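/- Assume the normalized setup with p > 0, let e ∈ ℝⁿ be a unit vector and β ∈ (0,1). Set S := {x ∈ Ω : u(x,−T) < 1} and suppose the directional derivative ∂_e u(·,−T) exists at every point of S̄ and has finite C^β norm ‖∂_e u(·,−T)‖_{C^β(S̄)} := sup_{S̄} |∂_e u(·,−T)| + sup_{x,y ∈ S̄, x ≠ y} |∂_e u(x,−T) − ∂_e u(y,−T)| / |x − y|^β. Then there exists α > 0, depending only on β and the universal constants, such that for every compact set K contained in {x ∈ Ω : u₀(x) < 1} there is a constant C(K), depending only on the universal constants and the distance from K to ∂{u₀ < 1}, with: ∂_e u₀ exists at every point of K and sup_K |∂_e u₀| + sup_{x,y ∈ K, x ≠ y} |∂_e u₀(x) − ∂_e u₀(y)| / |x − y|^α ≤ C(K) · ‖∂_e u(·,−T)‖_{C^β(S̄)}. -/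

import Mathlib

open Set Metric MeasureTheory
open scoped RealInnerProductSpace

noncomputable section

abbrev E (n : ℕ) := EuclideanSpace ℝ (Fin n)

variable {n : ℕ}

/-- The time derivative `∂ₜφ(x,t)`. -/
noncomputable def timeDeriv (φ : E n → ℝ → ℝ) (x : E n) (t : ℝ) : ℝ :=
  deriv (φ x) t

/-- The spatial Hessian matrix `D²φ(x,t)` (in the standard coordinates). -/
noncomputable def hessMatrix (φ : E n → ℝ → ℝ) (x : E n) (t : ℝ) :
    Matrix (Fin n) (Fin n) ℝ :=
  Matrix.of fun i j =>
    fderiv ℝ (fun y => fderiv ℝ (fun z => φ z t) y (EuclideanSpace.single j (1:ℝ))) x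
      (EuclideanSpace.single i (1:ℝ))

/-- `φ` is an admissible test function near `(x₀,t₀)`: C² in `x` and C¹ in `t` nearby. -/
def IsTestAt (φ : E n → ℝ → ℝ) (x₀ : E n) (t₀ : ℝ) : Prop :=
  ∃ ε > (0:ℝ),
    (∀ t ∈ ball t₀ ε, ContDiffOn ℝ 2 (fun x => φ x t) (ball x₀ ε)) ∧
    (∀ x ∈ ball x₀ ε, ContDiffOn ℝ 1 (fun t => φ x t) (ball t₀ ε))

/-- `u - φ` attains a local maximum at `(x₀,t₀)` among times `t ≤ t₀`,
relative to `closure Ω × [t₁,t₂]`. -/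
def LocalMaxBelow (Ω : Set (E n)) (t₁ t₂ : ℝ) (u φ : E n → ℝ → ℝ)
    (x₀ : E n) (t₀ : ℝ) : Prop :=
  ∃ ε > (0:ℝ), ∀ x ∈ closure Ω, ∀ t ∈ Icc t₁ t₂, t ≤ t₀ →
    dist x x₀ < ε → dist t t₀ < ε →
    u x t - φ x t ≤ u x₀ t₀ - φ x₀ t₀

/-- `u - φ` attains a local minimum at `(x₀,t₀)` among times `t ≤ t₀`. -/
def LocalMinBelow (Ω : Set (E n)) (t₁ t₂ : ℝ) (u φ : E n → ℝ → ℝ)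
    (x₀ : E n) (t₀ : ℝ) : Prop :=
  ∃ ε > (0:ℝ), ∀ x ∈ closure Ω, ∀ t ∈ Icc t₁ t₂, t ≤ t₀ →
    dist x x₀ < ε → dist t t₀ < ε →
    u x₀ t₀ - φ x₀ t₀ ≤ u x t - φ x t

/-- Viscosity subsolution of `u_t ≤ Λ (det D²u)^p` on `Ω × [t₁,t₂]`. -/
def ViscSubsolution (Lam p : ℝ) (Ω : Set (E n)) (t₁ t₂ : ℝ) (u : E n → ℝ → ℝ) : Prop :=
  ∀ x₀ ∈ Ω, ∀ t₀ ∈ Ioc t₁ t₂, ∀ φ : E n → ℝ → ℝ, IsTestAt φ x₀ t₀ →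
    LocalMaxBelow Ω t₁ t₂ u φ x₀ t₀ →
    timeDeriv φ x₀ t₀ ≤ Lam * max (hessMatrix φ x₀ t₀).det 0 ^ p

/-- Viscosity supersolution of `u_t ≥ λ (det D²u)^p` on `Ω × [t₁,t₂]`. -/
def ViscSupersolution (lam p : ℝ) (Ω : Set (E n)) (t₁ t₂ : ℝ) (u : E n → ℝ → ℝ) : Prop :=
  ∀ x₀ ∈ Ω, ∀ t₀ ∈ Ioc t₁ t₂, ∀ φ : E n → ℝ → ℝ, IsTestAt φ x₀ t₀ →
    LocalMinBelow Ω t₁ t₂ u φ x₀ t₀ →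
    (hessMatrix φ x₀ t₀).PosSemidef →
    lam * (hessMatrix φ x₀ t₀).det ^ p ≤ timeDeriv φ x₀ t₀

/-- The regularity/structure assumptions: continuity on `closure Ω × [t₁,t₂]`,
convexity in `x`, monotonicity in `t`. -/
structure ParabolicRegular (Ω : Set (E n)) (t₁ t₂ : ℝ) (u : E n → ℝ → ℝ) : Prop where
  cont : ContinuousOn (fun q : E n × ℝ => u q.1 q.2) (closure Ω ×ˢ Icc t₁ t₂)
  conv : ∀ t ∈ Icc t₁ t₂, ConvexOn ℝ (closure Ω) (fun x => u x t)
  mono : ∀ x ∈ closure Ω, ∀ s ∈ Icc t₁ t₂, ∀ t ∈ Icc t₁ t₂, s ≤ t → u x s ≤ u x t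

/-- Viscosity solution of `λ (det D²u)^p ≤ u_t ≤ Λ (det D²u)^p` on `Ω × [t₁,t₂]`. -/
def ViscositySolution (lam Lam p : ℝ) (Ω : Set (E n)) (t₁ t₂ : ℝ) (u : E n → ℝ → ℝ) : Prop :=
  ParabolicRegular Ω t₁ t₂ u ∧ ViscSubsolution Lam p Ω t₁ t₂ u ∧
    ViscSupersolution lam p Ω t₁ t₂ u

/-- `w` is `C^{1,α}` at `x₀` (relative to the set `D`) with some finite constant. -/
def C1AlphaAt (w : E n → ℝ) (D : Set (E n)) (α : ℝ) (x₀ : E n) : Prop :=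
  ∃ C a : ℝ, ∃ q : E n, ∀ x ∈ D, |w x - (a + ⟪q, x - x₀⟫)| ≤ C * ‖x - x₀‖ ^ (1 + α)

/-- `w` is `C^{1,α}` at `x₀` in the direction `e` (relative to the set `D`). -/
def C1AlphaDirAt (w : E n → ℝ) (D : Set (E n)) (α : ℝ) (x₀ e : E n) : Prop :=
  ∃ C a q : ℝ, ∀ s : ℝ, x₀ + s • e ∈ D →
    |w (x₀ + s • e) - (a + q * s)| ≤ C * |s| ^ (1 + α)

/-- A convex set `S` is `d`-balanced with respect to `x₀`. -/
def DBalanced (d : ℝ) (S : Set (E n)) (x₀ : E n) : Prop :=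
  ∃ A : E n →ₗ[ℝ] E n, Function.Bijective A ∧
    ball (0 : E n) 1 ⊆ A '' ((fun y => y - x₀) '' S) ∧
    A '' ((fun y => y - x₀) '' S) ⊆ ball (0 : E n) d

/-- `x₀` is an extremal point of the convex set `D`. -/
def ExtremalPoint (D : Set (E n)) (x₀ : E n) : Prop :=
  ¬ ∃ y ∈ closure D, ∃ z ∈ closure D, ∃ t : ℝ,
      0 < t ∧ t < 1 ∧ y ≠ z ∧ x₀ = t • y + (1 - t) • z

/-- The distance between two sets. -/
noncomputable def setDist {n : ℕ} (A B : Set (E n)) : ℝ :=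
  sInf (Set.image2 dist A B)

/-- Directional derivative of `w` at `x` in the direction `e`. -/
noncomputable def dirDeriv {n : ℕ} (w : E n → ℝ) (e x : E n) : ℝ :=
  deriv (fun s : ℝ => w (x + s • e)) 0

/-- The affine function with linear part `a.1` and constant term `a.2`. -/
def ev (a : (E n →L[ℝ] ℝ) × ℝ) (x : E n) : ℝ := a.1 x + a.2

lemma ev_add (a : (E n →L[ℝ] ℝ) × ℝ) (x v : E n) : ev a (x + v) = ev a x + a.1 v := by
  simp [ev]; ring

lemma ev_continuous (a : (E n →L[ℝ] ℝ) × ℝ) : Continuous (ev a) := by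
  unfold ev; fun_prop

/-- The quadratic test functions used as barriers. -/
def quadTest (q : (E n →L[ℝ] ℝ) × ℝ) (a : ℝ) (L : Fin n → (E n →L[ℝ] ℝ)) (z : E n)
    (v t₂ : ℝ) (x : E n) (t : ℝ) : ℝ :=
  ev q x + a * ∑ k, (L k (x - z)) ^ 2 + v * (t - t₂)

/-- The coordinate matrix of a family of functionals. -/
def funcMatrix (L : Fin n → (E n →L[ℝ] ℝ)) : Matrix (Fin n) (Fin n) ℝ :=
  Matrix.of fun k j => L k (EuclideanSpace.single j (1 : ℝ))

/-- The coordinate matrix of a family of vectors. -/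
def vecMatrix (B : Fin n → E n) : Matrix (Fin n) (Fin n) ℝ := Matrix.of fun i j => B i j

lemma quadTest_continuous (q : (E n →L[ℝ] ℝ) × ℝ) (a : ℝ) (L : Fin n → (E n →L[ℝ] ℝ)) (z : E n)
    (v t₂ : ℝ) : Continuous fun w : E n × ℝ => quadTest q a L z v t₂ w.1 w.2 := by
  unfold quadTest ev; fun_prop

lemma quadTest_isTestAt (q : (E n →L[ℝ] ℝ) × ℝ) (a : ℝ) (L : Fin n → (E n →L[ℝ] ℝ)) (z : E n)
    (v t₂ : ℝ) (x₀ : E n) (t₀ : ℝ) : IsTestAt (quadTest q a L z v t₂) x₀ t₀ := by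
  refine ⟨1, one_pos, fun t _ => ?_, fun x _ => ?_⟩
  · apply ContDiff.contDiffOn
    unfold quadTest ev; fun_prop
  · apply ContDiff.contDiffOn
    unfold quadTest ev; fun_prop

lemma quadTest_timeDeriv (q : (E n →L[ℝ] ℝ) × ℝ) (a : ℝ) (L : Fin n → (E n →L[ℝ] ℝ)) (z : E n)
    (v t₂ : ℝ) (x₀ : E n) (t₀ : ℝ) : timeDeriv (quadTest q a L z v t₂) x₀ t₀ = v := by
  unfold timeDeriv
  apply HasDerivAt.deriv
  unfold quadTest
  have h := ((hasDerivAt_id t₀).sub_const t₂).const_mul v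
  simpa using h.const_add (ev q x₀ + a * ∑ k, (L k (x₀ - z)) ^ 2)

lemma hasFDerivAt_apply_sub (l : E n →L[ℝ] ℝ) (z x₀ : E n) :
    HasFDerivAt (fun x : E n => l (x - z)) l x₀ := by
  simpa only [map_sub] using l.hasFDerivAt.sub_const (l z)

lemma quadTest_hasFDerivAt (q : (E n →L[ℝ] ℝ) × ℝ) (a : ℝ) (L : Fin n → (E n →L[ℝ] ℝ)) (z : E n)
    (v t₂ : ℝ) (x₀ : E n) (t₀ : ℝ) :
    HasFDerivAt (fun x => quadTest q a L z v t₂ x t₀)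
      (q.1 + a • ∑ k, (2 * L k (x₀ - z)) • L k) x₀ := by
  unfold quadTest ev
  have h1 : HasFDerivAt (fun x : E n => ∑ k, (L k (x - z)) ^ 2)
      (∑ k, (2 * L k (x₀ - z)) • L k) x₀ := by
    apply HasFDerivAt.fun_sum
    intro k _
    simpa [pow_one, two_mul] using (hasFDerivAt_apply_sub (L k) z x₀).pow 2
  have h3 := ((q.1.hasFDerivAt (x := x₀)).add_const q.2).add (h1.const_mul a)
  exact h3.add_const (v * (t₀ - t₂))

lemma quadTest_hessMatrix (q : (E n →L[ℝ] ℝ) × ℝ) (a : ℝ) (L : Fin n → (E n →L[ℝ] ℝ)) (z : E n)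
    (v t₂ : ℝ) (x₀ : E n) (t₀ : ℝ) :
    hessMatrix (quadTest q a L z v t₂) x₀ t₀ =
      (2 * a) • ((funcMatrix L).transpose * funcMatrix L) := by
  ext i j
  simp only [hessMatrix, Matrix.of_apply]
  have h1 : (fun y => fderiv ℝ (fun w => quadTest q a L z v t₂ w t₀) y
      (EuclideanSpace.single j (1:ℝ))) =
      fun y => q.1 (EuclideanSpace.single j (1:ℝ)) +
        ∑ k, (2 * a * L k (EuclideanSpace.single j (1:ℝ))) * L k (y - z) := by
    funext y
    rw [(quadTest_hasFDerivAt q a L z v t₂ y t₀).fderiv]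
    simp [Finset.mul_sum]
    apply Finset.sum_congr rfl
    intro k _
    ring
  rw [h1]
  have h2 : HasFDerivAt (fun y : E n => q.1 (EuclideanSpace.single j (1:ℝ)) +
        ∑ k, (2 * a * L k (EuclideanSpace.single j (1:ℝ))) * L k (y - z))
      (∑ k, (2 * a * L k (EuclideanSpace.single j (1:ℝ))) • L k) x₀ := by
    apply HasFDerivAt.const_add
    apply HasFDerivAt.fun_sum
    intro k _
    apply HasFDerivAt.const_mul
    exact hasFDerivAt_apply_sub (L k) z x₀
  rw [h2.fderiv]
  simp [Matrix.mul_apply, funcMatrix, Finset.mul_sum]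
  apply Finset.sum_congr rfl
  intro k _
  ring

lemma quadTest_det (q : (E n →L[ℝ] ℝ) × ℝ) (a : ℝ) (L : Fin n → (E n →L[ℝ] ℝ)) (z : E n)
    (v t₂ : ℝ) (x₀ : E n) (t₀ : ℝ) :
    (hessMatrix (quadTest q a L z v t₂) x₀ t₀).det = (2 * a) ^ n * (funcMatrix L).det ^ 2 := by
  rw [quadTest_hessMatrix, Matrix.det_smul, Matrix.det_mul, Matrix.det_transpose,
    Fintype.card_fin]
  ring

lemma quadTest_posSemidef (q : (E n →L[ℝ] ℝ) × ℝ) {a : ℝ} (ha : 0 ≤ a)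
    (L : Fin n → (E n →L[ℝ] ℝ)) (z : E n) (v t₂ : ℝ) (x₀ : E n) (t₀ : ℝ) :
    (hessMatrix (quadTest q a L z v t₂) x₀ t₀).PosSemidef := by
  rw [quadTest_hessMatrix]
  have h := Matrix.posSemidef_conjTranspose_mul_self (funcMatrix L)
  rw [Matrix.conjTranspose_eq_transpose_of_trivial] at h
  exact h.smul (by linarith)

/-- The functionals dual to a family of independent vectors. -/
lemma exists_dual (B : Fin n → E n) (hB : (vecMatrix B).det ≠ 0) :
    ∃ L : Fin n → (E n →L[ℝ] ℝ), (∀ v, v = ∑ k, L k v • B k) ∧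
      (∀ c : Fin n → ℝ, ∀ k, L k (∑ i, c i • B i) = c k) ∧
      (funcMatrix L).det = (vecMatrix B).det⁻¹ := by
  classical
  have hu : IsUnit (vecMatrix B).det := isUnit_iff_ne_zero.2 hB
  set M := (vecMatrix B)⁻¹ with hM
  let L : Fin n → (E n →L[ℝ] ℝ) := fun k => ∑ j, M j k • (EuclideanSpace.proj j : E n →L[ℝ] ℝ)
  have hL : ∀ k v, L k v = ∑ j, v j * M j k := by
    intro k v
    simp [L, mul_comm]
  refine ⟨L, ?_, ?_, ?_⟩
  · intro v
    ext i
    have h1 : M * vecMatrix B = 1 := Matrix.nonsing_inv_mul _ hu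
    have h2 : ∀ j, ∑ k, M j k * B k i = if j = i then 1 else 0 := by
      intro j
      have := congrFun (congrFun h1 j) i
      simpa [Matrix.mul_apply, vecMatrix, Matrix.one_apply] using this
    simp only [WithLp.ofLp_sum, WithLp.ofLp_smul, Finset.sum_apply, Pi.smul_apply, smul_eq_mul, hL,
      Finset.sum_mul]
    rw [Finset.sum_comm]
    simp only [mul_assoc, ← Finset.mul_sum, h2]
    simp
  · intro c k
    have h1 : vecMatrix B * M = 1 := Matrix.mul_nonsing_inv _ hu
    have h2 : ∀ i, L k (B i) = if i = k then 1 else 0 := by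
      intro i
      have := congrFun (congrFun h1 i) k
      simpa [Matrix.mul_apply, vecMatrix, Matrix.one_apply, hL] using this
    simp [h2]
  · have : funcMatrix L = M.transpose := by
      ext k j
      simp [funcMatrix, hL]
    rw [this, Matrix.det_transpose, hM, Matrix.det_nonsing_inv, Ring.inverse_eq_inv']

/-- Comparison with quadratic supersolutions. -/
lemma upper_barrier {Lam p T : ℝ} {Ω : Set (E n)} {u : E n → ℝ → ℝ}
    (hO : IsOpen Ω) (hc : Convex ℝ Ω)
    (hcont : ContinuousOn (fun q : E n × ℝ => u q.1 q.2) (closure Ω ×ˢ Icc (-T) 0))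
    (hsub : ViscSubsolution Lam p Ω (-T) 0 u)
    (q : (E n →L[ℝ] ℝ) × ℝ) (a : ℝ) (L : Fin n → (E n →L[ℝ] ℝ)) (z : E n) (v t₂ t : ℝ)
    (ht2 : -T ≤ t₂) (ht : t ≤ 0) (Z : Set (E n)) (hZ : IsCompact Z) (hZO : Z ⊆ closure Ω)
    (ha : 0 ≤ a)
    (hbot : ∀ x ∈ Z, u x t₂ ≤ quadTest q a L z v t₂ x t₂)
    (hlat : ∀ x ∈ Z, x ∉ interior Z → ∀ t' ∈ Icc t₂ t, u x t' ≤ quadTest q a L z v t₂ x t')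
    (hv : Lam * ((2 * a) ^ n * (funcMatrix L).det ^ 2) ^ p < v) :
    ∀ x ∈ Z, ∀ t' ∈ Icc t₂ t, u x t' ≤ quadTest q a L z v t₂ x t' := by
  by_contra! hcon
  obtain ⟨x1, hx1, t1, ht1, h1⟩ := hcon
  have hsubs : Z ×ˢ Icc t₂ t ⊆ closure Ω ×ˢ Icc (-T) 0 :=
    prod_mono hZO (Icc_subset_Icc ht2 ht)
  obtain ⟨⟨x0, t0⟩, hm0, hmax⟩ := (hZ.prod (isCompact_Icc (a := t₂) (b := t))).exists_isMaxOn
    ⟨(x1, t1), ⟨hx1, ht1⟩⟩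
    ((hcont.mono hsubs).sub (quadTest_continuous q a L z v t₂).continuousOn)
  have hx0 : x0 ∈ Z := hm0.1
  have ht0 : t0 ∈ Icc t₂ t := hm0.2
  have hpos : 0 < u x0 t0 - quadTest q a L z v t₂ x0 t0 := by
    have := hmax (show (x1, t1) ∈ Z ×ˢ Icc t₂ t from ⟨hx1, ht1⟩)
    change u x1 t1 - quadTest q a L z v t₂ x1 t1 ≤ u x0 t0 - quadTest q a L z v t₂ x0 t0 at this
    linarith
  have hxint : x0 ∈ interior Z := by
    by_contra hni
    linarith [hlat x0 hx0 hni t0 ht0]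
  have ht20 : t₂ < t0 := by
    rcases ht0.1.lt_or_eq with h | h
    · exact h
    · subst h
      linarith [hbot x0 hx0]
  have hx0O : x0 ∈ Ω := by
    have h3 : x0 ∈ interior (closure Ω) := interior_mono hZO hxint
    rwa [hc.interior_closure_eq_interior_of_nonempty_interior, hO.interior_eq] at h3
    rw [hO.interior_eq]
    exact closure_nonempty_iff.1 ⟨x0, hZO hx0⟩
  obtain ⟨ε, hε, hball⟩ := Metric.isOpen_iff.1 isOpen_interior x0 hxint
  have key := hsub x0 hx0O t0 ⟨by linarith, ht0.2.trans ht⟩ (quadTest q a L z v t₂)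
    (quadTest_isTestAt q a L z v t₂ x0 t0) ⟨min ε (t0 - t₂), lt_min hε (by linarith), by
      intro x _ t' _ htt hd1 hd2
      have hxZ : x ∈ Z := interior_subset (hball (lt_of_lt_of_le hd1 (min_le_left _ _)))
      have hd3 := lt_of_lt_of_le hd2 (min_le_right _ _)
      rw [Real.dist_eq, abs_lt] at hd3
      exact hmax (show (x, t') ∈ Z ×ˢ Icc t₂ t from ⟨hxZ, by linarith, htt.trans ht0.2⟩)⟩
  rw [quadTest_timeDeriv, quadTest_det, max_eq_left (by positivity)] at key
  linarith

/-- Comparison with quadratic subsolutions. -/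
lemma lower_barrier {lam p T : ℝ} {Ω : Set (E n)} {u : E n → ℝ → ℝ}
    (hO : IsOpen Ω) (hc : Convex ℝ Ω)
    (hcont : ContinuousOn (fun q : E n × ℝ => u q.1 q.2) (closure Ω ×ˢ Icc (-T) 0))
    (hsup : ViscSupersolution lam p Ω (-T) 0 u)
    (q : (E n →L[ℝ] ℝ) × ℝ) (a : ℝ) (L : Fin n → (E n →L[ℝ] ℝ)) (z : E n) (v t₂ t : ℝ)
    (ht2 : -T ≤ t₂) (ht : t ≤ 0) (Z : Set (E n)) (hZ : IsCompact Z) (hZO : Z ⊆ closure Ω)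
    (ha : 0 ≤ a)
    (hbot : ∀ x ∈ Z, quadTest q a L z v t₂ x t₂ ≤ u x t₂)
    (hlat : ∀ x ∈ Z, x ∉ interior Z → ∀ t' ∈ Icc t₂ t, quadTest q a L z v t₂ x t' ≤ u x t')
    (hv : v < lam * ((2 * a) ^ n * (funcMatrix L).det ^ 2) ^ p) :
    ∀ x ∈ Z, ∀ t' ∈ Icc t₂ t, quadTest q a L z v t₂ x t' ≤ u x t' := by
  by_contra! hcon
  obtain ⟨x1, hx1, t1, ht1, h1⟩ := hcon
  have hsubs : Z ×ˢ Icc t₂ t ⊆ closure Ω ×ˢ Icc (-T) 0 :=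
    prod_mono hZO (Icc_subset_Icc ht2 ht)
  obtain ⟨⟨x0, t0⟩, hm0, hmin⟩ := (hZ.prod (isCompact_Icc (a := t₂) (b := t))).exists_isMinOn
    ⟨(x1, t1), ⟨hx1, ht1⟩⟩
    ((hcont.mono hsubs).sub (quadTest_continuous q a L z v t₂).continuousOn)
  have hx0 : x0 ∈ Z := hm0.1
  have ht0 : t0 ∈ Icc t₂ t := hm0.2
  have hpos : u x0 t0 - quadTest q a L z v t₂ x0 t0 < 0 := by
    have := hmin (show (x1, t1) ∈ Z ×ˢ Icc t₂ t from ⟨hx1, ht1⟩)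
    change u x0 t0 - quadTest q a L z v t₂ x0 t0 ≤ u x1 t1 - quadTest q a L z v t₂ x1 t1 at this
    linarith
  have hxint : x0 ∈ interior Z := by
    by_contra hni
    linarith [hlat x0 hx0 hni t0 ht0]
  have ht20 : t₂ < t0 := by
    rcases ht0.1.lt_or_eq with h | h
    · exact h
    · subst h
      linarith [hbot x0 hx0]
  have hx0O : x0 ∈ Ω := by
    have h3 : x0 ∈ interior (closure Ω) := interior_mono hZO hxint
    rwa [hc.interior_closure_eq_interior_of_nonempty_interior, hO.interior_eq] at h3
    rw [hO.interior_eq]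
    exact closure_nonempty_iff.1 ⟨x0, hZO hx0⟩
  obtain ⟨ε, hε, hball⟩ := Metric.isOpen_iff.1 isOpen_interior x0 hxint
  have key := hsup x0 hx0O t0 ⟨by linarith, ht0.2.trans ht⟩ (quadTest q a L z v t₂)
    (quadTest_isTestAt q a L z v t₂ x0 t0) ⟨min ε (t0 - t₂), lt_min hε (by linarith), by
      intro x _ t' _ htt hd1 hd2
      have hxZ : x ∈ Z := interior_subset (hball (lt_of_lt_of_le hd1 (min_le_left _ _)))
      have hd3 := lt_of_lt_of_le hd2 (min_le_right _ _)
      rw [Real.dist_eq, abs_lt] at hd3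
      exact hmin (show (x, t') ∈ Z ×ˢ Icc t₂ t from ⟨hxZ, by linarith, htt.trans ht0.2⟩)⟩
    (quadTest_posSemidef q ha L z v t₂ x0 t0)
  rw [quadTest_timeDeriv, quadTest_det] at key
  linarith
/-- A convex function on the closure of an open convex set that lies above an affine function along
a line has an affine minorant extending it. -/
lemma exists_affine_minorant {Ω : Set (E n)} (hO : IsOpen Ω) (hc : Convex ℝ Ω) {g : E n → ℝ}
    (hgc : ContinuousOn g (closure Ω)) (hg : ConvexOn ℝ (closure Ω) g) {y e : E n} (hy : y ∈ Ω)
    {c g₀ : ℝ} (hline : ∀ τ : ℝ, y + τ • e ∈ Ω → c + g₀ * τ ≤ g (y + τ • e)) :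
    ∃ f : (E n →L[ℝ] ℝ) × ℝ, (∀ x ∈ closure Ω, ev f x ≤ g x) ∧ f.1 e = g₀ ∧ ev f y = c := by
  have hgO : ConvexOn ℝ Ω g := hg.subset subset_closure hc
  set s : Set (E n × ℝ) := {q | q.1 ∈ Ω ∧ g q.1 < q.2} with hs
  have hs1 : Convex ℝ s := hgO.convex_strict_epigraph
  have hs2 : IsOpen s := by
    have h1 : IsOpen (Ω ×ˢ (univ : Set ℝ)) := hO.prod isOpen_univ
    have h2 : ContinuousOn (fun q : E n × ℝ => q.2 - g q.1) (Ω ×ˢ (univ : Set ℝ)) := by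
      apply ContinuousOn.sub continuous_snd.continuousOn
      exact (hgc.mono subset_closure).comp continuous_fst.continuousOn (fun q hq => hq.1)
    have h3 := h2.isOpen_inter_preimage h1 (isOpen_Ioi (a := (0 : ℝ)))
    convert h3 using 1
    ext q
    simp [hs]
  set ln : Set (E n × ℝ) := range fun τ : ℝ => (y + τ • e, c + g₀ * τ) with hln
  have ht : Convex ℝ ln := by
    rintro _ ⟨a, rfl⟩ _ ⟨b, rfl⟩ α β _ _ hab
    refine ⟨α * a + β * b, ?_⟩
    have hα : α = 1 - β := by linarith
    subst hα
    ext1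
    · simp only [Prod.fst_add, Prod.smul_fst]
      module
    · simp only [Prod.snd_add, Prod.smul_snd, smul_eq_mul]
      ring
  have hdis : Disjoint s ln := by
    rw [Set.disjoint_left]
    rintro _ ⟨h1, h2⟩ ⟨τ, rfl⟩
    exact absurd (hline τ h1) (not_le.2 h2)
  obtain ⟨F, w, hF1, hF2⟩ := geometric_hahn_banach_open hs1 hs2 ht hdis
  set l : E n →L[ℝ] ℝ := F.comp (ContinuousLinearMap.inl ℝ (E n) ℝ) with hl
  set b : ℝ := F (0, 1) with hb
  have hF : ∀ x r, F (x, r) = l x + b * r := by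
    intro x r
    have : ((x, r) : E n × ℝ) = (x, 0) + r • ((0 : E n), (1 : ℝ)) := by ext1 <;> simp
    rw [this, map_add, map_smul]
    simp [hl, hb, mul_comm]
  have hlb : ∀ τ : ℝ, w ≤ l y + b * c + τ * (l e + b * g₀) := by
    intro τ
    have := hF2 _ ⟨τ, rfl⟩
    rw [hF, map_add, map_smul, smul_eq_mul] at this
    linarith
  have hcon : l e + b * g₀ = 0 := by
    by_contra hne
    have := hlb ((w - 1 - (l y + b * c)) / (l e + b * g₀))
    rw [div_mul_cancel₀ _ hne] at this
    linarith
  have hwy : w ≤ l y + b * c := by simpa using hlb 0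
  have hcy : c ≤ g y := by simpa using hline 0 (by simpa using hy)
  have hbneg : b < 0 := by
    have h1 := hF1 (y, g y + 1) ⟨hy, by simp⟩
    rw [hF] at h1
    have h2 : b * (g y + 1 - c) < 0 := by linarith
    by_contra! hb0
    nlinarith [mul_nonneg hb0 (show (0:ℝ) ≤ g y + 1 - c by linarith)]
  have hkey : ∀ x ∈ Ω, l x + b * g x ≤ l y + b * c := by
    intro x hx
    refine le_of_forall_pos_le_add fun ε hε => ?_
    have h1 := hF1 (x, g x + ε / (-b)) ⟨hx, by
      simp only; linarith [div_pos hε (neg_pos.2 hbneg)]⟩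
    rw [hF] at h1
    have h2 : b * (ε / (-b)) = -ε := by
      have hb0 := hbneg.ne
      field_simp
    rw [mul_add, h2] at h1
    linarith
  refine ⟨((-(1 / b)) • l, c + (1 / b) * l y), ?_, ?_, ?_⟩
  · intro x hx
    refine ContinuousWithinAt.closure_le hx (ev_continuous _).continuousWithinAt
      ((hgc x hx).mono subset_closure) fun z hz => ?_
    have h1 := hkey z hz
    have h2 : b * (g z - c) ≤ l y - l z := by linarith
    have h3 : (l y - l z) / b ≤ g z - c := by
      rw [div_le_iff_of_neg hbneg]; linarith
    simp only [ev, smul_apply, smul_eq_mul]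
    have h4 : (l y - l z) / b = -(1 / b) * l z + 1 / b * l y := by ring
    linarith
  · simp only [smul_apply, smul_eq_mul]
    have : l e = -(b * g₀) := by linarith
    have hb0 := hbneg.ne
    rw [this]; field_simp
  · simp only [ev, smul_apply, smul_eq_mul]; ring

lemma exists_affine_support {Ω : Set (E n)} (hO : IsOpen Ω) (hc : Convex ℝ Ω) {g : E n → ℝ}
    (hgc : ContinuousOn g (closure Ω)) (hg : ConvexOn ℝ (closure Ω) g) {y : E n} (hy : y ∈ Ω) :
    ∃ f : (E n →L[ℝ] ℝ) × ℝ, (∀ x ∈ closure Ω, ev f x ≤ g x) ∧ ev f y = g y := by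
  obtain ⟨f, h1, -, h2⟩ := exists_affine_minorant hO hc hgc hg (e := 0) hy (c := g y) (g₀ := 0)
    (by simp)
  exact ⟨f, h1, h2⟩
/-- The vertices `X` and `X + B i`, `i ≠ i₀`. -/
def vtx (X : E n) (B : Fin n → E n) (i₀ i : Fin n) : E n := X + Function.update B i₀ 0 i

lemma vtx_self (X : E n) (B : Fin n → E n) (i₀ : Fin n) : vtx X B i₀ i₀ = X := by simp [vtx]

lemma vtx_ne (X : E n) (B : Fin n → E n) {i₀ i : Fin n} (h : i ≠ i₀) :
    vtx X B i₀ i = X + B i := by simp [vtx, h]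

/-- A small box around the centre of a prism stays inside the convex hull of its vertices. -/
lemma prism_mem {C : Set (E n)} (hC : Convex ℝ C) {X : E n} {B : Fin n → E n} {i₀ : Fin n}
    (hP : ∀ i, vtx X B i₀ i ∈ C) {y k : E n} (hy : y ∈ C) (hyk : y + k ∈ C) {a : Fin n → ℝ}
    (ha : ∀ i, |a i| ≤ 1 / (4 * (n : ℝ) ^ 2)) :
    ∑ i, (1 / (2 * n) : ℝ) • vtx X B i₀ i + (1 / 2 : ℝ) • y + (1 / 4 : ℝ) • k
      + ∑ i, a i • Function.update B i₀ k i ∈ C := by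
  have hn : (1 : ℝ) ≤ n := by
    have := i₀.pos
    exact_mod_cast this
  have hn0 : (n : ℝ) ≠ 0 := by positivity
  set r : ℝ := 1 / (4 * (n : ℝ) ^ 2) with hr
  have hr0 : 0 < r := by positivity
  have hnr : n * r ≤ 1 / (4 * n) := by rw [hr]; apply le_of_eq; field_simp
  have hr1 : r ≤ n * r := by nlinarith
  have hr4 : 1 / (4 * (n : ℝ)) ≤ 1 / 4 := by
    apply one_div_le_one_div_of_le <;> linarith
  set a' : Fin n → ℝ := Function.update a i₀ 0 with ha'
  have ha'r : ∀ i, |a' i| ≤ r := by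
    intro i
    by_cases h : i = i₀
    · subst h; simp [a', hr0.le]
    · simpa [a', h] using ha i
  set σ : ℝ := ∑ i, a' i with hσ
  have hσr : |σ| ≤ n * r := by
    calc |σ| ≤ ∑ i, |a' i| := Finset.abs_sum_le_sum_abs _ _
      _ ≤ ∑ _i : Fin n, r := Finset.sum_le_sum fun i _ => ha'r i
      _ = n * r := by simp
  set w : Fin n → ℝ := fun i => 1 / n + 2 * a' i - (if i = i₀ then 2 * σ else 0) with hw
  have h2n : 1 / (n : ℝ) = 4 * (1 / (4 * n)) := by field_simp
  have hw0 : ∀ i, 0 ≤ w i := by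
    intro i
    have h1 := abs_le.1 (ha'r i)
    have h2 := abs_le.1 hσr
    have h3 : 0 < 1 / (4 * (n : ℝ)) := by positivity
    simp only [hw]
    split_ifs with h
    · linarith [h1.1, h2.2]
    · linarith [h1.1]
  have hw1 : ∑ i, w i = 1 := by
    simp only [hw, Finset.sum_sub_distrib, Finset.sum_add_distrib, ← Finset.mul_sum, ← hσ]
    simp [hn0]
  have hc1 : ∑ i, w i • vtx X B i₀ i ∈ C := hC.sum_mem (fun i _ => hw0 i) hw1 fun i _ => hP i
  have ha0 := abs_le.1 (ha i₀)
  have hc2 : (1 / 2 - 2 * a i₀) • y + (1 / 2 + 2 * a i₀) • (y + k) ∈ C :=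
    hC hy hyk (by linarith [ha0.2]) (by linarith [ha0.1]) (by ring)
  have h3 := hC hc1 hc2 (show (0 : ℝ) ≤ 1 / 2 by norm_num) (show (0 : ℝ) ≤ 1 / 2 by norm_num)
    (by norm_num)
  convert h3 using 1
  have e1 : ∑ i, w i • vtx X B i₀ i = ∑ i, (1 / n : ℝ) • vtx X B i₀ i
      + (2 : ℝ) • ∑ i, a' i • Function.update B i₀ k i := by
    have h5 : ∑ i, a' i • Function.update B i₀ k i
        = ∑ i, a' i • (vtx X B i₀ i) - σ • X := by
      rw [hσ, Finset.sum_smul, ← Finset.sum_sub_distrib]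
      apply Finset.sum_congr rfl
      intro i _
      by_cases h : i = i₀
      · subst h; simp [a']
      · simp [a', vtx, h]
    rw [h5]
    simp only [hw, sub_smul, add_smul, Finset.sum_sub_distrib, Finset.sum_add_distrib, ite_smul,
      zero_smul, Finset.sum_ite_eq', Finset.mem_univ, if_true, vtx_self, mul_smul,
      ← Finset.smul_sum]
    module
  have e2 : ∑ i, a i • Function.update B i₀ k i
      = ∑ i, a' i • Function.update B i₀ k i + a i₀ • k := by
    have h5 : ∀ i, a i • Function.update B i₀ k i = a' i • Function.update B i₀ k i
        + (if i = i₀ then a i₀ • k else 0) := by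
      intro i
      by_cases h : i = i₀
      · subst h; simp [a']
      · simp [a', h]
    simp only [h5, Finset.sum_add_distrib]
    simp
  have e3 : ∑ i, (1 / (2 * n) : ℝ) • vtx X B i₀ i
      = (1 / 2 : ℝ) • ∑ i, (1 / n : ℝ) • vtx X B i₀ i := by
    rw [Finset.smul_sum]
    apply Finset.sum_congr rfl
    intro i _
    rw [smul_smul]; congr 1; field_simp
  rw [e1, e2, e3]
  module

lemma convexOn_sub_ev {s : Set (E n)} {g : E n → ℝ} (hg : ConvexOn ℝ s g)
    (q : (E n →L[ℝ] ℝ) × ℝ) : ConvexOn ℝ s fun x => g x - ev q x := by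
  refine ⟨hg.1, fun x hx y hy a b ha hb hab => ?_⟩
  have h1 := hg.2 hx hy ha hb hab
  simp only [ev, map_add, map_smul, smul_eq_mul] at h1 ⊢
  have : q.2 = a * q.2 + b * q.2 := by rw [← add_mul, hab, one_mul]
  linarith

lemma vecMatrix_det_update_smul (B : Fin n → E n) (i : Fin n) (s : ℝ) :
    (vecMatrix (Function.update B i (s • B i))).det = s * (vecMatrix B).det := by
  have : vecMatrix (Function.update B i (s • B i))
      = (vecMatrix B).updateRow i (s • (vecMatrix B i)) := by
    ext j k
    by_cases h : j = i
    · subst h; simp [vecMatrix]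
    · simp [vecMatrix, h, Matrix.updateRow_ne]
  rw [this, Matrix.det_updateRow_smul, Matrix.updateRow_eq_self]

lemma vecMatrix_det_smul (B : Fin n → E n) (s : ℝ) :
    (vecMatrix (fun i => s • B i)).det = s ^ n * (vecMatrix B).det := by
  have : vecMatrix (fun i => s • B i) = s • vecMatrix B := by
    ext j k
    simp [vecMatrix]
  rw [this, Matrix.det_smul, Fintype.card_fin]

/-- Going back in time for a controlled amount, `u` cannot drop far below an affine minorant near
the centre of a prism. -/
lemma drop_bound {lam Lam p T : ℝ} {Ω : Set (E n)} {u : E n → ℝ → ℝ}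
    (hLam : 0 < Lam) (hO : IsOpen Ω) (hc : Convex ℝ Ω) (hbdd : Bornology.IsBounded Ω)
    (hsol : ViscositySolution lam Lam p Ω (-T) 0 u)
    {X y : E n} {B : Fin n → E n} {i₀ : Fin n} {s h t t₂ : ℝ} {q : (E n →L[ℝ] ℝ) × ℝ}
    (hB : (vecMatrix B).det ≠ 0) (hs : s ≠ 0) (hh : 0 < h)
    (ht : t ≤ 0) (ht2 : -T ≤ t₂) (htt : t₂ ≤ t)
    (hP : ∀ i, vtx X B i₀ i ∈ {x ∈ closure Ω | u x t - ev q x ≤ 5 * h})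
    (hy : y ∈ {x ∈ closure Ω | u x t - ev q x ≤ 5 * h})
    (hyk : y + s • B i₀ ∈ {x ∈ closure Ω | u x t - ev q x ≤ 5 * h})
    (hlow : ∀ x ∈ closure Ω, ev q x ≤ u x t)
    (hW : (t - t₂) * (2 * Lam * ((320 * (n : ℝ) ^ 2 * (4 * (n : ℝ) ^ 2) * h) ^ n
      / (s * (vecMatrix B).det) ^ 2) ^ p) ≤ 3 * h) :
    -13 * h ≤ u (y + (s / 2) • B i₀) t₂ - ev q (y + (s / 2) • B i₀) := by
  obtain ⟨hreg, hsub, -⟩ := hsol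
  by_contra! hcon
  have hn : (1 : ℝ) ≤ n := by
    have := i₀.pos
    exact_mod_cast this
  set r : ℝ := 1 / (4 * (n : ℝ) ^ 2) with hr
  have hr0 : 0 < r := by positivity
  have htm : t ∈ Icc (-T) 0 := ⟨ht2.trans htt, ht⟩
  have ht2m : t₂ ∈ Icc (-T) 0 := ⟨ht2, htt.trans ht⟩
  set S5 := {x ∈ closure Ω | u x t - ev q x ≤ 5 * h} with hS5
  have hS5c : Convex ℝ S5 := (convexOn_sub_ev (hreg.conv t htm) q).convex_le _
  set k : E n := s • B i₀ with hk
  set y' : E n := y + (s / 2) • B i₀ with hy'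
  have hy'S : y' ∈ S5 := by
    have := hS5c hy hyk (show (0 : ℝ) ≤ 1 / 2 by norm_num) (show (0 : ℝ) ≤ 1 / 2 by norm_num)
      (by norm_num)
    convert this using 1
    rw [hy', hk]; module
  set V : Fin n → E n := fun i => (1 / 2 : ℝ) • Function.update B i₀ k i with hV
  have hdetV : (vecMatrix V).det = (1 / 2) ^ n * (s * (vecMatrix B).det) := by
    rw [hV, vecMatrix_det_smul, hk, vecMatrix_det_update_smul]
  have hdetV0 : (vecMatrix V).det ≠ 0 := by
    rw [hdetV]; positivity
  obtain ⟨L, hL1, hL2, hL3⟩ := exists_dual V hdetV0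
  set Pc : E n := ∑ i, (1 / (2 * n) : ℝ) • vtx X B i₀ i + (1 / 2 : ℝ) • y + (1 / 4 : ℝ) • k
    with hPc
  set z : E n := (1 / 2 : ℝ) • y' + (1 / 2 : ℝ) • Pc with hz
  set Z : Set (E n) := {x | ∑ i, (L i (x - z)) ^ 2 ≤ r ^ 2} with hZ
  have hcontf : Continuous fun x : E n => ∑ i, (L i (x - z)) ^ 2 := by fun_prop
  have hdec : ∀ x ∈ Z, ∃ c ∈ S5, x = (1 / 2 : ℝ) • y' + (1 / 2 : ℝ) • c := by
    intro x hx
    refine ⟨Pc + ∑ i, L i (x - z) • Function.update B i₀ k i, ?_, ?_⟩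
    · apply prism_mem hS5c hP hy hyk
      intro i
      apply abs_le_of_sq_le_sq _ hr0.le
      exact (Finset.single_le_sum (f := fun i => (L i (x - z)) ^ 2) (fun j _ => sq_nonneg _)
        (Finset.mem_univ i)).trans hx
    · have h1 := hL1 (x - z)
      have h2 : ∑ k, L k (x - z) • V k
          = (1 / 2 : ℝ) • ∑ i, L i (x - z) • Function.update B i₀ k i := by
        rw [Finset.smul_sum]
        apply Finset.sum_congr rfl
        intro i _
        simp only [hV]
        rw [smul_comm]
      rw [h2] at h1
      generalize ∑ i, L i (x - z) • Function.update B i₀ k i = σ at h1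
      have h3 : x = z + (1 / 2 : ℝ) • σ := by rw [← h1]; abel
      rw [h3, hz]
      module
  have hZS : Z ⊆ S5 := by
    intro x hx
    obtain ⟨c, hc, rfl⟩ := hdec x hx
    exact hS5c hy'S hc (by norm_num) (by norm_num) (by norm_num)
  have hZO : Z ⊆ closure Ω := fun x hx => (hZS hx).1
  have hZc : IsCompact Z := by
    apply Metric.isCompact_of_isClosed_isBounded
    · exact isClosed_le hcontf continuous_const
    · exact hbdd.closure.subset hZO
  set D : ℝ := ((320 * (n : ℝ) ^ 2 * (4 * (n : ℝ) ^ 2) * h) ^ n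
      / (s * (vecMatrix B).det) ^ 2) ^ p with hD
  have hD0 : 0 < D := by
    apply Real.rpow_pos_of_pos
    positivity
  have hev : ∀ x, ev (q.1, q.2 - 4 * h) x = ev q x - 4 * h := by
    intro x; simp only [ev]; ring
  have key := upper_barrier hO hc hreg.cont hsub (q.1, q.2 - 4 * h) (10 * h / r ^ 2) L z
    (2 * Lam * D) t₂ t ht2 ht Z hZc hZO (by positivity) ?_ ?_ ?_
  · have hzZ : z ∈ Z := by
      simp only [hZ, mem_ofPred_eq, sub_self, map_zero]
      simp; positivity
    have h1 := key z hzZ t ⟨htt, le_rfl⟩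
    have h2 := hlow z (hZO hzZ)
    simp only [quadTest, hev, sub_self, map_zero] at h1
    simp only [ne_eq, OfNat.ofNat_ne_zero, not_false_eq_true, zero_pow, Finset.sum_const_zero,
      mul_zero, add_zero] at h1
    nlinarith
  · intro x hx
    obtain ⟨c, hcS, hxc⟩ := hdec x hx
    have hcv := convexOn_sub_ev (hreg.conv t₂ ht2m) q
    have h1 := hcv.2 hy'S.1 hcS.1 (show (0 : ℝ) ≤ 1 / 2 by norm_num)
      (show (0 : ℝ) ≤ 1 / 2 by norm_num) (by norm_num)
    rw [← hxc] at h1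
    simp only [smul_eq_mul] at h1
    have h2 := hreg.mono c hcS.1 t₂ ht2m t htm htt
    have h3 := hcS.2
    simp only [quadTest, hev, sub_self, mul_zero, add_zero]
    have h4 : 0 ≤ 10 * h / r ^ 2 * ∑ i, (L i (x - z)) ^ 2 :=
      mul_nonneg (by positivity) (Finset.sum_nonneg fun i _ => sq_nonneg _)
    linarith
  · intro x hx hxi t' ht'
    have h1 : r ^ 2 ≤ ∑ i, (L i (x - z)) ^ 2 := by
      by_contra! hlt
      apply hxi
      refine mem_interior.2 ⟨{x | ∑ i, (L i (x - z)) ^ 2 < r ^ 2}, fun w hw => ?_,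
        isOpen_lt hcontf continuous_const, hlt⟩
      exact hw.out.le
    have h2 := (hZS hx).2
    have h3 := hreg.mono x (hZO hx) t' ⟨ht2.trans ht'.1, ht'.2.trans ht⟩ t htm ht'.2
    simp only [quadTest, hev]
    have h4 : 10 * h ≤ 10 * h / r ^ 2 * ∑ i, (L i (x - z)) ^ 2 := by
      calc 10 * h = 10 * h / r ^ 2 * r ^ 2 := by field_simp
        _ ≤ _ := by gcongr
    have h5 : 0 ≤ 2 * Lam * D * (t' - t₂) :=
      mul_nonneg (by positivity) (by linarith [ht'.1])
    linarith
  · have h1 : (2 * (10 * h / r ^ 2)) ^ n * (funcMatrix L).det ^ 2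
        = (320 * (n : ℝ) ^ 2 * (4 * (n : ℝ) ^ 2) * h) ^ n / (s * (vecMatrix B).det) ^ 2 := by
      rw [hL3, hdetV]
      have h2 : 2 * (10 * h / r ^ 2) = (1 / 2) ^ 2 * (320 * (n : ℝ) ^ 2 * (4 * (n : ℝ) ^ 2) * h) := by
        rw [hr]; field_simp; ring
      rw [h2, mul_pow ((1 / 2 : ℝ) ^ 2), ← pow_mul, mul_comm 2 n, pow_mul]
      field_simp
    rw [h1, ← hD]
    have : 0 < Lam * D := by positivity
    linarith
/-- A point close to `X`, pulled towards the interior point `xs`. -/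
def apex (X xs : E n) : E n := (3 / 4 : ℝ) • X + (1 / 4 : ℝ) • xs

/-- The average of the vertices and of the apex. -/
def ctr (X : E n) (B : Fin n → E n) (i₀ : Fin n) (xs : E n) : E n :=
  (1 / (n + 1) : ℝ) • (∑ i, vtx X B i₀ i + apex X xs)

lemma ev_smul_add_smul (f : (E n →L[ℝ] ℝ) × ℝ) {a b : ℝ} (hab : a + b = 1) (x y : E n) :
    ev f (a • x + b • y) = a * ev f x + b * ev f y := by
  simp only [ev, map_add, map_smul, smul_eq_mul]
  have : f.2 = a * f.2 + b * f.2 := by rw [← add_mul, hab, one_mul]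
  linarith

lemma ev_apex (f : (E n →L[ℝ] ℝ) × ℝ) (X xs : E n) :
    ev f xs = 4 * ev f (apex X xs) - 3 * ev f X := by
  rw [apex, ev_smul_add_smul f (by norm_num)]; ring

lemma ev_ctr (f : (E n →L[ℝ] ℝ) × ℝ) (X : E n) (B : Fin n → E n) (i₀ : Fin n) (xs : E n) :
    (n + 1) * ev f (ctr X B i₀ xs) = ∑ i, ev f (vtx X B i₀ i) + ev f (apex X xs) := by
  have : (n + 1 : ℝ) ≠ 0 := by positivity
  simp only [ev, ctr, map_add, map_smul, map_sum, smul_eq_mul, Finset.sum_add_distrib]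
  simp
  field_simp
  ring

lemma ev_vtx_ge {f : (E n →L[ℝ] ℝ) × ℝ} {X : E n} {B : Fin n → E n} {i₀ : Fin n} {xs : E n}
    {b m : ℝ} (hv : ∀ i, ev f (vtx X B i₀ i) ≤ b) (ha : ev f (apex X xs) ≤ b)
    (hm : m ≤ ev f (ctr X B i₀ xs)) (i : Fin n) : (n + 1) * m - n * b ≤ ev f (vtx X B i₀ i) := by
  have h1 := ev_ctr f X B i₀ xs
  have h2 : ∑ j, ev f (vtx X B i₀ j) ≤ (n - 1) * b + ev f (vtx X B i₀ i) := by
    rw [← Finset.sum_erase_add _ _ (Finset.mem_univ i)]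
    gcongr
    have h3 := Finset.sum_le_card_nsmul (Finset.univ.erase i) (fun j => ev f (vtx X B i₀ j)) b
      fun j _ => hv j
    have h4 : ((Finset.univ.erase i).card : ℝ) = n - 1 := by
      rw [Finset.card_erase_of_mem (Finset.mem_univ i), Finset.card_univ, Fintype.card_fin,
        Nat.cast_sub (by have := i.pos; omega), Nat.cast_one]
    rwa [nsmul_eq_mul, h4] at h3
  have h5 : (n + 1) * m ≤ (n + 1) * ev f (ctr X B i₀ xs) := by gcongr
  linarith

lemma ev_apex_ge {f : (E n →L[ℝ] ℝ) × ℝ} {X : E n} {B : Fin n → E n} {i₀ : Fin n} {xs : E n}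
    {b m : ℝ} (hv : ∀ i, ev f (vtx X B i₀ i) ≤ b)
    (hm : m ≤ ev f (ctr X B i₀ xs)) : (n + 1) * m - n * b ≤ ev f (apex X xs) := by
  have h1 := ev_ctr f X B i₀ xs
  have h2 : ∑ j, ev f (vtx X B i₀ j) ≤ n * b := by
    have h3 := Finset.sum_le_card_nsmul Finset.univ (fun j => ev f (vtx X B i₀ j)) b
      fun j _ => hv j
    simpa using h3
  have h5 : (n + 1) * m ≤ (n + 1) * ev f (ctr X B i₀ xs) := by gcongr
  linarith

lemma apex_mem {C : Set (E n)} (hC : Convex ℝ C) {X xs : E n} (hX : X ∈ C) (hxs : xs ∈ C) :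
    apex X xs ∈ C := hC hX hxs (by norm_num) (by norm_num) (by norm_num)

lemma ctr_mem {C : Set (E n)} (hC : Convex ℝ C) {X : E n} {B : Fin n → E n} {i₀ : Fin n}
    {xs : E n} (hP : ∀ i, vtx X B i₀ i ∈ C) (ha : apex X xs ∈ C) : ctr X B i₀ xs ∈ C := by
  have hn : (n : ℝ) ≠ 0 := by
    have := i₀.pos
    positivity
  have h1 : ∑ i, (1 / n : ℝ) • vtx X B i₀ i ∈ C :=
    hC.sum_mem (fun i _ => by positivity) (by simp [hn]) fun i _ => hP i
  have h2 := hC h1 ha (show (0 : ℝ) ≤ n / (n + 1) by positivity)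
    (show (0 : ℝ) ≤ 1 / (n + 1) by positivity) (by field_simp)
  convert h2 using 1
  rw [ctr, smul_add, Finset.smul_sum, Finset.smul_sum]
  congr 1
  apply Finset.sum_congr rfl
  intro i _
  rw [smul_smul]
  congr 1
  field_simp

lemma ctr_add_mem {Ω : Set (E n)} (hO : IsOpen Ω) (hc : Convex ℝ Ω) {X : E n} {B : Fin n → E n}
    {i₀ : Fin n} {xs : E n} {d : ℝ} (hb : ball xs d ⊆ Ω) (hd : 0 < d)
    (hP : ∀ i, vtx X B i₀ i ∈ closure Ω) {v : E n} (hv : ‖v‖ < d / (4 * (n + 1))) :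
    ctr X B i₀ xs + v ∈ Ω := by
  have hn : (0 : ℝ) < n := by
    have := i₀.pos
    exact_mod_cast this
  set w : ℝ := 1 / (4 * (n + 1)) with hw
  have hw0 : 0 < w := by positivity
  have hxv : xs + w⁻¹ • v ∈ Ω := by
    apply hb
    rw [mem_ball, dist_eq_norm, add_sub_cancel_left, norm_smul, Real.norm_of_nonneg (by positivity)]
    rw [lt_div_iff₀ (by positivity)] at hv
    rw [hw, one_div, inv_inv]
    linarith
  have hcc : Convex ℝ (closure Ω) := hc.closure
  have hxs : xs ∈ closure Ω := subset_closure (hb (mem_ball_self hd))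
  have h1 : ∑ i, (1 / n : ℝ) • vtx X B i₀ i ∈ closure Ω :=
    hcc.sum_mem (fun i _ => by positivity) (by simp [hn.ne']) fun i _ => hP i
  have hX : X ∈ closure Ω := by simpa [vtx_self] using hP i₀
  have h2 : (n / (n + 3 / 4) : ℝ) • ∑ i, (1 / n : ℝ) • vtx X B i₀ i
      + ((3 / 4) / (n + 3 / 4) : ℝ) • X ∈ closure Ω :=
    hcc h1 hX (by positivity) (by positivity) (by field_simp)
  have h3 := hc.combo_closure_interior_mem_interior h2 (hO.interior_eq.symm ▸ hxv)
    (a := 1 - w) (b := w) (by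
      rw [hw, sub_nonneg, div_le_one (by positivity)]; linarith) hw0 (by ring)
  rw [hO.interior_eq] at h3
  convert h3 using 1
  have e1 : (1 - w) * (n / (n + 3 / 4)) * (1 / n) = 1 / (n + 1) := by
    rw [hw]; field_simp; ring
  have e2 : (1 - w) * ((3 / 4) / (n + 3 / 4)) = 3 / 4 * (1 / (n + 1)) := by
    rw [hw]; field_simp; ring
  have e3 : w = 1 / 4 * (1 / (n + 1)) := by rw [hw]; field_simp
  rw [smul_add (1 - w), smul_smul, smul_smul, ← Finset.smul_sum, smul_smul, e1, e2, smul_add w,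
    smul_smul, mul_inv_cancel₀ hw0.ne', one_smul, ctr, apex, e3]
  module

/-- The standing assumptions at an interior point `xs`. -/
structure Ctx (lam Lam p T : ℝ) (Ω : Set (E n)) (u : E n → ℝ → ℝ) (e xs : E n) (N d β : ℝ) :
    Prop where
  lam_pos : 0 < lam
  lam_le : lam ≤ Lam
  p_pos : 0 < p
  isOpen : IsOpen Ω
  conv : Convex ℝ Ω
  bdd : ∃ y₀, Ω ⊆ ball y₀ 1
  T_pos : 0 < T
  sol : ViscositySolution lam Lam p Ω (-T) 0 u
  bdry : ∀ x ∈ frontier Ω, ∀ t ∈ Icc (-T) 0, 1 < u x t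
  e_norm : ‖e‖ = 1
  d_pos : 0 < d
  d_le : d ≤ 1
  ball_sub : ball xs d ⊆ {x ∈ Ω | u x 0 < 1}
  N_ge : 1 / 2 ≤ N
  lower : ∀ x ∈ closure Ω, ∀ t ∈ Icc (-T) 0, 1 - 2 * N ≤ u x t
  init : ∀ s, 0 < s → s < d →
    u (xs + s • e) (-T) + u (xs - s • e) (-T) - 2 * u xs (-T) ≤ 2 * N * s ^ (1 + β)

/-- Two affine minorants `Q ± G / 2` of `u(·,t)` splitting in the direction `e`, together with a
prism of points where their average is `h`-close to `u`. -/
structure Valid (T : ℝ) (Ω : Set (E n)) (u : E n → ℝ → ℝ) (e xs : E n) (N : ℝ) (i₀ : Fin n)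
    (t : ℝ) (Q G : (E n →L[ℝ] ℝ) × ℝ) (h : ℝ) (X : E n) (B : Fin n → E n) : Prop where
  t_mem : t ∈ Icc (-T) 0
  h_pos : 0 < h
  h_le : h ≤ N
  lower : ∀ x ∈ closure Ω, ev Q x + |ev G x| / 2 ≤ u x t
  dir : B i₀ = e
  vtx_mem : ∀ i, vtx X B i₀ i ∈ closure Ω
  vtx_gap : ∀ i, u (vtx X B i₀ i) t - ev Q (vtx X B i₀ i) ≤ h
  xs_gap : u xs t - ev Q xs ≤ 4 * h
  J_pos : 0 < G.1 e
  det_ne : (vecMatrix B).det ≠ 0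

section
variable {lam Lam p T : ℝ} {Ω : Set (E n)} {u : E n → ℝ → ℝ} {e xs : E n} {N d β : ℝ}
  {i₀ : Fin n} {t : ℝ} {Q G : (E n →L[ℝ] ℝ) × ℝ} {h : ℝ} {X : E n} {B : Fin n → E n}

lemma Ctx.xs_mem (c : Ctx lam Lam p T Ω u e xs N d β) : xs ∈ Ω :=
  (c.ball_sub (mem_ball_self c.d_pos)).1

lemma Ctx.ball_sub' (c : Ctx lam Lam p T Ω u e xs N d β) : ball xs d ⊆ Ω :=
  fun _ hx => (c.ball_sub hx).1

lemma Ctx.isBounded (c : Ctx lam Lam p T Ω u e xs N d β) : Bornology.IsBounded Ω := by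
  obtain ⟨y₀, hy⟩ := c.bdd
  exact isBounded_ball.subset hy

lemma Ctx.contSlice (c : Ctx lam Lam p T Ω u e xs N d β) (ht : t ∈ Icc (-T) 0) :
    ContinuousOn (fun x => u x t) (closure Ω) :=
  c.sol.1.cont.comp (f := fun x : E n => (x, t)) (by fun_prop) fun _ hx => ⟨hx, ht⟩

lemma Ctx.gapConvex (c : Ctx lam Lam p T Ω u e xs N d β) (ht : t ∈ Icc (-T) 0)
    (Q : (E n →L[ℝ] ℝ) × ℝ) : ConvexOn ℝ (closure Ω) fun x => u x t - ev Q x :=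
  convexOn_sub_ev (c.sol.1.conv t ht) Q

lemma Valid.X_mem (v : Valid T Ω u e xs N i₀ t Q G h X B) : X ∈ closure Ω := by
  simpa [vtx_self] using v.vtx_mem i₀

lemma Valid.X_gap (v : Valid T Ω u e xs N i₀ t Q G h X B) : u X t - ev Q X ≤ h := by
  simpa [vtx_self] using v.vtx_gap i₀

lemma Valid.apex_mem (c : Ctx lam Lam p T Ω u e xs N d β)
    (v : Valid T Ω u e xs N i₀ t Q G h X B) :
    apex X xs ∈ {x ∈ closure Ω | u x t - ev Q x ≤ 2 * h} := by
  have hcv := c.gapConvex v.t_mem Q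
  have h1 := hcv.2 v.X_mem (subset_closure c.xs_mem) (show (0 : ℝ) ≤ 3 / 4 by norm_num)
    (show (0 : ℝ) ≤ 1 / 4 by norm_num) (by norm_num)
  refine ⟨_root_.apex_mem c.conv.closure v.X_mem (subset_closure c.xs_mem), ?_⟩
  have h2 := v.X_gap
  have h3 := v.xs_gap
  have h4 := v.h_pos
  simp only [smul_eq_mul] at h1
  rw [apex]
  linarith

lemma Valid.ctr_mem (c : Ctx lam Lam p T Ω u e xs N d β)
    (v : Valid T Ω u e xs N i₀ t Q G h X B) :
    ctr X B i₀ xs ∈ {x ∈ closure Ω | u x t - ev Q x ≤ 2 * h} := by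
  refine _root_.ctr_mem ((c.gapConvex v.t_mem Q).convex_le _) (fun i => ⟨v.vtx_mem i, ?_⟩)
    (v.apex_mem c)
  linarith [v.vtx_gap i, v.h_pos]

lemma Valid.ctr_add_mem (c : Ctx lam Lam p T Ω u e xs N d β)
    (v : Valid T Ω u e xs N i₀ t Q G h X B) {τ : ℝ} (hτ : |τ| < d / (4 * (n + 1))) :
    ctr X B i₀ xs + τ • e ∈ Ω := by
  refine _root_.ctr_add_mem c.isOpen c.conv c.ball_sub' c.d_pos v.vtx_mem ?_
  rwa [norm_smul, c.e_norm, mul_one, Real.norm_eq_abs]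

/-- If `u` grows fast on one side of the centre, the two planes can be made steeper. -/
lemma steepen (c : Ctx lam Lam p T Ω u e xs N d β)
    (v : Valid T Ω u e xs N i₀ t Q G h X B) {s δ : ℝ} (hs : 0 < s) (hsd : s < d / (4 * (n + 1)))
    (hδ : δ = 1 ∨ δ = -1) (hN : 6 * (n + 1) * h ≤ N)
    (hfast : G.1 e * s / 2 + 3 * h
      < u (ctr X B i₀ xs + (δ * s) • e) t - ev Q (ctr X B i₀ xs + (δ * s) • e)) :
    ∃ Q' G' : (E n →L[ℝ] ℝ) × ℝ, Valid T Ω u e xs N i₀ t Q' G' (6 * (n + 1) * h) X B ∧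
      G'.1 e = G.1 e + h / s ∧ 1 - ev Q X - h ≤ 1 - ev Q' X := by
  have hh := v.h_pos
  have hJ := v.J_pos
  have hδ2 : δ * δ = 1 := by rcases hδ with rfl | rfl <;> norm_num
  have hδa : |δ| = 1 := by rcases hδ with rfl | rfl <;> norm_num
  have hcv := c.gapConvex v.t_mem Q
  set y := ctr X B i₀ xs with hy
  have hyg := (v.ctr_mem c).2
  have hyO : y ∈ Ω := by
    have := v.ctr_add_mem c (τ := 0) (by rw [abs_zero]; exact hs.trans hsd)
    simpa using this
  have hysO : y + (δ * s) • e ∈ Ω := v.ctr_add_mem c (by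
    rwa [abs_mul, hδa, one_mul, abs_of_pos hs])
  have hlow := v.lower
  have hGy : |ev G y| ≤ 4 * h := by
    have := hlow y (subset_closure hyO)
    linarith
  have hline : ∀ τ : ℝ, y + τ • e ∈ Ω →
      -3 * h + (δ * (G.1 e / 2 + h / s)) * τ ≤ u (y + τ • e) t - ev Q (y + τ • e) := by
    intro τ hτ
    obtain ⟨σ, rfl⟩ : ∃ σ, τ = δ * σ := ⟨δ * τ, by rw [← mul_assoc, hδ2, one_mul]⟩
    have e1 : δ * (G.1 e / 2 + h / s) * (δ * σ) = (G.1 e / 2 + h / s) * σ := by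
      linear_combination (G.1 e / 2 + h / s) * σ * hδ2
    rw [e1]
    have hhs : 0 < h / s := by positivity
    have h1 := hlow _ (subset_closure hτ)
    rcases le_total σ 0 with hσ | hσ
    · have h2 : 0 ≤ |ev G (y + (δ * σ) • e)| := abs_nonneg _
      nlinarith
    rcases le_total σ s with hσs | hσs
    · have h2 : ev G (y + (δ * σ) • e) = ev G y + δ * σ * G.1 e := by
        rw [ev_add, map_smul, smul_eq_mul]
      have h3 : δ * ev G y + σ * G.1 e ≤ |ev G (y + (δ * σ) • e)| := by
        have h4 : δ * ev G (y + (δ * σ) • e) ≤ |ev G (y + (δ * σ) • e)| := by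
          calc _ ≤ |δ * ev G (y + (δ * σ) • e)| := le_abs_self _
            _ = _ := by rw [abs_mul, hδa, one_mul]
        rw [h2] at h4 ⊢
        linear_combination h4 - σ * G.1 e * hδ2
      have h5 : -(4 * h) ≤ δ * ev G y := by
        have : |δ * ev G y| ≤ 4 * h := by rwa [abs_mul, hδa, one_mul]
        exact (abs_le.1 this).1
      have h6 : h / s * σ ≤ h := by
        rw [div_mul_eq_mul_div, div_le_iff₀ hs]
        gcongr
      linarith
    · have hσ0 : 0 < σ := hs.trans_le hσs
      have h2 := hcv.2 (subset_closure hyO) (subset_closure hτ)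
        (show (0 : ℝ) ≤ 1 - s / σ by rw [sub_nonneg, div_le_one hσ0]; exact hσs)
        (show (0 : ℝ) ≤ s / σ by positivity) (by ring)
      have h3 : (1 - s / σ) • y + (s / σ) • (y + (δ * σ) • e) = y + (δ * s) • e := by
        have : s / σ * (δ * σ) = δ * s := by field_simp
        rw [smul_add, smul_smul, this]; module
      rw [h3] at h2
      simp only [smul_eq_mul] at h2
      have h4 : G.1 e * s / 2 + 3 * h ≤ (1 - s / σ) * (2 * h)
          + s / σ * (u (y + (δ * σ) • e) t - ev Q (y + (δ * σ) • e)) := by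
        have : (1 - s / σ) * (u y t - ev Q y) ≤ (1 - s / σ) * (2 * h) := by
          apply mul_le_mul_of_nonneg_left hyg
          rw [sub_nonneg, div_le_one hσ0]; exact hσs
        linarith
      have h5 := mul_le_mul_of_nonneg_left h4 (show (0 : ℝ) ≤ σ / s by positivity)
      have h6 : σ / s * ((1 - s / σ) * (2 * h)
          + s / σ * (u (y + (δ * σ) • e) t - ev Q (y + (δ * σ) • e)))
          = (σ / s - 1) * (2 * h) + (u (y + (δ * σ) • e) t - ev Q (y + (δ * σ) • e)) := by
        field_simp
      have h7 : σ / s * (G.1 e * s / 2 + 3 * h) = G.1 e / 2 * σ + 3 * (h / s * σ) := by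
        field_simp
      have h8 : (σ / s - 1) * (2 * h) = 2 * (h / s * σ) - 2 * h := by field_simp
      rw [h6, h7, h8] at h5
      linarith
  obtain ⟨f, hf1, hf2, hf3⟩ := exists_affine_minorant c.isOpen c.conv
    (g := fun x => u x t - ev Q x)
    ((c.contSlice v.t_mem).sub (ev_continuous Q).continuousOn) hcv hyO hline
  have hfv : ∀ i, ev f (vtx X B i₀ i) ≤ 2 * h := fun i => by
    have h1 := hf1 _ (v.vtx_mem i)
    have h2 := v.vtx_gap i
    linarith
  have hfa : ev f (apex X xs) ≤ 2 * h := (hf1 _ (v.apex_mem c).1).trans (v.apex_mem c).2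
  have hfv' := fun i => ev_vtx_ge hfv hfa hf3.ge i
  have hfa' := ev_apex_ge hfv hf3.ge (xs := xs)
  have hfX : ev f X ≤ h := by
    have h1 := hf1 _ v.X_mem
    linarith [v.X_gap]
  have hfxs := ev_apex f X xs
  have hev : ∀ x, ev (Q + (1 / 2 : ℝ) • f - (δ / 4) • G) x
      = ev Q x + ev f x / 2 - δ * ev G x / 4 := by
    intro x; simp [ev]; ring
  have hevG : ∀ x, ev (δ • f + (1 / 2 : ℝ) • G) x = δ * ev f x + ev G x / 2 := by
    intro x; simp [ev]; ring
  have hδG : ∀ x ∈ closure Ω, -(u x t - ev Q x) ≤ δ * ev G x / 2 ∧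
      δ * ev G x / 2 ≤ u x t - ev Q x := by
    intro x hx
    have h1 := hlow x hx
    have h2 : |δ * ev G x| = |ev G x| := by rw [abs_mul, hδa, one_mul]
    rw [← h2] at h1
    have h3 := abs_le.1 (show |δ * ev G x| ≤ 2 * (u x t - ev Q x) by linarith)
    constructor <;> linarith [h3.1, h3.2]
  have hlow' : ∀ x ∈ closure Ω, ev (Q + (1 / 2 : ℝ) • f - (δ / 4) • G) x
      + |ev (δ • f + (1 / 2 : ℝ) • G) x| / 2 ≤ u x t := by
    intro x hx
    have h1 := hf1 x hx
    have h2 := hδG x hx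
    have h3 : |ev (δ • f + (1 / 2 : ℝ) • G) x| = |ev f x + δ * ev G x / 2| := by
      rw [hevG, ← one_mul |δ * ev f x + ev G x / 2|, ← hδa, ← abs_mul]
      congr 1
      linear_combination ev f x * hδ2
    rw [h3, hev]
    rcases abs_cases (ev f x + δ * ev G x / 2) with h4 | h4 <;> rw [h4.1] <;> linarith [h2.1]
  have hn : (0 : ℝ) < n := by
    have := i₀.pos
    exact_mod_cast this
  have hnh : 0 < n * h := by positivity
  refine ⟨Q + (1 / 2 : ℝ) • f - (δ / 4) • G, δ • f + (1 / 2 : ℝ) • G,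
    ⟨v.t_mem, by positivity, hN, hlow', v.dir, v.vtx_mem, ?_, ?_, ?_, v.det_ne⟩, ?_, ?_⟩
  · intro i
    rw [hev]
    have h1 := (hδG _ (v.vtx_mem i)).2
    have h2 := v.vtx_gap i
    have h3 := hfv' i
    linarith
  · rw [hev]
    have h1 := (hδG _ (subset_closure c.xs_mem)).2
    have h2 := v.xs_gap
    linarith
  · have : (δ • f + (1 / 2 : ℝ) • G).1 e = G.1 e + h / s := by
      simp [hf2]
      linear_combination (G.1 e / 2 + h / s) * hδ2
    rw [this]
    positivity
  · simp [hf2]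
    linear_combination (G.1 e / 2 + h / s) * hδ2
  · have h1 := hlow' X v.X_mem
    have h2 := v.X_gap
    have h3 := abs_nonneg (ev (δ • f + (1 / 2 : ℝ) • G) X)
    linarith

end
section
variable {lam Lam p T : ℝ} {Ω : Set (E n)} {u : E n → ℝ → ℝ} {e xs : E n} {N d β : ℝ}
  {i₀ : Fin n} {t : ℝ} {Q G : (E n →L[ℝ] ℝ) × ℝ} {h : ℝ} {X : E n} {B : Fin n → E n}

lemma Ctx.Lam_pos (c : Ctx lam Lam p T Ω u e xs N d β) : 0 < Lam := c.lam_pos.trans_le c.lam_le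

/-- One of the two planes can be lowered slightly to lie below `u` at an earlier time. -/
lemma rewind_side (c : Ctx lam Lam p T Ω u e xs N d β)
    (v : Valid T Ω u e xs N i₀ t Q G h X B) {s δ t₂ : ℝ} (hs : 0 < s)
    (hsd : s < d / (4 * (n + 1))) (hδ : δ = 1 ∨ δ = -1) (ht2 : -T ≤ t₂) (htt : t₂ ≤ t)
    (hslow : u (ctr X B i₀ xs + (δ * s) • e) t - ev Q (ctr X B i₀ xs + (δ * s) • e)
      ≤ G.1 e * s / 2 + 3 * h)
    (hW : (t - t₂) * (2 * Lam * ((320 * (n : ℝ) ^ 2 * (4 * (n : ℝ) ^ 2) * h) ^ n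
      / (s * (vecMatrix B).det) ^ 2) ^ p) ≤ 3 * h) :
    ∃ f : (E n →L[ℝ] ℝ) × ℝ,
      (∀ x ∈ closure Ω, ev f x + (ev Q x + δ * ev G x / 2) ≤ u x t₂) ∧
      (∀ i, -(36 * (n + 1) * h) ≤ ev f (vtx X B i₀ i)) ∧
      -(36 * (n + 1) * h) ≤ ev f (apex X xs) ∧ ev f X ≤ 5 * h ∧ -(36 * h / s) ≤ δ * f.1 e := by
  have hh := v.h_pos
  have hJ := v.J_pos
  have hδ2 : δ * δ = 1 := by rcases hδ with rfl | rfl <;> norm_num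
  have hδa : |δ| = 1 := by rcases hδ with rfl | rfl <;> norm_num
  have hlow := v.lower
  have hδG : ∀ x ∈ closure Ω, -(u x t - ev Q x) ≤ δ * ev G x / 2 ∧
      δ * ev G x / 2 ≤ u x t - ev Q x := by
    intro x hx
    have h1 := hlow x hx
    have h2 : |δ * ev G x| = |ev G x| := by rw [abs_mul, hδa, one_mul]
    rw [← h2] at h1
    have h3 := abs_le.1 (show |δ * ev G x| ≤ 2 * (u x t - ev Q x) by linarith)
    constructor <;> linarith [h3.1, h3.2]
  set q : (E n →L[ℝ] ℝ) × ℝ := Q + (δ / 2) • G with hq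
  have hev : ∀ x, ev q x = ev Q x + δ * ev G x / 2 := by
    intro x; simp [hq, ev]; ring
  set y := ctr X B i₀ xs with hy
  have hyO : y ∈ Ω := by
    have := v.ctr_add_mem c (τ := 0) (by rw [abs_zero]; exact hs.trans hsd)
    simpa using this
  have hysO : y + (δ * s) • e ∈ Ω := v.ctr_add_mem c (by
    rwa [abs_mul, hδa, one_mul, abs_of_pos hs])
  have hyhO : y + (δ * s / 2) • e ∈ Ω := v.ctr_add_mem c (by
    rw [abs_div, abs_mul, hδa, one_mul, abs_of_pos hs, abs_two]; linarith)
  have hyg := (v.ctr_mem c).2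
  have hP : ∀ i, vtx X B i₀ i ∈ {x ∈ closure Ω | u x t - ev q x ≤ 5 * h} := by
    intro i
    refine ⟨v.vtx_mem i, ?_⟩
    rw [hev]
    linarith [v.vtx_gap i, (hδG _ (v.vtx_mem i)).1]
  have hA : apex X xs ∈ {x ∈ closure Ω | u x t - ev q x ≤ 5 * h} := by
    obtain ⟨h1, h2⟩ := v.apex_mem c
    refine ⟨h1, ?_⟩
    rw [hev]
    linarith [(hδG _ h1).1]
  have hyS : y ∈ {x ∈ closure Ω | u x t - ev q x ≤ 5 * h} := by
    refine ⟨subset_closure hyO, ?_⟩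
    rw [hev]
    linarith [(hδG _ (subset_closure hyO)).1]
  have hysS : y + (δ * s) • B i₀ ∈ {x ∈ closure Ω | u x t - ev q x ≤ 5 * h} := by
    rw [v.dir]
    refine ⟨subset_closure hysO, ?_⟩
    have h1 : ev G (y + (δ * s) • e) = ev G y + δ * s * G.1 e := by
      rw [ev_add, map_smul, smul_eq_mul]
    rw [hev, h1]
    have h2 := (hδG _ (subset_closure hyO)).1
    linear_combination hslow + h2 + hyg - s * G.1 e / 2 * hδ2
  have htm := v.t_mem
  have ht2m : t₂ ∈ Icc (-T) 0 := ⟨ht2, htt.trans htm.2⟩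
  have hqlow : ∀ x ∈ closure Ω, ev q x ≤ u x t := by
    intro x hx
    rw [hev]
    linarith [(hδG _ hx).2]
  have hdrop := drop_bound (s := δ * s) (q := q) c.Lam_pos c.isOpen c.conv c.isBounded c.sol
    v.det_ne (by rcases hδ with rfl | rfl <;> simp [hs.ne']) hh htm.2 ht2 htt hP hyS hysS hqlow (by
      have : (δ * s * (vecMatrix B).det) ^ 2 = (s * (vecMatrix B).det) ^ 2 := by
        linear_combination (s * (vecMatrix B).det) ^ 2 * hδ2
      rwa [this])
  rw [v.dir] at hdrop
  obtain ⟨f₀, hf1, hf2⟩ := exists_affine_support c.isOpen c.conv (c.contSlice ht2m)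
    (c.sol.1.conv t₂ ht2m) hyhO
  have hevf : ∀ x, ev (f₀ - q) x = ev f₀ x - ev q x := by
    intro x; simp [ev]; ring
  have hup : ∀ x ∈ {x ∈ closure Ω | u x t - ev q x ≤ 5 * h}, ev (f₀ - q) x ≤ 5 * h := by
    rintro x ⟨hx1, hx2⟩
    have h1 := hf1 x hx1
    have h2 := c.sol.1.mono x hx1 t₂ ht2m t htm htt
    rw [hevf]
    linarith
  set f := f₀ - q with hf
  have hmid : -13 * h ≤ ev f (y + (δ * s / 2) • e) := by
    rw [hevf, hf2]; exact hdrop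
  rw [v.dir] at hysS
  have e1 : ev f (y + (δ * s / 2) • e) = ev f y + δ * s / 2 * f.1 e := by
    rw [ev_add, map_smul, smul_eq_mul]
  have e2 : ev f (y + (δ * s) • e) = ev f y + δ * s * f.1 e := by
    rw [ev_add, map_smul, smul_eq_mul]
  have hu1 := hup _ hyS
  have hu2 := hup _ hysS
  have hfy : -31 * h ≤ ev f y := by linarith
  have hnh : 0 ≤ n * h := by positivity
  refine ⟨f, ?_, ?_, ?_, ?_, ?_⟩
  · intro x hx
    rw [← hev, hevf]
    linarith [hf1 x hx]
  · intro i
    have := ev_vtx_ge (fun j => hup _ (hP j)) (hup _ hA) hfy i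
    linarith
  · have := ev_apex_ge (fun j => hup _ (hP j)) hfy (xs := xs)
    linarith
  · simpa [vtx_self] using hup _ (hP i₀)
  · rw [neg_le_iff_add_nonneg, add_div' _ _ _ hs.ne']
    apply div_nonneg _ hs.le
    linarith

/-- If `u` grows slowly on both sides of the centre, the configuration can be carried to an
earlier time. -/
lemma rewind (c : Ctx lam Lam p T Ω u e xs N d β)
    (v : Valid T Ω u e xs N i₀ t Q G h X B) {s t₂ : ℝ} (hs : 0 < s)
    (hsd : s < d / (4 * (n + 1))) (ht2 : -T ≤ t₂) (htt : t₂ ≤ t)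
    (hslow : ∀ δ : ℝ, (δ = 1 ∨ δ = -1) →
      u (ctr X B i₀ xs + (δ * s) • e) t - ev Q (ctr X B i₀ xs + (δ * s) • e)
      ≤ G.1 e * s / 2 + 3 * h)
    (hW : (t - t₂) * (2 * Lam * ((320 * (n : ℝ) ^ 2 * (4 * (n : ℝ) ^ 2) * h) ^ n
      / (s * (vecMatrix B).det) ^ 2) ^ p) ≤ 3 * h)
    (hN : (36 * (n + 1) + 5) * h ≤ N) (hJs : 72 * h / s < G.1 e) :
    ∃ Q₂ G₂ : (E n →L[ℝ] ℝ) × ℝ, Valid T Ω u e xs N i₀ t₂ Q₂ G₂ ((36 * (n + 1) + 5) * h) X B ∧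
      G.1 e - 72 * h / s ≤ G₂.1 e ∧ u X t - ev Q₂ X ≤ (36 * (n + 1) + 5) * h ∧
      1 - ev Q X - h ≤ 1 - ev Q₂ X := by
  have hh := v.h_pos
  have htm := v.t_mem
  have ht2m : t₂ ∈ Icc (-T) 0 := ⟨ht2, htt.trans htm.2⟩
  obtain ⟨f, hf1, hf2, hf3, hf4, hf5⟩ := rewind_side c v hs hsd (Or.inl rfl) ht2 htt
    (hslow 1 (Or.inl rfl)) hW
  obtain ⟨g, hg1, hg2, hg3, hg4, hg5⟩ := rewind_side c v hs hsd (Or.inr rfl) ht2 htt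
    (hslow (-1) (Or.inr rfl)) hW
  have hevQ : ∀ x, ev (Q + (1 / 2 : ℝ) • (f + g)) x = ev Q x + (ev f x + ev g x) / 2 := by
    intro x; simp [ev]; ring
  have hevG : ∀ x, ev (G + f - g) x = ev G x + ev f x - ev g x := by
    intro x; simp [ev]; ring
  have hmono := fun x hx => c.sol.1.mono x hx t₂ ht2m t htm htt
  have hslope : G.1 e - 72 * h / s ≤ (G + f - g).1 e := by
    simp only [Prod.fst_sub, Prod.fst_add, _root_.sub_apply, _root_.add_apply]
    have : 72 * h / s = 36 * h / s + 36 * h / s := by ring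
    linarith
  have hnh : 0 ≤ n * h := by positivity
  have hlow : ∀ x ∈ closure Ω, ev (Q + (1 / 2 : ℝ) • (f + g)) x + |ev (G + f - g) x| / 2
      ≤ u x t₂ := by
    intro x hx
    rw [hevQ, hevG]
    have h1 := hf1 x hx
    have h2 := hg1 x hx
    rcases abs_cases (ev G x + ev f x - ev g x) with h4 | h4 <;> rw [h4.1] <;> linarith
  have hgapX : u X t - ev (Q + (1 / 2 : ℝ) • (f + g)) X ≤ (36 * (n + 1) + 5) * h := by
    have h1 := hf2 i₀
    have h2 := hg2 i₀
    rw [vtx_self] at h1 h2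
    rw [hevQ]
    linarith [v.X_gap]
  refine ⟨Q + (1 / 2 : ℝ) • (f + g), G + f - g,
    ⟨ht2m, by positivity, hN, hlow, v.dir, v.vtx_mem, ?_, ?_, by linarith, v.det_ne⟩, hslope,
    hgapX, ?_⟩
  · intro i
    have h1 := hf2 i
    have h2 := hg2 i
    rw [hevQ]
    linarith [v.vtx_gap i, hmono _ (v.vtx_mem i)]
  · rw [hevQ]
    have h1 := ev_apex f X xs
    have h2 := ev_apex g X xs
    linarith [v.xs_gap, hmono _ (subset_closure c.xs_mem)]
  · have h1 := hlow X v.X_mem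
    have h2 := hmono _ v.X_mem
    have h3 := v.X_gap
    have h4 := abs_nonneg (ev (G + f - g) X)
    linarith

/-- The slope at the initial time is controlled by the regularity of the initial datum. -/
lemma initial_slope (c : Ctx lam Lam p T Ω u e xs N d β)
    (v : Valid T Ω u e xs N i₀ (-T) Q G h X B) {s : ℝ} (hs : 0 < s) (hsd : s < d) :
    s * G.1 e ≤ 8 * h + 2 * N * s ^ (1 + β) := by
  have h1 := c.init s hs hsd
  have hm1 : xs + s • e ∈ closure Ω := subset_closure (c.ball_sub' (by
    simp [norm_smul, c.e_norm, abs_of_pos hs, hsd]))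
  have hm2 : xs - s • e ∈ closure Ω := subset_closure (c.ball_sub' (by
    simp [norm_smul, c.e_norm, abs_of_pos hs, hsd]))
  have h2 := v.lower _ hm1
  have h3 := v.lower _ hm2
  have h4 := v.xs_gap
  rw [show xs - s • e = xs + (-s) • e by rw [neg_smul, sub_eq_add_neg]] at h1 h3
  rw [ev_add, ev_add, map_smul, map_smul, smul_eq_mul, smul_eq_mul] at h2 h3
  have h5 := le_abs_self (ev G xs + s * G.1 e)
  have h6 := neg_abs_le (ev G xs + -s * G.1 e)
  linarith

/-- The slope is controlled by the oscillation of `u`. -/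
lemma Valid.slope_le (c : Ctx lam Lam p T Ω u e xs N d β)
    (v : Valid T Ω u e xs N i₀ t Q G h X B) : G.1 e ≤ 4 / d * (1 - ev Q xs) := by
  have hd := c.d_pos
  have hs : 0 < d / 2 := by positivity
  have hmem : ∀ r : ℝ, |r| = d / 2 → xs + r • e ∈ ball xs d := fun r hr => by
    simp only [mem_ball, dist_eq_norm, add_sub_cancel_left, norm_smul, c.e_norm, mul_one,
      Real.norm_eq_abs, hr]
    linarith
  have key : ∀ r : ℝ, |r| = d / 2 → ev Q xs + r * Q.1 e + |ev G xs + r * G.1 e| / 2 < 1 := by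
    intro r hr
    have hm := c.ball_sub (hmem r hr)
    have h1 := v.lower _ (subset_closure hm.1)
    have h2 := c.sol.1.mono _ (subset_closure hm.1) t v.t_mem 0 ⟨by linarith [c.T_pos], le_rfl⟩
      v.t_mem.2
    have h3 := hm.2
    rw [ev_add, ev_add, map_smul, map_smul, smul_eq_mul, smul_eq_mul] at h1
    linarith
  have h1 := key (d / 2) (abs_of_pos hs)
  have h2 := key (-(d / 2)) (by rw [abs_neg, abs_of_pos hs])
  have h3 := le_abs_self (ev G xs + d / 2 * G.1 e)
  have h4 := neg_abs_le (ev G xs + -(d / 2) * G.1 e)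
  rw [div_mul_eq_mul_div, le_div_iff₀ hd]
  linarith

lemma Valid.level_le (c : Ctx lam Lam p T Ω u e xs N d β)
    (v : Valid T Ω u e xs N i₀ t Q G h X B) : 1 - ev Q X ≤ 3 * N := by
  linarith [c.lower X v.X_mem t v.t_mem, v.X_gap, v.h_le]

lemma Valid.slope_le_N (c : Ctx lam Lam p T Ω u e xs N d β)
    (v : Valid T Ω u e xs N i₀ t Q G h X B) : G.1 e ≤ 24 / d * N := by
  have h1 := v.slope_le c
  have h2 := c.lower xs (subset_closure c.xs_mem) t v.t_mem
  have h3 := v.xs_gap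
  have h4 := v.h_le
  calc G.1 e ≤ 4 / d * (1 - ev Q xs) := h1
    _ ≤ 4 / d * (6 * N) := by
        have := c.d_pos
        gcongr
        linarith
    _ = 24 / d * N := by ring

lemma Valid.det_le (c : Ctx lam Lam p T Ω u e xs N d β)
    (v : Valid T Ω u e xs N i₀ t Q G h X B) : |(vecMatrix B).det| ≤ n.factorial * 2 ^ n := by
  obtain ⟨y₀, hy⟩ := c.bdd
  have hcl : closure Ω ⊆ closedBall y₀ 1 :=
    (closure_mono hy).trans closure_ball_subset_closedBall
  have hB : ∀ i, ‖B i‖ ≤ 2 := by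
    intro i
    by_cases hi : i = i₀
    · rw [hi, v.dir, c.e_norm]; norm_num
    · have h1 := hcl (v.vtx_mem i)
      have h2 := hcl v.X_mem
      rw [vtx_ne _ _ hi] at h1
      have h3 : B i = (X + B i - y₀) - (X - y₀) := by abel
      rw [mem_closedBall, dist_eq_norm] at h1 h2
      rw [h3]
      exact (norm_sub_le _ _).trans (by linarith)
  have h := Matrix.det_le (A := vecMatrix B) (abv := AbsoluteValue.abs) (x := (2 : ℝ))
    (fun i j => by
      have h1 := PiLp.norm_apply_le (B i) j
      simpa [vecMatrix] using h1.trans (hB i))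
  simpa using h

end
section
variable {lam Lam p T : ℝ} {Ω : Set (E n)} {u : E n → ℝ → ℝ} {e xs : E n} {N d β : ℝ}
  {i₀ : Fin n} {t : ℝ} {Q G : (E n →L[ℝ] ℝ) × ℝ} {h : ℝ} {X : E n} {B : Fin n → E n}

lemma vecMatrix_det_update_half (B : Fin n → E n) (i₀ : Fin n) :
    (vecMatrix (Function.update (fun i => (1 / 2 : ℝ) • B i) i₀ (B i₀))).det
      = 2 * (1 / 2) ^ n * (vecMatrix B).det := by
  have : B i₀ = (2 : ℝ) • ((fun i => (1 / 2 : ℝ) • B i) i₀) := by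
    simp only [smul_smul]; norm_num
  rw [this, vecMatrix_det_update_smul, vecMatrix_det_smul]
  ring

/-- A point where tilting the planes fails yields a configuration with a larger level. -/
lemma extend_level (c : Ctx lam Lam p T Ω u e xs N d β)
    (v : Valid T Ω u e xs N i₀ t Q G h X B) {K : ℝ} (hK : 1 ≤ K) (hL : 0 < 1 - ev Q X)
    (hσ : 64 * K * h ≤ 1 - ev Q X) {x' : E n} (hx' : x' ∈ closure Ω)
    (hx : u x' t - ev Q x' + 16 * h / (1 - ev Q X) * (ev Q x' - (ev Q X - (1 - ev Q X) / 4))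
      < (1 - 1 / K) * (|ev G x'| / 2)) :
    ∃ χ ≥ (5 / 4 : ℝ), ∃ X' B', Valid T Ω u e xs N i₀ t Q G (16 * K * χ * h) X' B' ∧
      |(vecMatrix B').det| = 2 * (1 / 2) ^ n * |(vecMatrix B).det| ∧
      1 - ev Q X' = (1 - ev Q X) * ((1 + χ) / 2) := by
  set L := 1 - ev Q X with hLdef
  set L' := 1 - ev Q x' with hL'
  set σ := 16 * h / L with hσd
  set m := σ * ((ev Q X - L / 4) - ev Q x') with hm
  have hh := v.h_pos
  have hσ0 : 0 < σ := by positivity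
  have hlow := v.lower x' hx'
  have hK0 : 0 < K := by linarith
  set a := |ev G x'| / 2 with ha
  have ha0 : 0 ≤ a := by positivity
  have h1 : u x' t - ev Q x' - m < (1 - 1 / K) * a := by
    have : σ * (ev Q x' - (ev Q X - L / 4)) = -m := by rw [hm]; ring
    linarith
  have h2 : a * (1 / K) < m := by linarith
  have hm0 : 0 < m := lt_of_le_of_lt (by positivity) h2
  have h3 : a < K * m := by
    have := mul_lt_mul_of_pos_left h2 hK0
    have e1 : K * (a * (1 / K)) = a := by field_simp
    linarith
  have hgap : u x' t - ev Q x' ≤ K * m := by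
    have h4 : (1 - 1 / K) * a ≤ (1 - 1 / K) * (K * m) := by
      apply mul_le_mul_of_nonneg_left h3.le
      rw [sub_nonneg, div_le_one hK0]; exact hK
    have e2 : (1 - 1 / K) * (K * m) = K * m - m := by field_simp
    linarith
  have hpos : 0 < (ev Q X - L / 4) - ev Q x' := pos_of_mul_pos_right hm0 hσ0.le
  have hLL : 5 / 4 * L ≤ L' := by rw [hL']; linarith
  have hmL : m ≤ σ * L' := by
    apply mul_le_mul_of_nonneg_left _ hσ0.le
    rw [hL']; linarith
  have hKσ : K * (σ * L') = 16 * K * (L' / L) * h := by rw [hσd]; field_simp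
  have hgap' : u x' t - ev Q x' ≤ 16 * K * (L' / L) * h := by
    rw [← hKσ]
    exact hgap.trans (mul_le_mul_of_nonneg_left hmL hK0.le)
  have hχ : 5 / 4 ≤ L' / L := by rw [le_div_iff₀ hL]; exact hLL
  have hL'0 : 0 < L' := by linarith
  have hbig : 16 * K * (L' / L) * h ≤ L' / 4 := by
    have : 16 * K * (L' / L) * h = (64 * K * h) * (L' / (4 * L)) := by field_simp; norm_num
    rw [this]
    calc (64 * K * h) * (L' / (4 * L)) ≤ L * (L' / (4 * L)) := by gcongr
      _ = L' / 4 := by field_simp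
  have hhle : h ≤ 16 * K * (L' / L) * h := by
    have : 1 ≤ 16 * K * (L' / L) := by nlinarith
    nlinarith
  set h₃ := 16 * K * (L' / L) * h with hh3
  have hN3 : h₃ ≤ N := by
    have := c.lower x' hx' t v.t_mem
    linarith
  set B' : Fin n → E n := Function.update (fun i => (1 / 2 : ℝ) • B i) i₀ (B i₀) with hB'
  have hvtx : ∀ i, vtx ((1 / 2 : ℝ) • x' + (1 / 2 : ℝ) • X) B' i₀ i
      = (1 / 2 : ℝ) • x' + (1 / 2 : ℝ) • vtx X B i₀ i := by
    intro i
    by_cases hi : i = i₀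
    · subst hi; simp [vtx_self]
    · rw [vtx_ne _ _ hi, vtx_ne _ _ hi, hB', Function.update_of_ne hi]; module
  have hdet := vecMatrix_det_update_half B i₀
  have hcv := c.gapConvex v.t_mem Q
  refine ⟨L' / L, hχ, (1 / 2 : ℝ) • x' + (1 / 2 : ℝ) • X, B',
    ⟨v.t_mem, hh.trans_le hhle, hN3, v.lower, by simp [hB', v.dir], ?_, ?_, ?_, v.J_pos, ?_⟩, ?_, ?_⟩
  · intro i
    rw [hvtx]
    exact c.conv.closure hx' (v.vtx_mem i) (by norm_num) (by norm_num) (by norm_num)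
  · intro i
    rw [hvtx]
    have := hcv.2 hx' (v.vtx_mem i) (show (0 : ℝ) ≤ 1 / 2 by norm_num)
      (show (0 : ℝ) ≤ 1 / 2 by norm_num) (by norm_num)
    simp only [smul_eq_mul] at this
    linarith [v.vtx_gap i]
  · linarith [v.xs_gap]
  · rw [hdet]
    exact mul_ne_zero (by positivity) v.det_ne
  · rw [hdet, abs_mul, abs_of_pos (by positivity)]
  · rw [ev_smul_add_smul Q (by norm_num)]
    have : L * ((1 + L' / L) / 2) = (L + L') / 2 := by field_simp
    rw [this, hL', hLdef]; ring

lemma vecMatrix_det_update (B : Fin n → E n) (i : Fin n) (a : Fin n → ℝ) :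
    (vecMatrix (Function.update B i (∑ k, a k • B k))).det = a i * (vecMatrix B).det := by
  have : vecMatrix (Function.update B i (∑ k, a k • B k))
      = (vecMatrix B).updateRow i (∑ k, a k • (vecMatrix B) k) := by
    ext j k
    by_cases h : j = i
    · subst h; simp [vecMatrix]
    · simp [vecMatrix, h, Matrix.updateRow_ne]
  rw [this, Matrix.det_updateRow_sum, smul_eq_mul]

lemma funcMatrix_det_update_smul (L : Fin n → (E n →L[ℝ] ℝ)) (i : Fin n) (s : ℝ) :
    (funcMatrix (Function.update L i (s • L i))).det = s * (funcMatrix L).det := by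
  have : funcMatrix (Function.update L i (s • L i))
      = (funcMatrix L).updateRow i (s • (funcMatrix L i)) := by
    ext j k
    by_cases h : j = i
    · subst h; simp [funcMatrix]
    · simp [funcMatrix, h, Matrix.updateRow_ne]
  rw [this, Matrix.det_updateRow_smul, Matrix.updateRow_eq_self]

/-- Among the prisms with vertices in a compact set there is one of maximal volume. -/
lemma exists_max_prism {Z : Set (E n)} (hZ : IsCompact Z) {X : E n} {B : Fin n → E n} {i₀ : Fin n}
    (hX : X ∈ Z) (hB : ∀ i, vtx X B i₀ i ∈ Z) (hdet : (vecMatrix B).det ≠ 0) :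
    ∃ B' : Fin n → E n, B' i₀ = B i₀ ∧ (∀ i, vtx X B' i₀ i ∈ Z) ∧ (vecMatrix B').det ≠ 0 ∧
      ∃ L : Fin n → (E n →L[ℝ] ℝ), (∀ x, x = ∑ k, L k x • B' k) ∧
        (funcMatrix L).det = (vecMatrix B').det⁻¹ ∧
        ∀ x ∈ Z, ∀ i, i ≠ i₀ → |L i (x - X)| ≤ 1 := by
  set S : Set (Fin n → E n) :=
    Set.pi univ fun i => if i = i₀ then {B i₀} else (fun b => X + b) ⁻¹' Z with hS
  have hScomp : IsCompact S := by
    apply isCompact_univ_pi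
    intro i
    split_ifs
    · exact isCompact_singleton
    · exact (Homeomorph.addLeft X).isCompact_preimage.2 hZ
  have hmem : ∀ C : Fin n → E n, C ∈ S ↔ C i₀ = B i₀ ∧ ∀ i, i ≠ i₀ → X + C i ∈ Z := by
    intro C
    simp only [hS, Set.mem_pi, mem_univ, true_imp_iff]
    constructor
    · intro hC
      refine ⟨by simpa using hC i₀, fun i hi => by simpa [hi] using hC i⟩
    · rintro ⟨h1, h2⟩ i
      by_cases hi : i = i₀
      · subst hi; simp [h1]
      · simpa [hi] using h2 i hi
  have hcont : Continuous fun C : Fin n → E n => |(vecMatrix C).det| := by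
    apply Continuous.abs
    apply Continuous.matrix_det
    unfold vecMatrix
    refine continuous_matrix fun i j => ?_
    simp only [Matrix.of_apply]
    fun_prop
  have hBS : B ∈ S := (hmem B).2 ⟨rfl, fun i hi => by simpa [vtx_ne _ _ hi] using hB i⟩
  obtain ⟨B', hB'S, hmax⟩ := hScomp.exists_isMaxOn ⟨B, hBS⟩ hcont.continuousOn
  obtain ⟨hB'1, hB'2⟩ := (hmem B').1 hB'S
  have hpos : 0 < |(vecMatrix B').det| := (abs_pos.2 hdet).trans_le (hmax hBS)
  have hne : (vecMatrix B').det ≠ 0 := abs_pos.1 hpos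
  obtain ⟨L, hL1, hL2, hL3⟩ := exists_dual B' hne
  refine ⟨B', hB'1, fun i => ?_, hne, L, hL1, hL3, fun x hx i hi => ?_⟩
  · by_cases hi : i = i₀
    · subst hi; rwa [vtx_self]
    · rw [vtx_ne _ _ hi]; exact hB'2 i hi
  · have h1 : Function.update B' i (∑ k, L k (x - X) • B' k) ∈ S := by
      rw [← hL1 (x - X)]
      refine (hmem _).2 ⟨by rw [Function.update_of_ne hi.symm, hB'1], fun j hj => ?_⟩
      by_cases hji : j = i
      · subst hji; simpa using hx
      · rw [Function.update_of_ne hji]; exact hB'2 j hj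
    have h2 : |(vecMatrix (Function.update B' i (∑ k, L k (x - X) • B' k))).det|
        ≤ |(vecMatrix B').det| := hmax h1
    rw [vecMatrix_det_update, abs_mul] at h2
    exact le_of_mul_le_mul_right (by linarith) hpos

end

section
variable {lam Lam p T : ℝ} {Ω : Set (E n)} {u : E n → ℝ → ℝ} {e xs : E n} {N d β : ℝ}
  {i₀ : Fin n} {t t₂ : ℝ} {Q G : (E n →L[ℝ] ℝ) × ℝ} {h : ℝ} {X : E n} {B : Fin n → E n}

/-- Tilting the average plane so that its small sublevel sets stay inside the domain. -/
lemma exists_tilt (c : Ctx lam Lam p T Ω u e xs N d β)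
    (v : Valid T Ω u e xs N i₀ t₂ Q G h X B) {K : ℝ} (hK : 1 < K) (hL : 16 * h ≤ 1 - ev Q X)
    (hnot : ∀ x ∈ closure Ω, (1 - 1 / K) * (|ev G x| / 2) ≤ u x t₂ - ev Q x
      + 16 * h / (1 - ev Q X) * (ev Q x - (ev Q X - (1 - ev Q X) / 4))) :
    ∃ Q₃ G₃ : (E n →L[ℝ] ℝ) × ℝ, (∀ x ∈ closure Ω, ev Q₃ x + |ev G₃ x| / 2 ≤ u x t₂) ∧
      G₃.1 e = (1 - 1 / K) * G.1 e ∧ ev Q₃ X = ev Q X - 4 * h ∧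
      u xs t₂ - ev Q₃ xs ≤ 24 * h ∧
      ∀ x ∈ closure Ω, u x t₂ - ev Q₃ x ≤ 16 * h → x ∈ Ω := by
  have hh := v.h_pos
  set L := 1 - ev Q X with hLdef
  have hL0 : 0 < L := by linarith
  set σ := 16 * h / L with hσd
  have hσ0 : 0 ≤ σ := by positivity
  have hσ1 : σ ≤ 1 := by rw [hσd, div_le_one hL0]; exact hL
  have hσL : σ * L = 16 * h := by rw [hσd]; field_simp
  have hK0 : 0 < K := by linarith
  have hK1 : 0 ≤ 1 - 1 / K := by rw [sub_nonneg, div_le_one hK0]; exact hK.le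
  set Q₃ : (E n →L[ℝ] ℝ) × ℝ := (1 - σ) • Q + (0, σ * (ev Q X - L / 4)) with hQ3
  have hev : ∀ x, ev Q₃ x = ev Q x - σ * (ev Q x - (ev Q X - L / 4)) := by
    intro x; simp [hQ3, ev]; ring
  have hevG : ∀ x, ev ((1 - 1 / K) • G) x = (1 - 1 / K) * ev G x := by
    intro x; simp [ev]; ring
  refine ⟨Q₃, (1 - 1 / K) • G, ?_, by simp, ?_, ?_, ?_⟩
  · intro x hx
    rw [hev, hevG, abs_mul, abs_of_nonneg hK1]
    linarith [hnot x hx]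
  · rw [hev]; linarith
  · have h1 := v.xs_gap
    have h2 := v.lower xs (subset_closure c.xs_mem)
    have h3 := abs_nonneg (ev G xs)
    have h4 := c.sol.1.mono xs (subset_closure c.xs_mem) t₂ v.t_mem 0
      ⟨v.t_mem.1.trans v.t_mem.2, le_rfl⟩ v.t_mem.2
    have h5 := (c.ball_sub (mem_ball_self c.d_pos)).2
    rw [hev]
    have h6 : σ * (ev Q xs - (ev Q X - L / 4)) ≤ σ * (5 / 4 * L) := by
      apply mul_le_mul_of_nonneg_left _ hσ0
      linarith
    linarith
  · intro x hx hgap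
    by_contra hxO
    have h1 := c.bdry x ⟨hx, by rwa [c.isOpen.interior_eq]⟩ t₂ v.t_mem
    have h2 := v.lower x hx
    have h3 := abs_nonneg (ev G x)
    rw [hev] at hgap
    have h4 : 0 ≤ (1 - σ) * (u x t₂ - ev Q x) := mul_nonneg (by linarith) (by linarith)
    have h5 : σ * (5 / 4 * L) ≤ σ * (u x t₂ - (ev Q X - L / 4)) := by
      apply mul_le_mul_of_nonneg_left _ hσ0
      linarith
    linarith

/-- The slow growth of `u` at the apex forces the sublevel set at an earlier time to contain a
prism of large volume. -/
lemma growth (c : Ctx lam Lam p T Ω u e xs N d β)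
    (v : Valid T Ω u e xs N i₀ t₂ Q G h X B) (ht2 : t₂ < t) (ht : t ≤ 0)
    (huX : u X t - ev Q X ≤ h) {K : ℝ} (hK : 1 < K) (hL : 16 * h ≤ 1 - ev Q X)
    (hN : 16 * h ≤ N)
    (hnot : ∀ x ∈ closure Ω, (1 - 1 / K) * (|ev G x| / 2) ≤ u x t₂ - ev Q x
      + 16 * h / (1 - ev Q X) * (ev Q x - (ev Q X - (1 - ev Q X) / 4))) :
    ∃ (Q₃ G₃ : (E n →L[ℝ] ℝ) × ℝ) (B' : Fin n → E n),
      Valid T Ω u e xs N i₀ t₂ Q₃ G₃ (16 * h) X B' ∧ G₃.1 e = (1 - 1 / K) * G.1 e ∧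
      1 - ev Q X ≤ 1 - ev Q₃ X ∧
      lam * ((8 * h / n) ^ n / (64 * n * h / G₃.1 e * (vecMatrix B').det) ^ 2) ^ p
        ≤ 12 * h / (t - t₂) := by
  obtain ⟨Q₃, G₃, hlow, hG, hQX, hxs, hin⟩ := exists_tilt c v hK hL hnot
  have hh := v.h_pos
  have hn : (0 : ℝ) < n := by
    have : 0 < n := i₀.pos
    exact_mod_cast this
  have hK1 : 0 < 1 - 1 / K := by rw [sub_pos, div_lt_one (by linarith)]; exact hK
  have hJ3 : 0 < G₃.1 e := by rw [hG]; exact mul_pos hK1 v.J_pos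
  have htm2 : t₂ ∈ Icc (-T) 0 := v.t_mem
  have htm : t ∈ Icc (-T) 0 := ⟨htm2.1.trans ht2.le, ht⟩
  have hmono := fun x hx => c.sol.1.mono x hx t₂ htm2 t htm ht2.le
  have hcont : ContinuousOn (fun x => u x t₂ - ev Q₃ x) (closure Ω) :=
    (c.contSlice htm2).sub (ev_continuous Q₃).continuousOn
  have hcv := c.gapConvex htm2 Q₃
  set Z := {x ∈ closure Ω | u x t₂ - ev Q₃ x ≤ 16 * h} with hZ
  have hZc : IsCompact Z := by
    have hcl : IsCompact (closure Ω) := c.isBounded.isCompact_closure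
    refine hcl.of_isClosed_subset ?_ (sep_subset _ _)
    exact hcont.preimage_isClosed_of_isClosed isClosed_closure isClosed_Iic
  have hXgap : u X t - ev Q₃ X ≤ 5 * h := by linarith
  have hXgap2 : u X t₂ - ev Q₃ X ≤ 5 * h := by linarith [hmono X v.X_mem]
  have hXZ : X ∈ Z := ⟨v.X_mem, by linarith⟩
  obtain ⟨r, hr0, hr1, hr⟩ : ∃ r : ℝ, 0 < r ∧ r ≤ 1 ∧
      ∀ i, (u (vtx X B i₀ i) t₂ - ev Q₃ (vtx X B i₀ i)) * r ≤ 11 * h := by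
    set M := ∑ i, |u (vtx X B i₀ i) t₂ - ev Q₃ (vtx X B i₀ i)| with hM
    have hM0 : 0 ≤ M := Finset.sum_nonneg fun i _ => abs_nonneg _
    refine ⟨11 * h / (11 * h + M), by positivity, ?_, fun i => ?_⟩
    · rw [div_le_one (by positivity)]; linarith
    · have h1 : u (vtx X B i₀ i) t₂ - ev Q₃ (vtx X B i₀ i) ≤ M :=
        (le_abs_self _).trans (Finset.single_le_sum
          (f := fun i => |u (vtx X B i₀ i) t₂ - ev Q₃ (vtx X B i₀ i)|)
          (fun i _ => abs_nonneg _) (Finset.mem_univ i))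
      rw [mul_div_assoc', div_le_iff₀ (by positivity)]
      nlinarith
  set B₁ : Fin n → E n := Function.update (fun i => r • B i) i₀ (B i₀) with hB1
  have hB1Z : ∀ i, vtx X B₁ i₀ i ∈ Z := by
    intro i
    by_cases hi : i = i₀
    · subst hi; rwa [vtx_self]
    · have e1 : vtx X B₁ i₀ i = (1 - r) • X + r • vtx X B i₀ i := by
        rw [vtx_ne _ _ hi, vtx_ne _ _ hi, hB1, Function.update_of_ne hi]; module
      rw [e1]
      refine ⟨c.conv.closure v.X_mem (v.vtx_mem i) (by linarith) hr0.le (by ring), ?_⟩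
      have h1 := hcv.2 v.X_mem (v.vtx_mem i) (show (0 : ℝ) ≤ 1 - r by linarith) hr0.le (by ring)
      simp only [smul_eq_mul] at h1
      have h2 : (1 - r) * (u X t₂ - ev Q₃ X) ≤ (1 - r) * (5 * h) :=
        mul_le_mul_of_nonneg_left hXgap2 (by linarith)
      have h3 := hr i
      nlinarith
  have hB1det : (vecMatrix B₁).det ≠ 0 := by
    have e1 : B i₀ = r⁻¹ • ((fun i => r • B i) i₀) := by
      simp only [smul_smul]; rw [inv_mul_cancel₀ hr0.ne', one_smul]
    rw [hB1, e1, vecMatrix_det_update_smul, vecMatrix_det_smul]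
    exact mul_ne_zero (inv_ne_zero hr0.ne') (mul_ne_zero (pow_ne_zero _ hr0.ne') v.det_ne)
  obtain ⟨B', hB'i, hB'Z, hB'det, L, hLrep, hLdet, hL1⟩ := exists_max_prism hZc hXZ hB1Z hB1det
  have hB'e : B' i₀ = e := by rw [hB'i, hB1, Function.update_self, v.dir]
  refine ⟨Q₃, G₃, B', ⟨htm2, by linarith, hN, hlow, hB'e, fun i => (hB'Z i).1,
    fun i => (hB'Z i).2, by linarith, hJ3, hB'det⟩, hG, by linarith, ?_⟩
  have hGZ : ∀ x ∈ Z, |ev G₃ x| ≤ 32 * h := by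
    intro x hx
    have := hlow x hx.1
    have := hx.2
    linarith
  have hGd : ∀ x ∈ Z, |G₃.1 (x - X)| ≤ 64 * h := by
    intro x hx
    have e1 : G₃.1 (x - X) = ev G₃ x - ev G₃ X := by simp [ev]
    rw [e1]
    have := hGZ x hx
    have := hGZ X hXZ
    exact (abs_sub _ _).trans (by linarith)
  set k := 64 * n * h / G₃.1 e with hk
  have hk0 : 0 < k := by positivity
  have hLi0 : ∀ x ∈ Z, |L i₀ (x - X)| ≤ k := by
    intro x hx
    have e1 : G₃.1 (x - X) = ∑ i, L i (x - X) * G₃.1 (B' i) := by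
      conv_lhs => rw [hLrep (x - X)]
      simp
    rw [← Finset.add_sum_erase _ _ (Finset.mem_univ i₀), hB'e] at e1
    have h1 : |∑ i ∈ Finset.univ.erase i₀, L i (x - X) * G₃.1 (B' i)|
        ≤ ∑ i ∈ Finset.univ.erase i₀, 64 * h := by
      refine (Finset.abs_sum_le_sum_abs _ _).trans (Finset.sum_le_sum fun i hi => ?_)
      have hi' := Finset.ne_of_mem_erase hi
      rw [abs_mul]
      have h2 := hL1 x hx i hi'
      have h3 := hGd _ (hB'Z i)
      rw [vtx_ne _ _ hi', add_sub_cancel_left] at h3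
      calc |L i (x - X)| * |G₃.1 (B' i)| ≤ 1 * (64 * h) := by gcongr
        _ = 64 * h := one_mul _
    rw [Finset.sum_const, Finset.card_erase_of_mem (Finset.mem_univ _), Finset.card_univ,
      Fintype.card_fin, nsmul_eq_mul, Nat.cast_pred i₀.pos] at h1
    rw [hk, le_div_iff₀ hJ3, ← abs_of_pos hJ3, ← abs_mul]
    have e2 : L i₀ (x - X) * G₃.1 e = G₃.1 (x - X)
        - ∑ i ∈ Finset.univ.erase i₀, L i (x - X) * G₃.1 (B' i) := by linarith
    rw [e2]
    refine (abs_sub _ _).trans ?_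
    linarith [hGd x hx]
  set L' : Fin n → (E n →L[ℝ] ℝ) := Function.update L i₀ ((1 / k) • L i₀) with hL'
  have hL'1 : ∀ x ∈ Z, ∀ i, |L' i (x - X)| ≤ 1 := by
    intro x hx i
    by_cases hi : i = i₀
    · subst hi
      rw [hL', Function.update_self, _root_.smul_apply, smul_eq_mul, abs_mul,
        abs_of_pos (by positivity : 0 < 1 / k), one_div_mul_eq_div, div_le_one hk0]
      exact hLi0 x hx
    · rw [hL', Function.update_of_ne hi]
      exact hL1 x hx i hi
  have hsum : ∀ x ∈ Z, 4 * h / n * ∑ i, (L' i (x - X)) ^ 2 ≤ 4 * h := by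
    intro x hx
    have h1 : ∑ i, (L' i (x - X)) ^ 2 ≤ ∑ _i : Fin n, (1 : ℝ) := by
      apply Finset.sum_le_sum
      intro i _
      have := hL'1 x hx i
      rw [← sq_abs]
      exact pow_le_one₀ (abs_nonneg _) this
    rw [Finset.sum_const, Finset.card_univ, Fintype.card_fin, nsmul_eq_mul, mul_one] at h1
    calc 4 * h / n * ∑ i, (L' i (x - X)) ^ 2 ≤ 4 * h / n * n := by gcongr
      _ = 4 * h := by field_simp
  have htt : 0 < t - t₂ := by linarith
  by_contra! hcon
  have hV : ∀ t' ∈ Icc t₂ t, 12 * h / (t - t₂) * (t' - t₂) ≤ 12 * h := by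
    intro t' ht'
    rw [div_mul_eq_mul_div, div_le_iff₀ htt]
    have : t' - t₂ ≤ t - t₂ := by linarith [ht'.2]
    gcongr
  have hq : ∀ x, ev (Q₃ + (0, -(4 * h))) x = ev Q₃ x - 4 * h := by
    intro x; simp [ev]; ring
  have key := lower_barrier c.isOpen c.conv c.sol.1.cont c.sol.2.2 (Q₃ + (0, -(4 * h))) (4 * h / n)
    L' X (12 * h / (t - t₂)) t₂ t htm2.1 ht Z hZc (sep_subset _ _) (by positivity) ?_ ?_ ?_ X hXZ t
    ⟨ht2.le, le_rfl⟩
  · rw [quadTest, hq, div_mul_cancel₀ _ htt.ne'] at key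
    simp only [sub_self, map_zero] at key
    norm_num at key
    linarith
  · intro x hx
    rw [quadTest, hq, sub_self, mul_zero]
    have h1 := hlow x hx.1
    have h2 := abs_nonneg (ev G₃ x)
    linarith [hsum x hx]
  · intro x hx hxi t' ht'
    have h1 : 16 * h ≤ u x t₂ - ev Q₃ x := by
      by_contra! hlt
      apply hxi
      rw [mem_interior_iff_mem_nhds]
      have hxO : x ∈ Ω := hin x hx.1 hx.2
      have hnhd : closure Ω ∈ nhds x :=
        Filter.mem_of_superset (c.isOpen.mem_nhds hxO) subset_closure
      filter_upwards [hnhd, (hcont.continuousAt hnhd).eventually (eventually_lt_nhds hlt)]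
        with y hy1 hy2
      exact ⟨hy1, hy2.le⟩
    have h2 := c.sol.1.mono x hx.1 t₂ htm2 t' ⟨htm2.1.trans ht'.1, ht'.2.trans ht⟩ ht'.1
    rw [quadTest, hq]
    linarith [hsum x hx, hV t' ht']
  · rw [hL', funcMatrix_det_update_smul, hLdet]
    rw [div_eq_mul_inv ((8 * h / n) ^ n), ← inv_pow, mul_inv] at hcon
    rwa [show 2 * (4 * h / n) = 8 * h / n by ring, one_div]

end

/-- The monotone quantity: slope `J`, volume `A`, height `h`, level `L`. -/
def pot (κ γ N J A h L : ℝ) : ℝ := J * A ^ κ * (N / h) ^ γ * L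

lemma pot_gain {κ γ N J A h L J' A' h' L' a b l m ε : ℝ} (ha : 0 ≤ a) (hb : 0 ≤ b) (hl : 0 ≤ l)
    (hm : 0 < m) (hN : 0 < N) (hh : 0 < h) (hJ : 0 ≤ J) (hA : 0 ≤ A) (hL : 0 ≤ L)
    (hJ' : a * J ≤ J') (hA' : b * A ^ κ ≤ A' ^ κ) (hh' : h' = m * h) (hL' : l * L ≤ L')
    (hfac : 1 + ε ≤ a * b * l * m ^ (-γ)) :
    (1 + ε) * pot κ γ N J A h L ≤ pot κ γ N J' A' h' L' := by
  have hAκ : 0 ≤ A ^ κ := Real.rpow_nonneg hA κ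
  have hNh : 0 ≤ (N / h) ^ γ := Real.rpow_nonneg (by positivity) γ
  have hmγ : 0 ≤ m ^ (-γ) := Real.rpow_nonneg hm.le _
  have e1 : (N / h') ^ γ = (N / h) ^ γ * m ^ (-γ) := by
    rw [hh', show N / (m * h) = N / h / m by field_simp, Real.div_rpow (by positivity) hm.le,
      Real.rpow_neg hm.le, div_eq_mul_inv]
  unfold pot
  rw [e1]
  calc (1 + ε) * (J * A ^ κ * (N / h) ^ γ * L)
      ≤ (a * b * l * m ^ (-γ)) * (J * A ^ κ * (N / h) ^ γ * L) :=
        mul_le_mul_of_nonneg_right hfac (by positivity)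
    _ = (a * J) * (b * A ^ κ) * ((N / h) ^ γ * m ^ (-γ)) * (l * L) := by ring
    _ ≤ J' * A' ^ κ * ((N / h) ^ γ * m ^ (-γ)) * L' := by
        have : 0 ≤ J' := le_trans (by positivity) hJ'
        have : 0 ≤ A' ^ κ := le_trans (by positivity) hA'
        gcongr

/-- The height gained when a prism is built at an earlier time. -/
def heightFactor (n : ℕ) : ℝ := 16 * (36 * (n + 1) + 5)

/-- The volume gained when a prism is built at an earlier time, up to the factor `K`. -/
def volFactor (n : ℕ) (p lam Lam : ℝ) : ℝ :=
  √((heightFactor n / (2560 * n ^ 5)) ^ n / (heightFactor n * Lam / (2 * lam)) ^ (1 / p))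
    / (8 * n * heightFactor n)

/-- Admissible exponents and large parameter. -/
structure Params (n : ℕ) (p lam Lam β K γ κ : ℝ) : Prop where
  K_ge : 10000 ≤ K
  κ_pos : 0 < κ
  γ_eq : γ = n * κ
  γ_le : γ ≤ 1 / 4
  γ_le_β : γ ≤ β / 2
  fast : 1 - 1 / (4 * K) ≤ (6 * (n + 1)) ^ (-γ)
  level : 999 / 1000 ≤ (2 * heightFactor n * K) ^ (-γ)
  vol : 1 + 100 / K ≤ (volFactor n p lam Lam * K) ^ κ * heightFactor n ^ (-γ)

lemma heightFactor_ge (n : ℕ) : 16 * 41 ≤ heightFactor n := by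
  have : (0 : ℝ) ≤ n := Nat.cast_nonneg n
  unfold heightFactor
  nlinarith

lemma heightFactor_pos (n : ℕ) : 0 < heightFactor n := by linarith [heightFactor_ge n]

lemma volFactor_pos {n : ℕ} (hn : 1 ≤ n) {p lam Lam : ℝ} (hlam : 0 < lam) (hLam : 0 < Lam) :
    0 < volFactor n p lam Lam := by
  have := heightFactor_pos n
  have : (0 : ℝ) < n := by exact_mod_cast hn
  unfold volFactor
  positivity

lemma exists_params {n : ℕ} (hn : 1 ≤ n) {p lam Lam β : ℝ} (hlam : 0 < lam) (hLam : 0 < Lam)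
    (hβ : 0 < β) : ∃ K γ κ, Params n p lam Lam β K γ κ := by
  have hn0 : (0 : ℝ) < n := by exact_mod_cast hn
  have hH := heightFactor_pos n
  have hV : 0 < volFactor n p lam Lam := volFactor_pos hn hlam hLam
  have h6 : 0 < Real.log (6 * (n + 1)) := Real.log_pos (by linarith)
  set c := 1 / (4 * Real.log (6 * (n + 1))) with hc
  have hc0 : 0 < c := by positivity
  have t1 : Filter.Tendsto (fun K : ℝ => c / K) Filter.atTop (nhds 0) :=
    Filter.Tendsto.const_div_atTop Filter.tendsto_id c
  have t2 : Filter.Tendsto (fun K : ℝ => c / K * Real.log (2 * heightFactor n * K)) Filter.atTop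
      (nhds 0) := by
    have h1 : Filter.Tendsto (fun K : ℝ => Real.log K / K) Filter.atTop (nhds 0) :=
      Real.isLittleO_log_id_atTop.tendsto_div_nhds_zero
    have h2 := (t1.mul_const (Real.log (2 * heightFactor n))).add (h1.const_mul c)
    simp only [zero_mul, mul_zero, add_zero] at h2
    refine h2.congr' ?_
    filter_upwards [Filter.eventually_gt_atTop 0] with K hK
    rw [Real.log_mul (by positivity) hK.ne']
    ring
  have t3 : Filter.Tendsto (fun K : ℝ => c / n * Real.log (volFactor n p lam Lam * K)
      - c * Real.log (heightFactor n)) Filter.atTop Filter.atTop := by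
    apply Filter.tendsto_atTop_add_const_right
    apply Filter.Tendsto.const_mul_atTop (by positivity)
    exact Real.tendsto_log_atTop.comp (Filter.tendsto_id.const_mul_atTop hV)
  obtain ⟨K, hK1, hK2, hK3, hK4, hK5⟩ := ((Filter.eventually_ge_atTop 10000).and
    ((t1.eventually_le_const (show (0 : ℝ) < 1 / 4 by norm_num)).and
    ((t1.eventually_le_const (show (0 : ℝ) < β / 2 by positivity)).and
    ((t2.eventually_le_const (show (0 : ℝ) < 1 / 1000 by norm_num)).and
    (t3.eventually_ge_atTop 100))))).exists
  have hK0 : 0 < K := by linarith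
  refine ⟨K, c / K, c / K / n, hK1, by positivity, by field_simp, hK2, hK3, ?_, ?_, ?_⟩
  · rw [Real.rpow_def_of_pos (by positivity)]
    have e1 : Real.log (6 * (n + 1)) * -(c / K) = -(1 / (4 * K)) := by
      rw [hc]; field_simp
    rw [e1]
    linarith [Real.add_one_le_exp (-(1 / (4 * K)))]
  · rw [Real.rpow_def_of_pos (by positivity)]
    linarith [Real.add_one_le_exp (Real.log (2 * heightFactor n * K) * -(c / K))]
  · rw [Real.rpow_def_of_pos (by positivity), Real.rpow_def_of_pos (by positivity), ← Real.exp_add]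
    have e1 : Real.log (volFactor n p lam Lam * K) * (c / K / n)
        + Real.log (heightFactor n) * -(c / K)
        = (c / n * Real.log (volFactor n p lam Lam * K) - c * Real.log (heightFactor n)) / K := by
      field_simp; ring
    rw [e1]
    have h1 : 100 / K ≤ (c / n * Real.log (volFactor n p lam Lam * K)
      - c * Real.log (heightFactor n)) / K := by gcongr
    linarith [Real.add_one_le_exp ((c / n * Real.log (volFactor n p lam Lam * K)
      - c * Real.log (heightFactor n)) / K)]

/-- The volume gain in the growth step. -/
lemma vol_gain {n : ℕ} (hn : 1 ≤ n) {p lam Lam K h J J₃ A A₃ W : ℝ} (hp : 0 < p) (hlam : 0 < lam)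
    (hLam : 0 < Lam) (hK : 0 < K) (hh : 0 < h) (hJ : 0 < J) (hA : 0 < A) (hA₃ : 0 < A₃)
    (hJ₃ : J / 2 ≤ J₃)
    (hW : W * (2 * Lam * ((320 * (n : ℝ) ^ 2 * (4 * (n : ℝ) ^ 2) * h) ^ n
      / (K * h / J * A) ^ 2) ^ p) = 3 * h)
    (hgrow : lam * ((8 * ((36 * (n + 1) + 5) * h) / n) ^ n
      / (64 * n * ((36 * (n + 1) + 5) * h) / J₃ * A₃) ^ 2) ^ p
        ≤ 12 * ((36 * (n + 1) + 5) * h) / W) :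
    volFactor n p lam Lam * K * A ≤ A₃ := by
  have hn0 : (0 : ℝ) < n := by exact_mod_cast hn
  have hH := heightFactor_pos n
  have hHd : (36 * ((n : ℝ) + 1) + 5) = heightFactor n / 16 := by unfold heightFactor; ring
  rw [hHd] at hgrow
  set H := heightFactor n with hHdef
  have hJ₃0 : 0 < J₃ := by linarith
  set Y := (320 * (n : ℝ) ^ 2 * (4 * (n : ℝ) ^ 2) * h) ^ n / (K * h / J * A) ^ 2 with hY
  have hY0 : 0 < Y := by positivity
  have hYp : 0 < Y ^ p := by positivity
  have hW0 : W = 3 * h / (2 * Lam * Y ^ p) := by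
    rw [eq_div_iff (by positivity)]; exact hW
  set M := (H * Lam / (2 * lam)) ^ (1 / p) with hM
  have hM0 : 0 < M := by positivity
  have hMp : M ^ p = H * Lam / (2 * lam) := by
    rw [hM, ← Real.rpow_mul (by positivity), one_div_mul_cancel hp.ne', Real.rpow_one]
  set P := (8 * (H / 16 * h) / n) ^ n / (64 * n * (H / 16 * h) / J₃ * A₃) ^ 2 with hP
  have h1 : P ^ p ≤ (M * Y) ^ p := by
    rw [Real.mul_rpow hM0.le hY0.le, hMp]
    have e1 : 12 * (H / 16 * h) / W = lam * (H * Lam / (2 * lam) * Y ^ p) := by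
      rw [hW0]; field_simp; norm_num
    rw [e1] at hgrow
    exact le_of_mul_le_mul_left hgrow hlam
  have h2 : P ≤ M * Y := by
    by_contra! hcon
    exact absurd h1 (not_le.2 (Real.rpow_lt_rpow (by positivity) hcon hp))
  have h3 : (H / (2560 * n ^ 5)) ^ n / M * (K * A / (4 * n * H)) ^ 2 ≤ (A₃ * (J / J₃)) ^ 2 := by
    rw [hP, hY, div_le_iff₀ (by positivity)] at h2
    have e1 : 8 * (H / 16 * h) / n
        = (H / (2560 * n ^ 5)) * (320 * (n : ℝ) ^ 2 * (4 * (n : ℝ) ^ 2) * h) := by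
      field_simp; norm_num
    rw [e1, mul_pow] at h2
    set F := (320 * (n : ℝ) ^ 2 * (4 * (n : ℝ) ^ 2) * h) ^ n with hF
    have hF0 : 0 < F := by positivity
    have e2 : M * (F / (K * h / J * A) ^ 2) * (64 * n * (H / 16 * h) / J₃ * A₃) ^ 2
        = F * (M * ((4 * n * H) / (K * A)) ^ 2 * (A₃ * (J / J₃)) ^ 2) := by
      field_simp; norm_num
    rw [e2, mul_comm _ F] at h2
    have h4 := le_of_mul_le_mul_left h2 hF0
    calc (H / (2560 * n ^ 5)) ^ n / M * (K * A / (4 * n * H)) ^ 2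
        ≤ (M * ((4 * n * H) / (K * A)) ^ 2 * (A₃ * (J / J₃)) ^ 2) / M
          * (K * A / (4 * n * H)) ^ 2 := by gcongr
      _ = (A₃ * (J / J₃)) ^ 2 := by field_simp
  have h5 : √((H / (2560 * n ^ 5)) ^ n / M) * (K * A / (4 * n * H)) ≤ A₃ * (J / J₃) := by
    apply le_of_sq_le_sq _ (by positivity)
    rwa [mul_pow, Real.sq_sqrt (by positivity)]
  have h6 : J / J₃ ≤ 2 := by rw [div_le_iff₀ hJ₃0]; linarith
  have h7 : A₃ * (J / J₃) ≤ A₃ * 2 := by gcongr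
  have e3 : volFactor n p lam Lam * K * A
      = √((H / (2560 * n ^ 5)) ^ n / M) * (K * A / (4 * n * H)) / 2 := by
    unfold volFactor
    rw [← hHdef, ← hM]
    field_simp; norm_num
  rw [e3]
  linarith

section
variable {lam Lam p T : ℝ} {Ω : Set (E n)} {u : E n → ℝ → ℝ} {e xs : E n} {N d β : ℝ}
  {i₀ : Fin n} {t : ℝ} {Q G : (E n →L[ℝ] ℝ) × ℝ} {h : ℝ} {X : E n} {B : Fin n → E n} {K γ κ : ℝ}

lemma Params.γ_pos (P : Params n p lam Lam β K γ κ) (i : Fin n) : 0 < γ := by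
  have : (0 : ℝ) < n := by exact_mod_cast i.pos
  rw [P.γ_eq]
  exact mul_pos this P.κ_pos

lemma factor_steepen (P : Params n p lam Lam β K γ κ) :
    1 + 1 / (16 * K) ≤ (1 + 1 / K) * 1 * (1 - 1 / (100 * K)) * (6 * (n + 1)) ^ (-γ) := by
  have hK := P.K_ge
  have hx : 1 / K ≤ 1 / 10000 := one_div_le_one_div_of_le (by norm_num) hK
  have hx0 : 0 < 1 / K := by positivity
  have h1 := P.fast
  have e1 : 1 / (16 * K) = 1 / K / 16 := by field_simp
  have e2 : 1 / (100 * K) = 1 / K / 100 := by field_simp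
  have e3 : 1 / (4 * K) = 1 / K / 4 := by field_simp
  rw [e3] at h1
  rw [e1, e2]
  set x := 1 / K
  refine le_trans ?_ (mul_le_mul_of_nonneg_left h1 (mul_nonneg (by linarith) (by linarith)))
  have h2 : 1 + 9 / 10 * x ≤ (1 + x) * 1 * (1 - x / 100) := by nlinarith
  refine le_trans ?_ (mul_le_mul_of_nonneg_right h2 (by linarith))
  nlinarith

lemma factor_extend (P : Params n p lam Lam β K γ κ) (i : Fin n) {χ : ℝ} (hχ : 5 / 4 ≤ χ) :
    1 + 1 / (16 * K) ≤ (1 - 72 / K) * (2 * (1 / 2) ^ n) ^ κ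
      * ((1 - 1 / (100 * K)) * ((1 + χ) / 2)) * (heightFactor n * K * χ) ^ (-γ) := by
  have hK := P.K_ge
  have hH := heightFactor_pos n
  have hγ := P.γ_pos i
  have hx : 1 / K ≤ 1 / 10000 := one_div_le_one_div_of_le (by norm_num) hK
  have hx0 : 0 < 1 / K := by positivity
  have e1 : 1 / (16 * K) = 1 / K / 16 := by field_simp
  have e2 : 1 / (100 * K) = 1 / K / 100 := by field_simp
  have e3 : 72 / K = 72 * (1 / K) := by field_simp
  have e4 : (2 : ℝ) ^ (-γ) ≤ (2 * (1 / 2) ^ n) ^ κ := by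
    have : (2 : ℝ) ^ (-γ) = ((1 / 2 : ℝ) ^ n) ^ κ := by
      rw [← Real.rpow_natCast, ← Real.rpow_mul (by norm_num), P.γ_eq, one_div,
        Real.inv_rpow (by norm_num), Real.rpow_neg (by norm_num)]
    rw [this]
    apply Real.rpow_le_rpow (by positivity) _ P.κ_pos.le
    linarith [show (0 : ℝ) < (1 / 2) ^ n by positivity]
  have e5 : (heightFactor n * K * χ) ^ (-γ) = (heightFactor n * K) ^ (-γ) * χ ^ (-γ) :=
    Real.mul_rpow (by positivity) (by linarith)
  have e6 : (2 * heightFactor n * K) ^ (-γ) = 2 ^ (-γ) * (heightFactor n * K) ^ (-γ) := by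
    rw [mul_assoc, Real.mul_rpow (by positivity) (by positivity)]
  have h1 := P.level
  rw [e6] at h1
  have h2 : 999 / 1000 ≤ (2 * (1 / 2 : ℝ) ^ n) ^ κ * (heightFactor n * K) ^ (-γ) :=
    h1.trans (mul_le_mul_of_nonneg_right e4 (by positivity))
  have hχγ : 0 < χ ^ γ := Real.rpow_pos_of_pos (by linarith) γ
  have h3 : χ ^ γ ≤ 1 + γ * (χ - 1) := by
    have := rpow_one_add_le_one_add_mul_self (s := χ - 1) (by linarith) hγ.le
      (by linarith [P.γ_le])
    rwa [add_sub_cancel] at this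
  have h4 : 18 / 17 ≤ (1 + χ) / 2 * χ ^ (-γ) := by
    rw [Real.rpow_neg (by linarith), ← div_eq_mul_inv, le_div_iff₀ hχγ]
    have : γ * (χ - 1) ≤ 1 / 4 * (χ - 1) := mul_le_mul_of_nonneg_right P.γ_le (by linarith)
    linarith
  rw [e1, e2, e3, e5]
  set x := 1 / K
  calc 1 + x / 16 ≤ ((1 - 72 * x) * (1 - x / 100)) * ((999 / 1000) * (18 / 17)) := by nlinarith
    _ ≤ ((1 - 72 * x) * (1 - x / 100)) * (((2 * (1 / 2 : ℝ) ^ n) ^ κ * (heightFactor n * K) ^ (-γ))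
        * ((1 + χ) / 2 * χ ^ (-γ))) := by
        apply mul_le_mul_of_nonneg_left
        · gcongr
        · exact mul_nonneg (by linarith) (by linarith)
    _ = _ := by ring

lemma factor_growth (P : Params n p lam Lam β K γ κ) :
    1 + 1 / (16 * K) ≤ ((1 - 1 / K) * (1 - 72 / K)) * (volFactor n p lam Lam * K) ^ κ
      * (1 - 1 / (100 * K)) * heightFactor n ^ (-γ) := by
  have hK := P.K_ge
  have hx : 1 / K ≤ 1 / 10000 := one_div_le_one_div_of_le (by norm_num) hK
  have hx0 : 0 < 1 / K := by positivity
  have h1 := P.vol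
  have e1 : 1 / (16 * K) = 1 / K / 16 := by field_simp
  have e2 : 1 / (100 * K) = 1 / K / 100 := by field_simp
  have e3 : 72 / K = 72 * (1 / K) := by field_simp
  have e4 : 100 / K = 100 * (1 / K) := by field_simp
  rw [e4] at h1
  rw [e1, e2, e3]
  set x := 1 / K
  have h2 : 1 - 74 * x ≤ (1 - x) * (1 - 72 * x) * (1 - x / 100) := by nlinarith [mul_pos hx0 hx0]
  calc 1 + x / 16 ≤ (1 - 74 * x) * (1 + 100 * x) := by nlinarith
    _ ≤ ((1 - x) * (1 - 72 * x) * (1 - x / 100))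
        * ((volFactor n p lam Lam * K) ^ κ * heightFactor n ^ (-γ)) := by
        gcongr
        exact le_trans (by linarith) h2
    _ = _ := by ring

/-- The value of the potential of a configuration. -/
def Valid.pot (_ : Valid T Ω u e xs N i₀ t Q G h X B) (κ γ : ℝ) : ℝ :=
  _root_.pot κ γ N (G.1 e) |(vecMatrix B).det| h (1 - ev Q X)

/-- The bound coming from configurations that reach the initial time. -/
def initBound (n : ℕ) (d : ℝ) : ℝ := 6 * (heightFactor n / d + 2) * (n.factorial * 2 ^ n)

lemma det_rpow_le (c : Ctx lam Lam p T Ω u e xs N d β)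
    (v : Valid T Ω u e xs N i₀ t Q G h X B) (hκ : 0 < κ) (hκ1 : κ ≤ 1) :
    |(vecMatrix B).det| ^ κ ≤ n.factorial * 2 ^ n := by
  have h1 : (1 : ℝ) ≤ n.factorial * 2 ^ n := by
    have : (1 : ℝ) ≤ n.factorial := by exact_mod_cast n.factorial_pos
    have : (1 : ℝ) ≤ 2 ^ n := one_le_pow₀ (by norm_num)
    nlinarith
  calc |(vecMatrix B).det| ^ κ ≤ (n.factorial * 2 ^ n : ℝ) ^ κ :=
        Real.rpow_le_rpow (abs_nonneg _) (v.det_le c) hκ.le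
    _ ≤ (n.factorial * 2 ^ n : ℝ) ^ (1 : ℝ) := Real.rpow_le_rpow_of_exponent_le h1 hκ1
    _ = _ := Real.rpow_one _

lemma Params.κ_le (P : Params n p lam Lam β K γ κ) (i : Fin n) : κ ≤ 1 := by
  have h1 : (1 : ℝ) ≤ n := by exact_mod_cast i.pos
  have h2 := P.γ_eq
  have h3 := P.γ_le
  have h4 := P.κ_pos
  nlinarith

/-- A configuration carried back to the initial time has a bounded potential. -/
lemma pot_initial (c : Ctx lam Lam p T Ω u e xs N d β) (P : Params n p lam Lam β K γ κ)
    (hh : 0 < h) (hhN : h ≤ N) (v : Valid T Ω u e xs N i₀ t Q G h X B)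
    (hβ : 0 < β) {Q₂ G₂ : (E n →L[ℝ] ℝ) × ℝ} {X₂ : E n} {B₂ : Fin n → E n}
    (v₂ : Valid T Ω u e xs N i₀ (-T) Q₂ G₂ ((36 * (n + 1) + 5) * h) X₂ B₂)
    (hJ : G.1 e ≤ 2 * G₂.1 e) (hL : 0 ≤ 1 - ev Q X) :
    v.pot κ γ ≤ initBound n d * N ^ 2 := by
  have hd := c.d_pos
  have hd1 := c.d_le
  have hN0 : 0 < N := hh.trans_le hhN
  have hγ := P.γ_pos i₀
  have hr0 : 0 < h / N := by positivity
  have hr1 : h / N ≤ 1 := by rw [div_le_one hN0]; exact hhN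
  have hH : (36 * ((n : ℝ) + 1) + 5) = heightFactor n / 16 := by unfold heightFactor; ring
  have hH0 := heightFactor_pos n
  set r := h / N with hr
  have hhr : h = r * N := by rw [hr]; field_simp
  set w := √r with hw
  have hw0 : 0 < w := Real.sqrt_pos.2 hr0
  have hw1 : w ≤ 1 := Real.sqrt_le_one.2 hr1
  have hww : w * w = r := Real.mul_self_sqrt hr0.le
  have hs := initial_slope c v₂ (s := d / 2 * w) (by positivity) (by nlinarith)
  rw [hH, Real.rpow_add (by positivity), Real.rpow_one] at hs
  have hwβ : (d / 2 * w) ^ β ≤ w ^ β :=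
    Real.rpow_le_rpow (by positivity) (by nlinarith) hβ.le
  have hwγ : w ^ β ≤ r ^ γ := by
    have : r ^ γ = w ^ (2 * γ) := by
      rw [← hww, Real.mul_rpow hw0.le hw0.le, ← Real.rpow_add hw0]; ring_nf
    rw [this]
    exact Real.rpow_le_rpow_of_exponent_ge hw0 hw1 (by linarith [P.γ_le_β])
  have hw1γ : w ≤ r ^ γ := by
    have : r ^ γ = w ^ (2 * γ) := by
      rw [← hww, Real.mul_rpow hw0.le hw0.le, ← Real.rpow_add hw0]; ring_nf
    rw [this]
    calc w = w ^ (1 : ℝ) := (Real.rpow_one _).symm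
      _ ≤ _ := Real.rpow_le_rpow_of_exponent_ge hw0 hw1 (by linarith [P.γ_le])
  have hG2 : G₂.1 e ≤ (heightFactor n / d + 2) * N * r ^ γ := by
    have h1 : d / 2 * w * G₂.1 e ≤ d / 2 * w * (heightFactor n / d * N * w + 2 * N * w ^ β) := by
      refine hs.trans ?_
      have e1 : 8 * (heightFactor n / 16 * h) = d / 2 * w * (heightFactor n / d * N * w) := by
        rw [hhr, ← hww]; field_simp; norm_num
      rw [e1, mul_add]
      have e2 : 2 * N * (d / 2 * w * (d / 2 * w) ^ β) = d / 2 * w * (2 * N * (d / 2 * w) ^ β) := by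
        ring
      rw [e2]
      gcongr
    have h2 := le_of_mul_le_mul_left h1 (by positivity)
    have h3 : heightFactor n / d * N * w ≤ heightFactor n / d * N * r ^ γ := by gcongr
    have h4 : 2 * N * w ^ β ≤ 2 * N * r ^ γ := by gcongr
    linarith
  have hrγ : 0 < r ^ γ := by positivity
  have hinv : (N / h) ^ γ = (r ^ γ)⁻¹ := by
    rw [← Real.inv_rpow hr0.le, hr, inv_div]
  have hA := det_rpow_le c v P.κ_pos (P.κ_le i₀)
  have hA0 : 0 ≤ |(vecMatrix B).det| ^ κ := by positivity
  have hLN := v.level_le c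
  unfold Valid.pot _root_.pot initBound
  rw [hinv]
  calc G.1 e * |(vecMatrix B).det| ^ κ * (r ^ γ)⁻¹ * (1 - ev Q X)
      ≤ (2 * ((heightFactor n / d + 2) * N * r ^ γ)) * (n.factorial * 2 ^ n) * (r ^ γ)⁻¹
        * (3 * N) := by
        have := v.J_pos
        gcongr
        linarith
    _ = _ := by field_simp; norm_num

end

section
variable {lam Lam p T : ℝ} {Ω : Set (E n)} {u : E n → ℝ → ℝ} {e xs : E n} {N d β : ℝ}
  {i₀ : Fin n} {t : ℝ} {Q G : (E n →L[ℝ] ℝ) × ℝ} {h : ℝ} {X : E n} {B : Fin n → E n} {K γ κ : ℝ}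

/-- The ratio that the level and the slope must have to the height. -/
def ratio (n : ℕ) (d K : ℝ) : ℝ := 100 * (n + 1) * heightFactor n * K / d

set_option maxHeartbeats 800000 in
/-- A configuration with small height is either close to the initial time or can be improved. -/
lemma improve (c : Ctx lam Lam p T Ω u e xs N d β) (P : Params n p lam Lam β K γ κ) (hβ : 0 < β)
    (v : Valid T Ω u e xs N i₀ t Q G h X B) (hL : ratio n d K * h ≤ 1 - ev Q X)
    (hJ : ratio n d K * h ≤ G.1 e) :
    v.pot κ γ ≤ initBound n d * N ^ 2 ∨
    ∃ (t' : ℝ) (Q' G' : (E n →L[ℝ] ℝ) × ℝ) (h' : ℝ) (X' : E n) (B' : Fin n → E n)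
      (v' : Valid T Ω u e xs N i₀ t' Q' G' h' X' B'), h ≤ h' ∧
      (1 + 1 / (16 * K)) * v.pot κ γ ≤ v'.pot κ γ := by
  have hd := c.d_pos
  have hd1 := c.d_le
  have hh := v.h_pos
  have hN0 : 0 < N := hh.trans_le v.h_le
  have hJ0 := v.J_pos
  have hK := P.K_ge
  have hK0 : 0 < K := by linarith
  have hn : 1 ≤ n := i₀.pos
  have hn1 : (1 : ℝ) ≤ n := by exact_mod_cast hn
  have hLam := c.Lam_pos
  have hH0 := heightFactor_pos n
  have hH1 := heightFactor_ge n
  have hHd : (36 * ((n : ℝ) + 1) + 5) = heightFactor n / 16 := by unfold heightFactor; ring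
  have hLN := v.level_le c
  have hγ := P.γ_pos i₀
  have hdet0 : 0 < |(vecMatrix B).det| := abs_pos.2 v.det_ne
  set H := heightFactor n with hHdef
  set J := G.1 e with hJdef
  set L := 1 - ev Q X with hLdef
  set A := |(vecMatrix B).det| with hA
  have hLbig : 100 * (n + 1) * H * K * h ≤ L := by
    refine le_trans ?_ hL
    rw [ratio, ← hHdef, div_mul_eq_mul_div, le_div_iff₀ hd]
    exact mul_le_of_le_one_right (by positivity) hd1
  have hHK : 0 < H * K * h := by positivity
  have hL200 : 200 * (H * K * h) ≤ L := by
    linarith [mul_le_mul_of_nonneg_right hn1 hHK.le]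
  have hHh1 : 656 * h ≤ H * h := mul_le_mul_of_nonneg_right (by linarith) hh.le
  have h6 : 6 * ((n : ℝ) + 1) ≤ H := by linarith
  have h6h : h ≤ 6 * ((n : ℝ) + 1) * h := le_mul_of_one_le_left hh.le (by linarith)
  have hL0 : 0 < L := by linarith
  have hHh : H * h * 10000 ≤ H * K * h := by
    linarith [mul_le_mul_of_nonneg_left hK (mul_pos hH0 hh).le]
  have hHhN : H * h ≤ N := by linarith
  have hKh : 100 * (K * h) ≤ L := by
    linarith [mul_le_mul_of_nonneg_right hH1 (mul_pos hK0 hh).le, mul_pos hK0 hh]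
  have hLh : (1 - 1 / (100 * K)) * L ≤ L - h := by
    have : h ≤ L / (100 * K) := by rw [le_div_iff₀ (by positivity)]; linarith
    have e1 : (1 - 1 / (100 * K)) * L = L - L / (100 * K) := by field_simp
    linarith
  have hx1 : 1 / (100 * K) ≤ 1 := by rw [div_le_one (by positivity)]; linarith
  have h72 : 72 / K ≤ 1 / 100 := by rw [div_le_div_iff₀ hK0 (by norm_num)]; linarith
  set s := K * h / J with hs
  have hs0 : 0 < s := by positivity
  have hsd : s < d / (4 * (n + 1)) := by
    rw [ratio, ← hHdef, div_mul_eq_mul_div, div_le_iff₀ hd] at hJ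
    rw [hs, div_lt_div_iff₀ hJ0 (by positivity)]
    have h0 : 0 < (n + 1) * K * h := by positivity
    linarith [mul_le_mul_of_nonneg_right hH1 h0.le]
  by_cases hfast : ∃ δ : ℝ, (δ = 1 ∨ δ = -1) ∧ J * s / 2 + 3 * h
      < u (ctr X B i₀ xs + (δ * s) • e) t - ev Q (ctr X B i₀ xs + (δ * s) • e)
  · right
    obtain ⟨δ, hδ, hf⟩ := hfast
    obtain ⟨Q', G', v', hG', hQ'⟩ := steepen c v hs0 hsd hδ
      (le_trans (mul_le_mul_of_nonneg_right h6 hh.le) hHhN) hf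
    refine ⟨t, Q', G', _, X, B, v', h6h, ?_⟩
    refine pot_gain (a := 1 + 1 / K) (b := 1) (l := 1 - 1 / (100 * K)) (m := 6 * (n + 1))
      (by positivity) zero_le_one (by linarith) (by positivity) hN0 hh hJ0.le (abs_nonneg _) hL0.le
      ?_ (one_mul _).le rfl (hLh.trans hQ') (factor_steepen P)
    rw [hG', hs, ← hJdef]
    apply le_of_eq
    field_simp
  · push Not at hfast
    set Y := (320 * (n : ℝ) ^ 2 * (4 * (n : ℝ) ^ 2) * h) ^ n / (s * (vecMatrix B).det) ^ 2 with hY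
    have hdet := v.det_ne
    have hY0 : 0 < Y := by positivity
    have hYA : Y = (320 * (n : ℝ) ^ 2 * (4 * (n : ℝ) ^ 2) * h) ^ n / (s * A) ^ 2 := by
      rw [hY, hA, mul_pow s, mul_pow s, sq_abs]
    set W := 3 * h / (2 * Lam * Y ^ p) with hW
    have hYp : 0 < 2 * Lam * Y ^ p := by positivity
    have hW0 : 0 < W := by positivity
    have hWY : W * (2 * Lam * Y ^ p) = 3 * h := div_mul_cancel₀ _ hYp.ne'
    have hJs : 72 * h / s = 72 / K * J := by rw [hs]; field_simp
    have h72J := mul_le_mul_of_nonneg_right h72 hJ0.le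
    have hre : ∀ t₂, -T ≤ t₂ → t - W ≤ t₂ → t₂ ≤ t → ∃ Q₂ G₂ : (E n →L[ℝ] ℝ) × ℝ,
        Valid T Ω u e xs N i₀ t₂ Q₂ G₂ ((36 * (n + 1) + 5) * h) X B ∧
        J - 72 / K * J ≤ G₂.1 e ∧ u X t - ev Q₂ X ≤ (36 * (n + 1) + 5) * h ∧
        L - h ≤ 1 - ev Q₂ X := by
      intro t₂ h1 h2 h3
      have hWt : (t - t₂) * (2 * Lam * Y ^ p) ≤ 3 * h :=
        le_trans (mul_le_mul_of_nonneg_right (by linarith) hYp.le) hWY.le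
      have hN5 : (36 * ((n : ℝ) + 1) + 5) * h ≤ N := by rw [hHd]; linarith
      have hJK : 72 * h / s < G.1 e := by
        rw [hJs, ← hJdef]
        linarith
      have := rewind c v hs0 hsd h1 h3 hfast hWt hN5 hJK
      rwa [hJs] at this
    rcases le_or_gt (t - W) (-T) with hcase | hcase
    · left
      obtain ⟨Q₂, G₂, v₂, hG₂, -, -⟩ := hre (-T) le_rfl hcase v.t_mem.1
      exact pot_initial c P hh v.h_le v hβ v₂ (by linarith) hL0.le
    · right
      obtain ⟨Q₂, G₂, v₂, hG₂, hX₂, hL₂⟩ := hre (t - W) hcase.le le_rfl (by linarith)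
      have hG₂' : (1 - 72 / K) * J ≤ G₂.1 e := by linarith
      have hL₂' : (1 - 1 / (100 * K)) * L ≤ 1 - ev Q₂ X := hLh.trans hL₂
      set L₂ := 1 - ev Q₂ X with hL₂def
      have hL₂half : L / 2 ≤ L₂ := by
        linarith
      have h64 : 64 * K * ((36 * (n + 1) + 5) * h) ≤ L₂ := by rw [hHd]; linarith
      have hL₂0 : 0 < L₂ := by linarith
      by_cases hext : ∃ x' ∈ closure Ω, u x' (t - W) - ev Q₂ x'
          + 16 * ((36 * (n + 1) + 5) * h) / L₂ * (ev Q₂ x' - (ev Q₂ X - L₂ / 4))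
          < (1 - 1 / K) * (|ev G₂ x'| / 2)
      · obtain ⟨x', hx', hx⟩ := hext
        obtain ⟨χ, hχ, X', B', v', hB', hL'⟩ := extend_level c v₂ (by linarith) hL₂0 h64 hx' hx
        have hm : 16 * K * χ * ((36 * (n + 1) + 5) * h) = H * K * χ * h := by rw [hHd]; ring
        refine ⟨t - W, Q₂, G₂, _, X', B', v', ?_, ?_⟩
        · rw [hm]
          have : H * K * h * 1 ≤ H * K * h * χ := by gcongr; linarith
          linarith
        · refine pot_gain (a := 1 - 72 / K) (b := (2 * (1 / 2) ^ n) ^ κ)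
            (l := (1 - 1 / (100 * K)) * ((1 + χ) / 2)) (m := H * K * χ) (by linarith)
            (by positivity) (mul_nonneg (by linarith) (by linarith)) (by positivity) hN0 hh hJ0.le
            (abs_nonneg _) hL0.le hG₂' ?_ hm ?_ (factor_extend P i₀ hχ)
          · rw [hB', Real.mul_rpow (by positivity) (abs_nonneg _)]
          · rw [hL']
            calc (1 - 1 / (100 * K)) * ((1 + χ) / 2) * L
                = ((1 - 1 / (100 * K)) * L) * ((1 + χ) / 2) := by ring
              _ ≤ _ := mul_le_mul_of_nonneg_right hL₂' (by linarith)
      · push Not at hext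
        have h16 : 16 * ((36 * (n + 1) + 5) * h) = H * h := by rw [hHd]; ring
        have hLH : H * h ≤ L₂ := by linarith
        obtain ⟨Q₃, G₃, B', v', hG₃, hL₃, hvol⟩ := growth c v₂ (by linarith) v.t_mem.2 hX₂
          (by linarith) (by rw [h16]; exact hLH) (by rw [h16]; exact hHhN) hext
        refine ⟨t - W, Q₃, G₃, _, X, B', v', by rw [h16]; linarith, ?_⟩
        have hx2 : 1 / K ≤ 1 / 100 := by rw [div_le_div_iff₀ hK0 (by norm_num)]; linarith
        have hJ₃ : (1 - 1 / K) * (1 - 72 / K) * J ≤ G₃.1 e := by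
          rw [hG₃, mul_assoc]
          exact mul_le_mul_of_nonneg_left hG₂' (by linarith)
        have hvg : volFactor n p lam Lam * K * A ≤ |(vecMatrix B').det| := by
          refine vol_gain hn c.p_pos c.lam_pos hLam hK0 hh hJ0 hdet0 (abs_pos.2 v'.det_ne)
            (J₃ := G₃.1 e) (W := W) ?_ ?_ ?_
          · have h12 : 1 / 2 ≤ (1 - 1 / K) * (1 - 72 / K) := by
              calc (1 / 2 : ℝ) ≤ 99 / 100 * (99 / 100) := by norm_num
                _ ≤ _ := by gcongr <;> linarith
            linarith [mul_le_mul_of_nonneg_right h12 hJ0.le]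
          · rw [← hs, ← hYA]; exact hWY
          · rw [mul_pow _ |_|, sq_abs, ← mul_pow]
            rwa [sub_sub_cancel] at hvol
        have hV := volFactor_pos hn (p := p) c.lam_pos hLam
        refine pot_gain (a := (1 - 1 / K) * (1 - 72 / K)) (b := (volFactor n p lam Lam * K) ^ κ)
          (l := 1 - 1 / (100 * K)) (m := H) (mul_nonneg (by linarith) (by linarith))
          (by positivity) (by linarith) hH0 hN0 hh hJ0.le (abs_nonneg _) hL0.le hJ₃ ?_ h16
          (hL₂'.trans hL₃) (factor_growth P)
        rw [← Real.mul_rpow (by positivity) (abs_nonneg _)]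
        exact Real.rpow_le_rpow (by positivity) hvg P.κ_pos.le

/-- The bound on the potential of all configurations. -/
def potBound (n : ℕ) (d K : ℝ) : ℝ :=
  initBound n d + (3 + 24 / d) * ratio n d K * (n.factorial * 2 ^ n)

lemma pot_le_mul (c : Ctx lam Lam p T Ω u e xs N d β) (P : Params n p lam Lam β K γ κ)
    (v : Valid T Ω u e xs N i₀ t Q G h X B) {a b : ℝ} (ha : G.1 e ≤ a) (hb : 1 - ev Q X ≤ b)
    (hb0 : 0 ≤ b) : v.pot κ γ ≤ a * b * (N / h) * (n.factorial * 2 ^ n) := by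
  have hh := v.h_pos
  have hN0 : 0 < N := hh.trans_le v.h_le
  have hJ := v.J_pos
  have hA := det_rpow_le c v P.κ_pos (P.κ_le i₀)
  have hNh : (N / h) ^ γ ≤ N / h := by
    calc (N / h) ^ γ ≤ (N / h) ^ (1 : ℝ) := Real.rpow_le_rpow_of_exponent_le
          (by rw [le_div_iff₀ hh, one_mul]; exact v.h_le) (by linarith [P.γ_le])
      _ = _ := Real.rpow_one _
  have hNh0 : 0 ≤ (N / h) ^ γ := by positivity
  unfold Valid.pot _root_.pot
  calc G.1 e * |(vecMatrix B).det| ^ κ * (N / h) ^ γ * (1 - ev Q X)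
      ≤ G.1 e * |(vecMatrix B).det| ^ κ * (N / h) ^ γ * b := by gcongr
    _ ≤ a * (n.factorial * 2 ^ n) * (N / h) * b := by
        have : 0 ≤ a := by linarith
        gcongr
    _ = _ := by ring

theorem pot_le (c : Ctx lam Lam p T Ω u e xs N d β) (P : Params n p lam Lam β K γ κ) (hβ : 0 < β)
    (v : Valid T Ω u e xs N i₀ t Q G h X B) : v.pot κ γ ≤ potBound n d K * N ^ 2 := by
  have hd := c.d_pos
  have hK := P.K_ge
  have hK0 : 0 < K := by linarith
  have hH0 := heightFactor_pos n
  have hR : 0 < ratio n d K := by unfold ratio; positivity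
  have hh := v.h_pos
  have hN0 : 0 < N := hh.trans_le v.h_le
  have hI : 0 ≤ initBound n d := by unfold initBound; positivity
  set S : Set ℝ := {r | ∃ (t' : ℝ) (Q' G' : (E n →L[ℝ] ℝ) × ℝ) (h' : ℝ) (X' : E n)
    (B' : Fin n → E n) (v' : Valid T Ω u e xs N i₀ t' Q' G' h' X' B'), h ≤ h' ∧ r = v'.pot κ γ}
    with hS
  have hbdd : BddAbove S := by
    refine ⟨24 / d * N * (3 * N) * (N / h) * (n.factorial * 2 ^ n), ?_⟩
    rintro r ⟨t', Q', G', h', X', B', v', hh', rfl⟩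
    refine (pot_le_mul c P v' (v'.slope_le_N c) (v'.level_le c) (by positivity)).trans ?_
    gcongr
  have hvS : v.pot κ γ ∈ S := ⟨t, Q, G, h, X, B, v, le_rfl, rfl⟩
  by_contra! hcon
  have hpos : 0 < v.pot κ γ := by
    refine lt_of_le_of_lt ?_ hcon
    unfold potBound
    positivity
  set ε := 1 / (16 * K) with hε
  have hε0 : 0 < ε := by positivity
  have hsup : v.pot κ γ ≤ sSup S := le_csSup hbdd hvS
  have hlt : sSup S / (1 + ε) < sSup S := by
    rw [div_lt_iff₀ (by positivity)]
    nlinarith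
  obtain ⟨r₁, hr₁S, hr₁⟩ := exists_lt_of_lt_csSup ⟨_, hvS⟩ hlt
  obtain ⟨r, hrS, hr⟩ : ∃ r ∈ S, sSup S / (1 + ε) < r ∧ v.pot κ γ ≤ r := by
    rcases le_total r₁ (v.pot κ γ) with hle | hle
    · exact ⟨_, hvS, hr₁.trans_le hle, le_rfl⟩
    · exact ⟨_, hr₁S, hr₁, hle⟩
  obtain ⟨t', Q', G', h', X', B', v', hh', rfl⟩ := hrS
  have hh'0 := v'.h_pos
  have hbig : potBound n d K * N ^ 2 < v'.pot κ γ := hcon.trans_le hr.2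
  have hF : (0 : ℝ) < n.factorial * 2 ^ n := by positivity
  have hb1 : 24 / d * ratio n d K * (n.factorial * 2 ^ n) ≤ potBound n d K := by
    unfold potBound
    have : 0 < 3 * ratio n d K * (n.factorial * 2 ^ n) := by positivity
    linarith
  have hb2 : 3 * ratio n d K * (n.factorial * 2 ^ n) ≤ potBound n d K := by
    unfold potBound
    have : 0 < 24 / d * ratio n d K * (n.factorial * 2 ^ n) := by positivity
    linarith
  have hLh : ratio n d K * h' ≤ 1 - ev Q' X' := by
    by_contra! hlt
    have h1 := pot_le_mul c P v' (v'.slope_le_N c) hlt.le (by positivity)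
    have e1 : 24 / d * N * (ratio n d K * h') * (N / h') * (n.factorial * 2 ^ n)
        = 24 / d * ratio n d K * (n.factorial * 2 ^ n) * N ^ 2 := by field_simp
    rw [e1] at h1
    have := mul_le_mul_of_nonneg_right hb1 (sq_nonneg N)
    linarith
  have hJh : ratio n d K * h' ≤ G'.1 e := by
    by_contra! hlt
    have h1 := pot_le_mul c P v' hlt.le (v'.level_le c) (by positivity)
    have e1 : ratio n d K * h' * (3 * N) * (N / h') * (n.factorial * 2 ^ n)
        = 3 * ratio n d K * (n.factorial * 2 ^ n) * N ^ 2 := by field_simp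
    rw [e1] at h1
    have := mul_le_mul_of_nonneg_right hb2 (sq_nonneg N)
    linarith
  rcases improve c P hβ v' hLh hJh with h1 | ⟨t₁, Q₁, G₁, h₁, X₁, B₁, v₁, hh₁, h1⟩
  · have h2 : initBound n d ≤ potBound n d K := by
      unfold potBound
      have : 0 ≤ (3 + 24 / d) * ratio n d K * (n.factorial * 2 ^ n) := by positivity
      linarith
    have := mul_le_mul_of_nonneg_right h2 (sq_nonneg N)
    linarith
  · have h2 : v₁.pot κ γ ≤ sSup S :=
      le_csSup hbdd ⟨t₁, Q₁, G₁, h₁, X₁, B₁, v₁, hh'.trans hh₁, rfl⟩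
    have h3 := hr.1
    rw [div_lt_iff₀ (by positivity)] at h3
    linarith

end

lemma exists_orthonormal_frame {e : E n} (he : ‖e‖ = 1) (i₀ : Fin n) :
    ∃ b : Fin n → E n, b i₀ = e ∧ (∀ i, ‖b i‖ = 1) ∧ |(vecMatrix b).det| = 1 := by
  have ho : Orthonormal ℝ (Set.domRestrict {i₀} (fun _ : Fin n => e)) := by
    rw [orthonormal_iff_ite]
    intro i j
    have : i = j := Subsingleton.elim i j
    simp [this, he]
  obtain ⟨b, hb⟩ := ho.exists_orthonormalBasis_extension_of_card_eq (by simp)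
  refine ⟨b, hb i₀ rfl, fun i => b.norm_eq_one i, ?_⟩
  have h1 := (EuclideanSpace.basisFun (Fin n) ℝ).det_to_matrix_orthonormalBasis_real b
  have h2 : (EuclideanSpace.basisFun (Fin n) ℝ).toBasis.det b = (vecMatrix b).det := by
    rw [Module.Basis.det_apply, ← Matrix.det_transpose]
    congr 1
  rw [h2] at h1
  rcases h1 with h1 | h1 <;> simp [h1]

section
variable {lam Lam p T : ℝ} {Ω : Set (E n)} {u : E n → ℝ → ℝ} {e xs : E n} {N d β : ℝ}
  {K γ κ : ℝ}

lemma Ctx.zero_mem (c : Ctx lam Lam p T Ω u e xs N d β) : (0 : ℝ) ∈ Icc (-T) 0 :=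
  ⟨by linarith [c.T_pos], le_rfl⟩

lemma Ctx.N_pos (c : Ctx lam Lam p T Ω u e xs N d β) : 0 < N := by linarith [c.N_ge]

lemma Ctx.exists_support (c : Ctx lam Lam p T Ω u e xs N d β) {y : E n}
    (hy : y ∈ ball xs (d / 2)) :
    ∃ q : (E n →L[ℝ] ℝ) × ℝ, (∀ x ∈ closure Ω, ev q x ≤ u x 0) ∧ ev q y = u y 0 ∧
      ∀ w, |q.1 w| ≤ 8 * N / d * ‖w‖ := by
  have hd := c.d_pos
  have hN := c.N_pos
  have hyd : y ∈ ball xs d := ball_subset_ball (by linarith) hy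
  obtain ⟨q, hq, hqy⟩ := exists_affine_support c.isOpen c.conv (c.contSlice c.zero_mem)
    (c.sol.1.conv 0 c.zero_mem) (c.ball_sub' hyd)
  have key : ∀ w, q.1 w ≤ 8 * N / d * ‖w‖ := by
    intro w
    rcases eq_or_ne w 0 with rfl | hw
    · simp
    have hw0 : 0 < ‖w‖ := norm_pos_iff.2 hw
    have hmem : y + (d / 4 / ‖w‖) • w ∈ ball xs d := by
      rw [mem_ball, dist_eq_norm] at hy ⊢
      calc ‖y + (d / 4 / ‖w‖) • w - xs‖ = ‖(y - xs) + (d / 4 / ‖w‖) • w‖ := by congr 1; abel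
        _ ≤ ‖y - xs‖ + ‖(d / 4 / ‖w‖) • w‖ := norm_add_le _ _
        _ = ‖y - xs‖ + d / 4 := by
            rw [norm_smul, Real.norm_of_nonneg (by positivity), div_mul_cancel₀ _ hw0.ne']
        _ < d := by linarith
    have h1 := hq _ (subset_closure (c.ball_sub hmem).1)
    have h2 := (c.ball_sub hmem).2
    rw [ev_add, map_smul, smul_eq_mul, hqy] at h1
    have h3 := c.lower y (subset_closure (c.ball_sub' hyd)) 0 c.zero_mem
    have h4 : d / 4 / ‖w‖ * q.1 w ≤ 2 * N := by linarith
    rw [div_mul_eq_mul_div, div_le_iff₀ hw0] at h4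
    rw [div_mul_eq_mul_div, le_div_iff₀ hd]
    linarith
  refine ⟨q, hq, hqy, fun w => abs_le.2 ⟨?_, key w⟩⟩
  have := key (-w)
  rw [map_neg, norm_neg] at this
  linarith

lemma Ctx.lipschitz (c : Ctx lam Lam p T Ω u e xs N d β) {y z : E n}
    (hy : y ∈ ball xs (d / 2)) (hz : z ∈ ball xs (d / 2)) :
    u y 0 - u z 0 ≤ 8 * N / d * ‖y - z‖ := by
  obtain ⟨q, hq, hqy, hlip⟩ := c.exists_support hy
  have h1 := hq z (subset_closure (c.ball_sub' (ball_subset_ball (by linarith [c.d_pos]) hz)))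
  have h2 := ev_add q z (y - z)
  rw [add_sub_cancel, hqy] at h2
  linarith [le_abs_self (q.1 (y - z)), hlip (y - z)]

/-- The constant in the bound of the second differences. -/
def secondConst (n : ℕ) (d K : ℝ) : ℝ := √(128 * potBound n d K) / d

/-- Supporting planes at opposite points of a segment have close slopes. -/
lemma slope_gap (c : Ctx lam Lam p T Ω u e xs N d β) (P : Params n p lam Lam β K γ κ) (hβ : 0 < β)
    (i₀ : Fin n) {s : ℝ} (hs : 0 < s) (hsd : s ≤ d / 32) {q₁ q₂ : (E n →L[ℝ] ℝ) × ℝ}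
    (h₁ : ∀ x ∈ closure Ω, ev q₁ x ≤ u x 0) (h₁' : ev q₁ (xs + s • e) = u (xs + s • e) 0)
    (hl₁ : ∀ w, |q₁.1 w| ≤ 8 * N / d * ‖w‖)
    (h₂ : ∀ x ∈ closure Ω, ev q₂ x ≤ u x 0) (h₂' : ev q₂ (xs + (-s) • e) = u (xs + (-s) • e) 0)
    (hl₂ : ∀ w, |q₂.1 w| ≤ 8 * N / d * ‖w‖) :
    q₁.1 e - q₂.1 e ≤ secondConst n d K * N * s ^ (κ / 2) := by
  have hd := c.d_pos
  have hd1 := c.d_le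
  have hN := c.N_pos
  have hH := heightFactor_pos n
  have hK0 : 0 < K := by linarith [P.K_ge]
  have hpb : 0 ≤ potBound n d K := by
    unfold potBound initBound ratio
    positivity
  have hsc : 0 ≤ secondConst n d K := by unfold secondConst; positivity
  rcases le_or_gt (q₁.1 e - q₂.1 e) 0 with hJ | hJ
  · exact hJ.trans (by positivity)
  obtain ⟨b, hbi, hb1, hbdet⟩ := exists_orthonormal_frame c.e_norm i₀
  have hball : ∀ w : E n, ‖w‖ = s → xs + w ∈ ball xs (d / 2) := by
    intro w hw
    rw [mem_ball, dist_eq_norm, add_sub_cancel_left, hw]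
    linarith
  have hsub : ball xs (d / 2) ⊆ closure Ω := fun x hx =>
    subset_closure (c.ball_sub' (ball_subset_ball (by linarith) hx))
  have hxs : xs ∈ ball xs (d / 2) := mem_ball_self (by linarith)
  have hse : ∀ r : ℝ, |r| = s → ‖r • e‖ = s := fun r hr => by
    rw [norm_smul, c.e_norm, mul_one, Real.norm_eq_abs, hr]
  have hsa : |s| = s := abs_of_pos hs
  have hsa' : |-s| = s := by rw [abs_neg, hsa]
  have g₁ : u xs 0 - ev q₁ xs ≤ 16 * N / d * s := by
    have a1 := c.lipschitz hxs (hball _ (hse s hsa))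
    have a2 := hl₁ (s • e)
    rw [sub_add_cancel_left, norm_neg, hse s hsa] at a1
    rw [hse s hsa] at a2
    rw [ev_add] at h₁'
    have e1 : 16 * N / d * s = 8 * N / d * s + 8 * N / d * s := by ring
    linarith [le_abs_self (q₁.1 (s • e))]
  have g₂ : u xs 0 - ev q₂ xs ≤ 16 * N / d * s := by
    have a1 := c.lipschitz hxs (hball _ (hse (-s) hsa'))
    have a2 := hl₂ ((-s) • e)
    rw [sub_add_cancel_left, norm_neg, hse (-s) hsa'] at a1
    rw [hse (-s) hsa'] at a2
    rw [ev_add] at h₂'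
    have e1 : 16 * N / d * s = 8 * N / d * s + 8 * N / d * s := by ring
    linarith [le_abs_self (q₂.1 ((-s) • e))]
  set Q : (E n →L[ℝ] ℝ) × ℝ := (1 / 2 : ℝ) • (q₁ + q₂) with hQ
  have hevQ : ∀ x, ev Q x = (ev q₁ x + ev q₂ x) / 2 := by intro x; simp [hQ, ev]; ring
  have hevG : ∀ x, ev (q₁ - q₂) x = ev q₁ x - ev q₂ x := by intro x; simp [ev]; ring
  have hG1 : (q₁ - q₂).1 e = q₁.1 e - q₂.1 e := by simp
  set h := 32 * N / d * s with hh
  have hh0 : 0 < h := by positivity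
  have hhN : h ≤ N := by
    rw [hh, div_mul_eq_mul_div, div_le_iff₀ hd]
    nlinarith
  set B : Fin n → E n := Function.update (fun i => s • b i) i₀ e with hB
  have hBdet : |(vecMatrix B).det| = s⁻¹ * s ^ n := by
    have e1 : e = s⁻¹ • ((fun i => s • b i) i₀) := by
      simp only [hbi]; rw [smul_smul, inv_mul_cancel₀ hs.ne', one_smul]
    have e2 : B = Function.update (fun i => s • b i) i₀ (s⁻¹ • ((fun i => s • b i) i₀)) := by
      rw [← e1]
    rw [e2, vecMatrix_det_update_smul, vecMatrix_det_smul, abs_mul, abs_mul, hbdet,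
      mul_one, abs_of_pos (by positivity), abs_of_pos (by positivity)]
  have gap0 : u xs 0 - ev Q xs ≤ 16 * N / d * s := by rw [hevQ]; linarith
  have e32 : h = 16 * N / d * s + (8 * N / d * s + 8 * N / d * s) := by rw [hh]; ring
  have e16 : 0 < 8 * N / d * s := by positivity
  have hvtx : ∀ i, vtx xs B i₀ i ∈ closure Ω ∧ u (vtx xs B i₀ i) 0 - ev Q (vtx xs B i₀ i) ≤ h := by
    intro i
    by_cases hi : i = i₀
    · subst hi
      rw [vtx_self]
      exact ⟨hsub hxs, by linarith⟩
    · rw [vtx_ne _ _ hi, hB, Function.update_of_ne hi]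
      have hn : ‖s • b i‖ = s := by rw [norm_smul, hb1, mul_one, Real.norm_of_nonneg hs.le]
      refine ⟨hsub (hball _ hn), ?_⟩
      have a1 := c.lipschitz (hball _ hn) hxs
      have a2 := hl₁ (s • b i)
      have a3 := hl₂ (s • b i)
      rw [add_sub_cancel_left] at a1
      rw [hn] at a1 a2 a3
      rw [hevQ] at gap0 ⊢
      rw [ev_add, ev_add]
      linarith [neg_abs_le (q₁.1 (s • b i)), neg_abs_le (q₂.1 (s • b i))]
  have v : Valid T Ω u e xs N i₀ 0 Q (q₁ - q₂) h xs B := by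
    refine ⟨c.zero_mem, hh0, hhN, ?_, by simp [hB], fun i => (hvtx i).1, fun i => (hvtx i).2,
      by linarith, by rwa [hG1], ?_⟩
    · intro x hx
      rw [hevQ, hevG]
      rcases abs_cases (ev q₁ x - ev q₂ x) with h4 | h4 <;> rw [h4.1] <;>
        linarith [h₁ x hx, h₂ x hx]
    · rw [← abs_pos, hBdet]; positivity
  have hpot := pot_le c P hβ v
  have hslope := v.slope_le c
  unfold Valid.pot pot at hpot
  rw [hG1] at hpot hslope
  set J := q₁.1 e - q₂.1 e with hJd
  set L := 1 - ev Q xs with hL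
  have hvol : |(vecMatrix B).det| ^ κ * (N / h) ^ γ = s ^ (-κ) * (d / 32) ^ γ := by
    have e1 : N / h = d / 32 * s⁻¹ := by rw [hh]; field_simp
    rw [hBdet, e1, Real.mul_rpow (by positivity) (by positivity),
      Real.mul_rpow (by positivity) (by positivity), P.γ_eq, ← Real.rpow_natCast,
      ← Real.rpow_mul hs.le, Real.inv_rpow hs.le, Real.inv_rpow hs.le, Real.rpow_neg hs.le]
    have : s ^ (n * κ) ≠ 0 := (Real.rpow_pos_of_pos hs _).ne'
    field_simp
  rw [mul_assoc J, hvol] at hpot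
  have hdγ : d / 32 ≤ (d / 32) ^ γ := by
    calc d / 32 = (d / 32) ^ (1 : ℝ) := (Real.rpow_one _).symm
      _ ≤ _ := Real.rpow_le_rpow_of_exponent_ge (by positivity) (by linarith)
        (by linarith [P.γ_le])
  have hsκ : 0 < s ^ (-κ) := Real.rpow_pos_of_pos hs _
  have hL0 : d / 4 * J ≤ L := by
    have : 4 / d * L = L / (d / 4) := by field_simp
    rw [this, le_div_iff₀ (by positivity)] at hslope
    linarith
  have hJJ : J ^ 2 * (d ^ 2 / 128) * s ^ (-κ) ≤ potBound n d K * N ^ 2 := by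
    refine le_trans ?_ hpot
    calc J ^ 2 * (d ^ 2 / 128) * s ^ (-κ) = J * (s ^ (-κ) * (d / 32)) * (d / 4 * J) := by ring
      _ ≤ _ := by gcongr
  apply le_of_sq_le_sq _ (by positivity)
  have e1 : (s ^ (κ / 2)) ^ 2 = s ^ κ := by
    rw [← Real.rpow_natCast, ← Real.rpow_mul hs.le]; norm_num
  have e2 : (secondConst n d K * N * s ^ (κ / 2)) ^ 2
      = potBound n d K * N ^ 2 * (s ^ κ * (128 / d ^ 2)) := by
    rw [mul_pow, mul_pow, e1, secondConst, div_pow, Real.sq_sqrt (by positivity)]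
    ring
  rw [e2]
  have hsκ' : 0 < s ^ κ := Real.rpow_pos_of_pos hs _
  calc J ^ 2 = J ^ 2 * (d ^ 2 / 128) * s ^ (-κ) * (s ^ κ * (128 / d ^ 2)) := by
        rw [Real.rpow_neg hs.le]; field_simp
    _ ≤ _ := by gcongr

/-- First-order expansion of `u(·,0)` along the direction `e`. -/
lemma line_expansion (c : Ctx lam Lam p T Ω u e xs N d β) (P : Params n p lam Lam β K γ κ)
    (hβ : 0 < β) (i₀ : Fin n) : ∃ D : ℝ, |D| ≤ 8 * N / d ∧ ∀ τ : ℝ, |τ| ≤ d / 32 →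
      0 ≤ u (xs + τ • e) 0 - u xs 0 - D * τ ∧
      u (xs + τ • e) 0 - u xs 0 - D * τ ≤ secondConst n d K * N * |τ| ^ (1 + κ / 2) := by
  have hd := c.d_pos
  have hmem : ∀ r : ℝ, |r| ≤ d / 32 → xs + r • e ∈ ball xs (d / 2) := fun r hr => by
    rw [mem_ball, dist_eq_norm, add_sub_cancel_left, norm_smul, c.e_norm, mul_one,
      Real.norm_eq_abs]
    linarith
  have hsub : ball xs (d / 2) ⊆ closure Ω := fun x hx =>
    subset_closure (c.ball_sub' (ball_subset_ball (by linarith) hx))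
  have hxs : xs ∈ ball xs (d / 2) := mem_ball_self (by linarith)
  obtain ⟨q, hq, hqx, hql⟩ := c.exists_support hxs
  have hDabs := hql e
  rw [c.e_norm, mul_one] at hDabs
  have hlow : ∀ τ : ℝ, |τ| ≤ d / 32 → 0 ≤ u (xs + τ • e) 0 - u xs 0 - q.1 e * τ := by
    intro τ hτ
    have := hq _ (hsub (hmem τ hτ))
    rw [ev_add, map_smul, smul_eq_mul, hqx] at this
    linarith
  refine ⟨q.1 e, hDabs, fun τ hτ => ⟨hlow τ hτ, ?_⟩⟩
  rcases eq_or_ne τ 0 with rfl | hτ0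
  · have : (0 : ℝ) < 1 + κ / 2 := by linarith [P.κ_pos]
    simp [Real.zero_rpow this.ne']
  set s := |τ| with hs
  have hs0 : 0 < s := abs_pos.2 hτ0
  have hsa : |s| ≤ d / 32 := by rw [hs, abs_abs]; exact hτ
  have hsa' : |-s| ≤ d / 32 := by rw [abs_neg]; exact hsa
  obtain ⟨q₁, h₁, h₁', hl₁⟩ := c.exists_support (hmem s hsa)
  obtain ⟨q₂, h₂, h₂', hl₂⟩ := c.exists_support (hmem (-s) hsa')
  have hgap := slope_gap c P hβ i₀ hs0 hτ h₁ h₁' hl₁ h₂ h₂' hl₂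
  have hx1 := h₁ xs (hsub hxs)
  have hx2 := h₂ xs (hsub hxs)
  rw [ev_add, map_smul, smul_eq_mul] at h₁' h₂'
  have hl1 := hlow s hsa
  have hl2 := hlow (-s) hsa'
  have h3 := mul_le_mul_of_nonneg_right hgap hs0.le
  have e1 : secondConst n d K * N * s ^ (κ / 2) * s = secondConst n d K * N * s ^ (1 + κ / 2) := by
    rw [Real.rpow_add hs0, Real.rpow_one]; ring
  rw [e1] at h3
  rcases abs_cases τ with h4 | h4
  · have : τ = s := by linarith
    rw [this]
    linarith
  · have : τ = -s := by linarith
    rw [this]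
    linarith

end

lemma hasDerivAt_of_sandwich {f : ℝ → ℝ} {D C δ a : ℝ} (ha : 0 < a) (hδ : 0 < δ)
    (h : ∀ τ, |τ| ≤ δ → 0 ≤ f τ - f 0 - D * τ ∧ f τ - f 0 - D * τ ≤ C * |τ| ^ (1 + a)) :
    HasDerivAt f D 0 := by
  rw [hasDerivAt_iff_isLittleO]
  have ht : Filter.Tendsto (fun τ : ℝ => C * |τ| ^ a) (nhds 0) (nhds 0) := by
    have : ContinuousAt (fun τ : ℝ => C * |τ| ^ a) 0 :=
      continuousAt_const.mul (continuous_abs.continuousAt.rpow_const (Or.inr ha.le))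
    simpa [ContinuousAt, Real.zero_rpow ha.ne'] using this
  rw [Asymptotics.isLittleO_iff]
  intro c hc
  have h1 : ∀ᶠ τ : ℝ in nhds 0, |τ| ≤ δ := by
    have := Metric.closedBall_mem_nhds (0 : ℝ) hδ
    filter_upwards [this] with τ hτ
    simpa using hτ
  filter_upwards [h1, ht.eventually (gt_mem_nhds hc)] with τ h1 h2
  obtain ⟨h3, h4⟩ := h τ h1
  have h5 : C * |τ| ^ (1 + a) ≤ c * |τ| := by
    rcases eq_or_ne τ 0 with rfl | h0
    · simp [Real.zero_rpow (by positivity : 1 + a ≠ 0)]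
    · rw [Real.rpow_add (abs_pos.2 h0), Real.rpow_one]
      nlinarith [abs_pos.2 h0]
  rw [sub_zero, smul_eq_mul, Real.norm_eq_abs, Real.norm_eq_abs, abs_of_nonneg (by linarith)]
  linarith

section
variable {lam Lam p T : ℝ} {Ω : Set (E n)} {u : E n → ℝ → ℝ} {e x y : E n} {N d β : ℝ}
  {K γ κ : ℝ}

/-- The constant in the Hölder estimate for the directional derivative. -/
def holderConst (n : ℕ) (d K : ℝ) : ℝ := secondConst n d K + 16 / d + 512 / d ^ 2 + 8 / d

lemma holderConst_ge {d : ℝ} (hd : 0 < d) : 8 / d ≤ holderConst n d K := by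
  have h1 : 0 ≤ secondConst n d K := by unfold secondConst; positivity
  have h2 : 0 < 16 / d := by positivity
  have h3 : 0 < 512 / d ^ 2 := by positivity
  unfold holderConst
  linarith

lemma differentiableAt_and_abs_dirDeriv_le (c : Ctx lam Lam p T Ω u e x N d β)
    (P : Params n p lam Lam β K γ κ) (hβ : 0 < β) (i₀ : Fin n) :
    DifferentiableAt ℝ (fun s : ℝ => u (x + s • e) 0) 0 ∧
      |dirDeriv (fun z => u z 0) e x| ≤ 8 * N / d ∧
      ∀ τ : ℝ, |τ| ≤ d / 32 →
        0 ≤ u (x + τ • e) 0 - u x 0 - dirDeriv (fun z => u z 0) e x * τ ∧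
        u (x + τ • e) 0 - u x 0 - dirDeriv (fun z => u z 0) e x * τ ≤
          secondConst n d K * N * |τ| ^ (1 + κ / 2) := by
  obtain ⟨D, hD, h⟩ := line_expansion c P hβ i₀
  have hder : HasDerivAt (fun s : ℝ => u (x + s • e) 0) D 0 :=
    hasDerivAt_of_sandwich (half_pos P.κ_pos) (by linarith [c.d_pos] : 0 < d / 32)
      (C := secondConst n d K * N) (by simpa using h)
  have hDeq : dirDeriv (fun z => u z 0) e x = D := hder.deriv
  rw [hDeq]
  exact ⟨hder.differentiableAt, hD, h⟩

lemma dirDeriv_sub_le (cx : Ctx lam Lam p T Ω u e x N d β) (cy : Ctx lam Lam p T Ω u e y N d β)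
    (P : Params n p lam Lam β K γ κ) (hβ : 0 < β) (i₀ : Fin n) (hxy : x ≠ y) :
    dirDeriv (fun z => u z 0) e y - dirDeriv (fun z => u z 0) e x ≤
      holderConst n d K * N * ‖x - y‖ ^ (κ / 2 / (1 + κ / 2)) := by
  obtain ⟨-, hDx, hx⟩ := differentiableAt_and_abs_dirDeriv_le cx P hβ i₀
  obtain ⟨-, hDy, hy⟩ := differentiableAt_and_abs_dirDeriv_le cy P hβ i₀
  set Dx := dirDeriv (fun z => u z 0) e x
  set Dy := dirDeriv (fun z => u z 0) e y
  have hd := cx.d_pos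
  have hd1 := cx.d_le
  have hN := cx.N_pos
  have hκ := P.κ_pos
  have hκ1 := P.κ_le i₀
  set a := κ / 2 with ha
  have ha0 : 0 < a := by positivity
  have hr : 0 < ‖x - y‖ := norm_pos_iff.2 (sub_ne_zero.2 hxy)
  set r := ‖x - y‖ with hrdef
  set s := r ^ (1 / (1 + a)) with hs
  have hs0 : 0 < s := Real.rpow_pos_of_pos hr _
  have hsr : s ^ (1 + a) = r := by
    rw [hs, ← Real.rpow_mul hr.le, one_div_mul_cancel (by positivity), Real.rpow_one]
  have hsa : s ^ a = r ^ (a / (1 + a)) := by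
    rw [hs, ← Real.rpow_mul hr.le]; congr 1; ring
  rw [← hsa]
  have hsa0 : 0 < s ^ a := Real.rpow_pos_of_pos hs0 _
  have hC1 : 0 ≤ secondConst n d K := by unfold secondConst; positivity
  have hrs : r = s * s ^ a := by rw [← hsr, Real.rpow_add hs0, Real.rpow_one]
  have e1 : 0 ≤ 16 / d := by positivity
  have e2 : 0 ≤ 512 / d ^ 2 := by positivity
  have e3 : 0 ≤ 8 / d := by positivity
  rcases le_or_gt s (d / 32) with hsd | hsd
  · have habs : |s| ≤ d / 32 := by rwa [abs_of_pos hs0]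
    have h1 := (hx s habs).2
    have h2 := (hy s habs).1
    rw [abs_of_pos hs0, hsr] at h1
    have hrd : r ≤ d / 32 := by
      have : s ^ a ≤ 1 := Real.rpow_le_one hs0.le (by linarith) ha0.le
      nlinarith
    have hlip1 := cx.lipschitz (y := x) (z := y) (mem_ball_self (by linarith)) (by
      rw [mem_ball, dist_eq_norm, norm_sub_rev]; linarith)
    have hlip2 := cx.lipschitz (y := y + s • e) (z := x + s • e) (by
      rw [mem_ball, dist_eq_norm]
      calc ‖y + s • e - x‖ = ‖(y - x) + s • e‖ := by congr 1; abel
        _ ≤ ‖y - x‖ + ‖s • e‖ := norm_add_le _ _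
        _ = r + s := by
          rw [norm_sub_rev, norm_smul, cx.e_norm, mul_one, Real.norm_of_nonneg hs0.le]
        _ < d / 2 := by linarith) (by
      rw [mem_ball, dist_eq_norm, add_sub_cancel_left, norm_smul, cx.e_norm, mul_one,
        Real.norm_of_nonneg hs0.le]; linarith)
    rw [add_sub_add_right_eq_sub, norm_sub_rev, ← hrdef] at hlip2
    rw [← hrdef] at hlip1
    have h3 : (Dy - Dx) * s ≤ (secondConst n d K + 16 / d) * N * s ^ a * s := by
      calc (Dy - Dx) * s ≤ secondConst n d K * N * r + 2 * (8 * N / d * r) := by linarith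
        _ = _ := by rw [hrs]; ring
    have h4 := le_of_mul_le_mul_right h3 hs0
    refine h4.trans ?_
    unfold holderConst
    have : 0 ≤ (512 / d ^ 2 + 8 / d) * N * s ^ a := by positivity
    linarith
  · have h1 : d / 32 ≤ s ^ a := by
      calc d / 32 = (d / 32) ^ (1 : ℝ) := (Real.rpow_one _).symm
        _ ≤ (d / 32) ^ a := Real.rpow_le_rpow_of_exponent_ge (by positivity) (by linarith)
            (by linarith)
        _ ≤ s ^ a := Real.rpow_le_rpow (by positivity) hsd.le ha0.le
    have h2 : Dy - Dx ≤ 16 * N / d := by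
      have e5 : 16 * N / d = 2 * (8 * N / d) := by ring
      rw [e5]
      linarith [abs_le.1 hDx, abs_le.1 hDy]
    have h3 : 16 * N / d ≤ 512 / d ^ 2 * N * s ^ a := by
      calc 16 * N / d = 512 / d ^ 2 * N * (d / 32) := by field_simp; norm_num
        _ ≤ _ := by gcongr
    unfold holderConst
    have : 0 ≤ (secondConst n d K + 16 / d + 8 / d) * N * s ^ a := by positivity
    linarith

lemma abs_dirDeriv_sub_le (cx : Ctx lam Lam p T Ω u e x N d β)
    (cy : Ctx lam Lam p T Ω u e y N d β)
    (P : Params n p lam Lam β K γ κ) (hβ : 0 < β) (i₀ : Fin n) (hxy : x ≠ y) :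
    |dirDeriv (fun z => u z 0) e x - dirDeriv (fun z => u z 0) e y| ≤
      holderConst n d K * N * ‖x - y‖ ^ (κ / 2 / (1 + κ / 2)) := by
  rw [abs_sub_le_iff]
  refine ⟨?_, dirDeriv_sub_le cx cy P hβ i₀ hxy⟩
  rw [norm_sub_rev]
  exact dirDeriv_sub_le cy cx P hβ i₀ hxy.symm

end

lemma setDist_le {A B : Set (E n)} {x w : E n} (hx : x ∈ A) (hw : w ∈ B) :
    setDist A B ≤ dist x w :=
  csInf_le ⟨0, by rintro _ ⟨a, -, b, -, rfl⟩; exact dist_nonneg⟩ (mem_image2_of_mem hx hw)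

lemma setDist_frontier_pos {D K : Set (E n)} (hD : IsOpen D) (hK : IsCompact K) (hKD : K ⊆ D)
    (hKne : K.Nonempty) (hF : (frontier D).Nonempty) : 0 < setDist K (frontier D) := by
  obtain ⟨δ, hδ, h⟩ := hK.exists_thickening_subset_open hD hKD
  refine hδ.trans_le (le_csInf (hKne.image2 hF) ?_)
  rintro _ ⟨x, hx, w, hw, rfl⟩
  by_contra! hlt
  rw [hD.frontier_eq] at hw
  exact hw.2 (h (mem_thickening_iff.2 ⟨x, hx, by rwa [dist_comm]⟩))

lemma ball_setDist_frontier_subset {D K : Set (E n)} (hD : IsOpen D) (hKD : K ⊆ D) {x : E n}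
    (hx : x ∈ K) : ball x (setDist K (frontier D)) ⊆ D := by
  intro z hz
  by_contra hzD
  have hcover : ball x (setDist K (frontier D)) ⊆ D ∪ (closure D)ᶜ := by
    intro w hw
    by_contra hwD
    have hwF : w ∈ frontier D := by
      rw [hD.frontier_eq]
      exact ⟨by_contra fun h => hwD (Or.inr h), fun h => hwD (Or.inl h)⟩
    have := setDist_le hx hwF
    rw [mem_ball, dist_comm] at hw
    linarith
  obtain ⟨w, -, hw, hw'⟩ := (convex_ball x (setDist K (frontier D))).isPreconnected D (closure D)ᶜ
    hD isClosed_closure.isOpen_compl hcover ⟨x, mem_ball_self (pos_of_mem_ball hz), hKD hx⟩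
    ⟨z, hz, (hcover hz).resolve_left hzD⟩
  exact hw' (subset_closure hw)

/-- The hypotheses on the solution and on its initial slice. -/
structure InitialData (lam Lam p T : ℝ) (Ω : Set (E n)) (y₀ : E n) (u : E n → ℝ → ℝ) (e : E n)
    (N β : ℝ) : Prop where
  isOpen : IsOpen Ω
  conv : Convex ℝ Ω
  sub : Ω ⊆ ball y₀ 1
  T_pos : 0 < T
  sol : ViscositySolution lam Lam p Ω (-T) 0 u
  bdry : ∀ x ∈ frontier Ω, ∀ t ∈ Icc (-T) 0, 1 < u x t
  zero_mem : (0 : E n) ∈ Ω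
  zero_val : u 0 0 = 0
  e_norm : ‖e‖ = 1
  diff : ∀ x ∈ closure {x ∈ Ω | u x (-T) < 1},
    DifferentiableAt ℝ (fun s : ℝ => u (x + s • e) (-T)) 0
  bound : ∀ x ∈ closure {x ∈ Ω | u x (-T) < 1}, |dirDeriv (fun z => u z (-T)) e x| ≤ N
  holder : ∀ x ∈ closure {x ∈ Ω | u x (-T) < 1}, ∀ y ∈ closure {x ∈ Ω | u x (-T) < 1},
    x ≠ y → |dirDeriv (fun z => u z (-T)) e x - dirDeriv (fun z => u z (-T)) e y| ≤
      N * ‖x - y‖ ^ β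

namespace InitialData
variable {lam Lam p T : ℝ} {Ω : Set (E n)} {y₀ : E n} {u : E n → ℝ → ℝ} {e x : E n} {N β : ℝ}

lemma continuousOn_slice (H : InitialData lam Lam p T Ω y₀ u e N β) {t : ℝ}
    (ht : t ∈ Icc (-T) 0) : ContinuousOn (fun x => u x t) (closure Ω) :=
  H.sol.1.cont.comp (f := fun x => (x, t)) (by fun_prop) fun _ hx => ⟨hx, ht⟩

lemma isOpen_sublevel (H : InitialData lam Lam p T Ω y₀ u e N β) {t : ℝ}
    (ht : t ∈ Icc (-T) 0) : IsOpen {x ∈ Ω | u x t < 1} :=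
  ((H.continuousOn_slice ht).mono subset_closure).isOpen_inter_preimage H.isOpen isOpen_Iio

lemma neg_T_mem (H : InitialData lam Lam p T Ω y₀ u e N β) : -T ∈ Icc (-T) 0 :=
  ⟨le_rfl, by linarith [H.T_pos]⟩

lemma zero_mem_Icc (H : InitialData lam Lam p T Ω y₀ u e N β) : (0 : ℝ) ∈ Icc (-T) 0 :=
  ⟨by linarith [H.T_pos], le_rfl⟩

lemma sublevel_mono (H : InitialData lam Lam p T Ω y₀ u e N β) :
    {x ∈ Ω | u x 0 < 1} ⊆ {x ∈ Ω | u x (-T) < 1} := fun x hx =>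
  ⟨hx.1, (H.sol.1.mono x (subset_closure hx.1) _ H.neg_T_mem _ H.zero_mem_Icc
    H.neg_T_mem.2).trans_lt hx.2⟩

lemma closure_sublevel (H : InitialData lam Lam p T Ω y₀ u e N β)
    (hx : x ∈ closure {x ∈ Ω | u x (-T) < 1}) : x ∈ Ω ∧ u x (-T) ≤ 1 := by
  have hcl : IsClosed (closure Ω ∩ (fun x => u x (-T)) ⁻¹' Iic 1) :=
    (H.continuousOn_slice H.neg_T_mem).preimage_isClosed_of_isClosed isClosed_closure isClosed_Iic
  have hsub : {x ∈ Ω | u x (-T) < 1} ⊆ closure Ω ∩ (fun x => u x (-T)) ⁻¹' Iic 1 :=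
    fun y hy => ⟨subset_closure hy.1, hy.2.le⟩
  have h := closure_minimal hsub hcl hx
  refine ⟨?_, h.2⟩
  by_contra hxO
  have := H.bdry x (by rw [H.isOpen.frontier_eq]; exact ⟨h.1, hxO⟩) (-T) H.neg_T_mem
  exact absurd h.2 (not_le.2 this)

lemma exists_dirDeriv_eq_slope (H : InitialData lam Lam p T Ω y₀ u e N β) {a b : ℝ} (hab : a < b)
    (h : ∀ s ∈ Icc a b, x + s • e ∈ closure {x ∈ Ω | u x (-T) < 1}) :
    ∃ s ∈ Ioo a b, u (x + b • e) (-T) - u (x + a • e) (-T) =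
      dirDeriv (fun z => u z (-T)) e (x + s • e) * (b - a) := by
  have hder : ∀ s ∈ Icc a b, HasDerivAt (fun s : ℝ => u (x + s • e) (-T))
      (dirDeriv (fun z => u z (-T)) e (x + s • e)) s := by
    intro s hs
    have h1 : HasDerivAt (fun r : ℝ => u (x + s • e + r • e) (-T))
        (dirDeriv (fun z => u z (-T)) e (x + s • e)) (s - s) := by
      rw [sub_self]
      exact (H.diff _ (h s hs)).hasDerivAt
    have h2 : HasDerivAt (fun r : ℝ => r - s) 1 s := (hasDerivAt_id s).sub_const s
    have h3 := HasDerivAt.comp (h := fun r : ℝ => r - s) s h1 h2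
    rw [mul_one] at h3
    refine h3.congr_of_eventuallyEq (Filter.Eventually.of_forall fun r => ?_)
    simp only [Function.comp_apply]
    rw [add_assoc, ← add_smul, add_sub_cancel]
  obtain ⟨c, hc, hc'⟩ := exists_hasDerivAt_eq_slope _ _ hab
    (fun s hs => (hder s hs).continuousAt.continuousWithinAt)
    (fun s hs => hder s (Ioo_subset_Icc_self hs))
  refine ⟨c, hc, ?_⟩
  rw [hc', div_mul_cancel₀ _ (by linarith)]

lemma lower_sublevel (H : InitialData lam Lam p T Ω y₀ u e N β)
    (hx : x ∈ {x ∈ Ω | u x (-T) < 1}) : 1 - 2 * N ≤ u x (-T) := by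
  set S := {x ∈ Ω | u x (-T) < 1} with hS
  have hSo : IsOpen S := H.isOpen_sublevel H.neg_T_mem
  have hcont : Continuous fun s : ℝ => x + s • e := by fun_prop
  have hF : IsCompact (Icc (0 : ℝ) 2 ∩ (fun s : ℝ => x + s • e) ⁻¹' Sᶜ) :=
    isCompact_Icc.inter_right (hSo.isClosed_compl.preimage hcont)
  have h2 : (2 : ℝ) ∈ Icc (0 : ℝ) 2 ∩ (fun s : ℝ => x + s • e) ⁻¹' Sᶜ := by
    refine ⟨by norm_num, fun h => ?_⟩
    have ha := H.sub h.1
    have hb := H.sub hx.1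
    rw [mem_ball] at ha hb
    have : dist (x + (2 : ℝ) • e) x = 2 := by simp [norm_smul, H.e_norm]
    linarith [dist_triangle_right (x + (2 : ℝ) • e) x y₀]
  obtain ⟨b, ⟨⟨hb0, hb2⟩, hbS⟩, hmin⟩ := hF.exists_isLeast ⟨2, h2⟩
  have hb : 0 < b := by
    rcases hb0.eq_or_lt with rfl | h
    · exact absurd hx (by simpa using hbS)
    · exact h
  have hin : ∀ s ∈ Ico 0 b, x + s • e ∈ S := by
    intro s hs
    by_contra hsS
    exact absurd (hmin ⟨⟨hs.1, hs.2.le.trans hb2⟩, hsS⟩) (not_le.2 hs.2)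
  have hcl : ∀ s ∈ Icc 0 b, x + s • e ∈ closure S := by
    intro s hs
    rw [← closure_Ico hb.ne] at hs
    exact map_mem_closure (f := fun s : ℝ => x + s • e) hcont hs hin
  obtain ⟨hbO, -⟩ := H.closure_sublevel (hcl b ⟨hb0, le_rfl⟩)
  have hge : 1 ≤ u (x + b • e) (-T) := by
    by_contra! hlt
    exact hbS ⟨hbO, hlt⟩
  obtain ⟨s, hs, hslope⟩ := H.exists_dirDeriv_eq_slope hb hcl
  have hbd := H.bound _ (hcl s (Ioo_subset_Icc_self hs))
  have hN : 0 ≤ N := (abs_nonneg _).trans hbd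
  rw [zero_smul, add_zero, sub_zero] at hslope
  have h3 := mul_le_mul ((le_abs_self _).trans hbd) hb2 hb0 hN
  linarith

lemma N_ge (H : InitialData lam Lam p T Ω y₀ u e N β) : 1 / 2 ≤ N := by
  have h0 : (0 : E n) ∈ {x ∈ Ω | u x 0 < 1} := ⟨H.zero_mem, by rw [H.zero_val]; norm_num⟩
  have h1 := H.lower_sublevel (H.sublevel_mono h0)
  have h2 := H.sol.1.mono 0 (subset_closure H.zero_mem) _ H.neg_T_mem _ H.zero_mem_Icc
    H.neg_T_mem.2
  rw [H.zero_val] at h2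
  linarith

lemma lower (H : InitialData lam Lam p T Ω y₀ u e N β) {t : ℝ} (hx : x ∈ closure Ω)
    (ht : t ∈ Icc (-T) 0) : 1 - 2 * N ≤ u x t := by
  have hN := H.N_ge
  by_cases hxO : x ∈ Ω
  · refine le_trans ?_ (H.sol.1.mono x hx _ H.neg_T_mem _ ht ht.1)
    rcases lt_or_ge (u x (-T)) 1 with h | h
    · exact H.lower_sublevel ⟨hxO, h⟩
    · linarith
  · have := H.bdry x (by rw [H.isOpen.frontier_eq]; exact ⟨hx, hxO⟩) t ht
    linarith

lemma second_difference (H : InitialData lam Lam p T Ω y₀ u e N β) (hβ0 : 0 < β) (hβ1 : β < 1)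
    {d : ℝ} (hball : ball x d ⊆ {x ∈ Ω | u x 0 < 1}) {s : ℝ} (hs : 0 < s) (hsd : s < d) :
    u (x + s • e) (-T) + u (x - s • e) (-T) - 2 * u x (-T) ≤ 2 * N * s ^ (1 + β) := by
  have hmem : ∀ r : ℝ, |r| ≤ s → x + r • e ∈ closure {x ∈ Ω | u x (-T) < 1} := fun r hr =>
    subset_closure (H.sublevel_mono (hball (by
      rw [mem_ball, dist_eq_norm, add_sub_cancel_left, norm_smul, H.e_norm, mul_one,
        Real.norm_eq_abs]
      linarith)))
  have hm1 : ∀ r ∈ Icc 0 s, x + r • e ∈ closure {x ∈ Ω | u x (-T) < 1} := fun r hr =>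
    hmem r (abs_le.2 ⟨by linarith [hr.1], hr.2⟩)
  have hm2 : ∀ r ∈ Icc (-s) 0, x + r • e ∈ closure {x ∈ Ω | u x (-T) < 1} := fun r hr =>
    hmem r (abs_le.2 ⟨hr.1, by linarith [hr.2]⟩)
  obtain ⟨a, ha, ha'⟩ := H.exists_dirDeriv_eq_slope hs hm1
  obtain ⟨b, hb, hb'⟩ := H.exists_dirDeriv_eq_slope (by linarith : -s < 0) hm2
  have hab : b < a := hb.2.trans ha.1
  have hnorm : ‖x + a • e - (x + b • e)‖ = a - b := by
    rw [add_sub_add_left_eq_sub, ← sub_smul, norm_smul, H.e_norm, mul_one,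
      Real.norm_of_nonneg (by linarith)]
  have hne : x + a • e ≠ x + b • e := by
    intro h
    rw [h, sub_self, norm_zero] at hnorm
    linarith
  have h1 := H.holder _ (hm1 a (Ioo_subset_Icc_self ha)) _ (hm2 b (Ioo_subset_Icc_self hb)) hne
  rw [hnorm] at h1
  have hN : 0 < N := by linarith [H.N_ge]
  have h2 : (a - b) ^ β ≤ 2 * s ^ β := by
    calc (a - b) ^ β ≤ (2 * s) ^ β :=
          Real.rpow_le_rpow (by linarith) (by linarith [ha.2, hb.1]) hβ0.le
      _ = 2 ^ β * s ^ β := Real.mul_rpow (by norm_num) hs.le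
      _ ≤ 2 ^ (1 : ℝ) * s ^ β := by
          gcongr
          norm_num
      _ = 2 * s ^ β := by rw [Real.rpow_one]
  have h3 := (le_abs_self _).trans h1
  have h4 : N * (a - b) ^ β ≤ N * (2 * s ^ β) := by gcongr
  have h5 := mul_le_mul_of_nonneg_right (h3.trans h4) hs.le
  rw [zero_smul, add_zero, sub_zero] at ha'
  rw [zero_smul, add_zero, neg_smul, ← sub_eq_add_neg] at hb'
  rw [Real.rpow_add hs, Real.rpow_one]
  linarith

lemma ctx (H : InitialData lam Lam p T Ω y₀ u e N β) (hp : 0 < p) (hlam : 0 < lam)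
    (hll : lam ≤ Lam) (hβ0 : 0 < β) (hβ1 : β < 1) {K : Set (E n)} (hK : IsCompact K)
    (hKD : K ⊆ {x ∈ Ω | u x 0 < 1}) (hx : x ∈ K) :
    Ctx lam Lam p T Ω u e x N (min (setDist K (frontier {x ∈ Ω | u x 0 < 1})) 1) β := by
  have hF : (frontier {x ∈ Ω | u x 0 < 1}).Nonempty := by
    by_contra! h
    rcases isClopen_iff.1 (isClopen_iff_frontier_eq_empty.2 h) with h0 | h0
    · exact absurd (hKD hx) (by rw [h0]; exact notMem_empty x)
    · have h1 : y₀ + e ∈ {x ∈ Ω | u x 0 < 1} := by rw [h0]; trivial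
      have h2 := H.sub h1.1
      rw [mem_ball, dist_eq_norm, add_sub_cancel_left, H.e_norm] at h2
      exact lt_irrefl _ h2
  have hpos := setDist_frontier_pos (H.isOpen_sublevel H.zero_mem_Icc) hK hKD ⟨x, hx⟩ hF
  have hball : ball x (min (setDist K (frontier {x ∈ Ω | u x 0 < 1})) 1) ⊆
      {x ∈ Ω | u x 0 < 1} :=
    (ball_subset_ball (min_le_left _ _)).trans
      (ball_setDist_frontier_subset (H.isOpen_sublevel H.zero_mem_Icc) hKD hx)
  exact
    { lam_pos := hlam
      lam_le := hll
      p_pos := hp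
      isOpen := H.isOpen
      conv := H.conv
      bdd := ⟨y₀, H.sub⟩
      T_pos := H.T_pos
      sol := H.sol
      bdry := H.bdry
      e_norm := H.e_norm
      d_pos := lt_min hpos one_pos
      d_le := min_le_right _ _
      ball_sub := hball
      N_ge := H.N_ge
      lower := fun _ hx _ ht => H.lower hx ht
      init := fun _ hs hsd => H.second_difference hβ0 hβ1 hball hs hsd }

end InitialData

/-- Theorem 8.3: `C^{1,α}` regularity in a direction `e` in which the initial
data is `C^{1,β}`. -/
theorem stmt3 (n : ℕ) (hn : 1 ≤ n) (p lam Lam : ℝ)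
    (hp : 0 < p) (hlam : 0 < lam) (hll : lam ≤ Lam)
    (β : ℝ) (hβ0 : 0 < β) (hβ1 : β < 1) :
    ∃ α : ℝ, 0 < α ∧ ∃ C : ℝ → ℝ,
      ∀ (Ω : Set (E n)) (T : ℝ) (y₀ : E n) (u : E n → ℝ → ℝ) (e : E n) (N : ℝ),
        IsOpen Ω → Convex ℝ Ω → Ω ⊆ ball y₀ 1 →
        0 < T →
        ViscositySolution lam Lam p Ω (-T) 0 u →
        (∀ x ∈ frontier Ω, ∀ t ∈ Icc (-T) 0, 1 < u x t) →
        (0 : E n) ∈ Ω → u 0 0 = 0 →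
        ‖e‖ = 1 →
        -- the directional derivative of `u(·,-T)` exists on the closure of
        -- `S = {u(·,-T) < 1}` and has `C^β` norm at most `N` there:
        (∀ x ∈ closure {x ∈ Ω | u x (-T) < 1},
            DifferentiableAt ℝ (fun s : ℝ => u (x + s • e) (-T)) 0) →
        (∀ x ∈ closure {x ∈ Ω | u x (-T) < 1},
            |dirDeriv (fun z => u z (-T)) e x| ≤ N) →
        (∀ x ∈ closure {x ∈ Ω | u x (-T) < 1}, ∀ y ∈ closure {x ∈ Ω | u x (-T) < 1},
            x ≠ y → |dirDeriv (fun z => u z (-T)) e x - dirDeriv (fun z => u z (-T)) e y| ≤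
              N * ‖x - y‖ ^ β) →
        ∀ K : Set (E n), IsCompact K → K ⊆ {x ∈ Ω | u x 0 < 1} →
          (∀ x ∈ K, DifferentiableAt ℝ (fun s : ℝ => u (x + s • e) 0) 0) ∧
          (∀ x ∈ K, |dirDeriv (fun z => u z 0) e x| ≤
              C (setDist K (frontier {x ∈ Ω | u x 0 < 1})) * N) ∧
          (∀ x ∈ K, ∀ y ∈ K, x ≠ y →
            |dirDeriv (fun z => u z 0) e x - dirDeriv (fun z => u z 0) e y| ≤
              C (setDist K (frontier {x ∈ Ω | u x 0 < 1})) * N * ‖x - y‖ ^ α) := by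
  obtain ⟨M, γ, κ, P⟩ := exists_params (p := p) hn hlam (hlam.trans_le hll) hβ0
  have hκ := P.κ_pos
  let i₀ : Fin n := ⟨0, hn⟩
  refine ⟨κ / 2 / (1 + κ / 2), by positivity, fun δ => holderConst n (min δ 1) M, ?_⟩
  intro Ω T y₀ u e N hO hconv hsub hT hsol hbdry h0 hu0 he hdiff hbound hholder K hK hKD
  have H : InitialData lam Lam p T Ω y₀ u e N β :=
    ⟨hO, hconv, hsub, hT, hsol, hbdry, h0, hu0, he, hdiff, hbound, hholder⟩
  have hctx := fun x (hx : x ∈ K) => H.ctx hp hlam hll hβ0 hβ1 hK hKD hx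
  refine ⟨fun x hx => (differentiableAt_and_abs_dirDeriv_le (hctx x hx) P hβ0 i₀).1,
    fun x hx => ?_, fun x hx y hy hxy =>
      abs_dirDeriv_sub_le (hctx x hx) (hctx y hy) P hβ0 i₀ hxy⟩
  have c := hctx x hx
  refine (differentiableAt_and_abs_dirDeriv_le c P hβ0 i₀).2.1.trans ?_
  rw [mul_div_right_comm]
  exact mul_le_mul_of_nonneg_right (holderConst_ge c.d_pos) c.N_pos.le
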